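/- Let A → R be an injective homomorphism of commutative Noetherian rings making R a finitely generated A-module (a finite extension). If A is regular (the localization of A at every prime ideal is a regular local ring), then the inclusion A → R is split as a map of A-modules: there exists an A-linear map π : R → A whose composition with the inclusion is the identity on A. -/

import Mathlib

/-- A Noetherian local ring is regular if its maximal ideal can be generated by
`Krull dimension` many elements. -/
def IsRegularLocal (A : Type*) [CommRing A] [IsLocalRing A] : Prop :=
  IsNoetherianRing A ∧
    ∃ s : Finset A, Ideal.span (s : Set A) = IsLocalRing.maximalIdeal A ∧
      (s.card : WithBot ℕ∞) = ringKrullDim A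

/-- The first Koszul homology of the family `a` on `S ⧸ J` vanishes: every relation is a
consequence of the trivial ones. -/
def SyzTriv {S : Type*} [CommRing S] {ι : Type*} [Fintype ι] (J : Ideal S) (a : ι → S) : Prop :=
  ∀ s : ι → S, ∑ i, a i * s i ∈ J → ∃ c : ι → ι → S, (∀ i j, c i j = - c j i) ∧ (∀ i, c i i = 0) ∧
    ∀ i, s i - ∑ j, c i j * a j ∈ J

namespace SyzTriv

variable {S : Type*} [CommRing S] {ι κ : Type*} [Fintype ι] [Fintype κ] {J : Ideal S}

theorem mem_sup_span_range {a : ι → S} {y : S} :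
    y ∈ J ⊔ Ideal.span (Set.range a) ↔ ∃ s : ι → S, y - ∑ i, a i * s i ∈ J := by
  constructor
  · intro h
    obtain ⟨j, hj, z, hz, rfl⟩ := Submodule.mem_sup.1 h
    obtain ⟨s, rfl⟩ := (Ideal.mem_span_range_iff_exists_fun).1 hz
    exact ⟨s, by simpa [mul_comm] using hj⟩
  · rintro ⟨s, hs⟩
    have : y = (y - ∑ i, a i * s i) + ∑ i, a i * s i := by ring
    rw [this]
    refine add_mem (Ideal.mem_sup_left hs) (Ideal.mem_sup_right (sum_mem fun i _ => ?_))
    exact Ideal.mul_mem_right _ _ (Ideal.subset_span ⟨i, rfl⟩)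

theorem sum_alternating {a : ι → S} {c : ι → ι → S} (h1 : ∀ i j, c i j = - c j i)
    (h2 : ∀ i, c i i = 0) : ∑ i, a i * ∑ j, c i j * a j = 0 := by
  classical
  simp_rw [Finset.mul_sum]
  rw [← Finset.sum_product']
  refine Finset.sum_involution (fun p _ => (p.2, p.1)) ?_ ?_ ?_ ?_
  · rintro ⟨i, j⟩ -
    simp only
    rw [h1 i j]; ring
  · rintro ⟨i, j⟩ - h heq
    simp only [Prod.mk.injEq] at heq
    obtain ⟨rfl, -⟩ := heq
    simp [h2] at h
  · simp
  · simp

theorem reindex {a : ι → S} (e : κ ≃ ι) (h : SyzTriv J a) : SyzTriv J (a ∘ e) := by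
  intro s hs
  obtain ⟨c, h1, h2, h3⟩ := h (s ∘ e.symm) (by
    rw [← e.sum_comp]; simpa using hs)
  refine ⟨fun i j => c (e i) (e j), fun i j => h1 _ _, fun i => h2 _, fun i => ?_⟩
  have := h3 (e i)
  rw [← e.sum_comp] at this
  simpa using this

theorem congr {a b : ι → S} (hab : ∀ i, a i - b i ∈ J) (h : SyzTriv J a) : SyzTriv J b := by
  intro s hs
  obtain ⟨c, h1, h2, h3⟩ := h s (by
    have : ∑ i, a i * s i = ∑ i, b i * s i + ∑ i, (a i - b i) * s i := by
      rw [← Finset.sum_add_distrib]; exact Finset.sum_congr rfl fun i _ => by ring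
    rw [this]
    exact add_mem hs (sum_mem fun i _ => Ideal.mul_mem_right _ _ (hab i)))
  refine ⟨c, h1, h2, fun i => ?_⟩
  have : s i - ∑ j, c i j * b j = (s i - ∑ j, c i j * a j) + ∑ j, c i j * (a j - b j) := by
    simp only [mul_sub, Finset.sum_sub_distrib]; ring
  rw [this]
  exact add_mem (h3 i) (sum_mem fun j _ => Ideal.mul_mem_left _ _ (hab j))

theorem append {a : ι → S} {b : κ → S} (ha : SyzTriv J a)
    (hb : SyzTriv (J ⊔ Ideal.span (Set.range a)) b) : SyzTriv J (Sum.elim a b) := by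
  intro s hs
  simp only [Fintype.sum_sum_type, Sum.elim_inl, Sum.elim_inr] at hs
  obtain ⟨c, h1, h2, h3⟩ := hb (fun k => s (Sum.inr k)) (mem_sup_span_range.2
    ⟨fun i => - s (Sum.inl i), by simpa [add_comm] using hs⟩)
  choose e he using fun k => mem_sup_span_range.1 (h3 k)
  have hs2 : ∑ i, a i * (s (Sum.inl i) + ∑ k, e k i * b k) ∈ J := by
    have key : ∑ i, a i * (s (Sum.inl i) + ∑ k, e k i * b k)
        = (∑ i, a i * s (Sum.inl i) + ∑ k, b k * s (Sum.inr k)) -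
          ∑ k, b k * (s (Sum.inr k) - ∑ l, c k l * b l - ∑ i, a i * e k i)
          - ∑ k, b k * ∑ l, c k l * b l := by
      have h4 : ∑ i, a i * ∑ k, e k i * b k = ∑ k, b k * ∑ i, a i * e k i := by
        simp_rw [Finset.mul_sum]
        rw [Finset.sum_comm]
        exact Finset.sum_congr rfl fun k _ => Finset.sum_congr rfl fun i _ => by ring
      simp only [mul_add, mul_sub, Finset.sum_add_distrib, Finset.sum_sub_distrib, h4]
      ring
    rw [key, sum_alternating h1 h2, sub_zero]
    exact sub_mem hs (sum_mem fun k _ => Ideal.mul_mem_left _ _ (he k))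
  obtain ⟨c', h1', h2', h3'⟩ := ha _ hs2
  refine ⟨Sum.elim (fun i => Sum.elim (fun j => c' i j) (fun k => - e k i))
    (fun k => Sum.elim (fun i => e k i) (fun l => c k l)), ?_, ?_, ?_⟩
  · rintro (i | k) (j | l)
    · exact h1' _ _
    · simp
    · simp
    · exact h1 _ _
  · rintro (i | k)
    · exact h2' _
    · exact h2 _
  · rintro (i | k)
    · have := h3' i
      simp only [Fintype.sum_sum_type, Sum.elim_inl, Sum.elim_inr]
      convert this using 1
      simp only [neg_mul, Finset.sum_neg_distrib]; ring
    · have := he k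
      simp only [Fintype.sum_sum_type, Sum.elim_inl, Sum.elim_inr]
      convert this using 1
      simp only [mul_comm (a _)]; ring

theorem of_append {a : ι → S} {b : κ → S} (h : SyzTriv J (Sum.elim a b)) :
    SyzTriv (J ⊔ Ideal.span (Set.range a)) b := by
  intro t ht
  obtain ⟨s, hs⟩ := mem_sup_span_range.1 ht
  obtain ⟨c, h1, h2, h3⟩ := h (Sum.elim (fun i => - s i) t) (by
    simpa [add_comm, sub_eq_add_neg] using hs)
  refine ⟨fun k l => c (Sum.inr k) (Sum.inr l), fun _ _ => h1 _ _, fun _ => h2 _, fun k => ?_⟩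
  have := h3 (Sum.inr k)
  simp only [Fintype.sum_sum_type, Sum.elim_inl, Sum.elim_inr] at this
  refine mem_sup_span_range.2 ⟨fun i => c (Sum.inr k) (Sum.inl i), ?_⟩
  convert this using 1
  simp only [mul_comm (a _)]; ring

theorem append_comm {a : ι → S} {b : κ → S} (h : SyzTriv J (Sum.elim a b)) :
    SyzTriv J (Sum.elim b a) := by
  have := h.reindex (Equiv.sumComm κ ι)
  convert this using 1
  ext (i | i) <;> rfl

theorem of_append_left {a : ι → S} {b : κ → S} (h : SyzTriv J (Sum.elim a b)) :
    SyzTriv (J ⊔ Ideal.span (Set.range b)) a := h.append_comm.of_append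

theorem of_isEmpty [IsEmpty ι] (a : ι → S) : SyzTriv J a :=
  fun _ _ => ⟨fun i => isEmptyElim i, fun i => isEmptyElim i, fun i => isEmptyElim i,
    fun i => isEmptyElim i⟩

theorem unique [Unique ι] {a : ι → S} (h : ∀ s, a default * s ∈ J → s ∈ J) : SyzTriv J a := by
  intro s hs
  refine ⟨fun _ _ => 0, by simp, by simp, fun i => ?_⟩
  obtain rfl := Unique.eq_default i
  simpa using h _ (by simpa using hs)

theorem mul_at [DecidableEq ι] {x y w : ι → S} (i : ι) (hx : SyzTriv J x) (hy : SyzTriv J y)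
    (hyx : ∀ j, j ≠ i → y j = x j) (hwx : ∀ j, j ≠ i → w j = x j) (hw : w i = x i * y i) :
    SyzTriv J w := by
  intro s hs
  set s' : ι → S := fun j => if j = i then y i * s i else s j with hs'
  obtain ⟨c, h1, h2, h3⟩ := hx s' (by
    convert hs using 2 with j
    by_cases hj : j = i
    · subst hj; simp [hs', hw, mul_assoc]
    · simp [hs', hj, hwx])
  set s'' : ι → S := fun j => if j = i then s i else c j i with hs''
  obtain ⟨d, g1, g2, g3⟩ := hy s'' (by
    have key : ∑ j, y j * s'' j = s' i - ∑ j, c i j * x j := by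
      have : ∀ j, y j * s'' j = (if j = i then s' i else 0) - c i j * x j := by
        intro j
        by_cases hj : j = i
        · subst hj; simp [hs', hs'', h2]
        · simp only [hs'', hj, if_false, hyx j hj, h1 i j]; ring
      simp only [this, Finset.sum_sub_distrib, Finset.sum_ite_eq', Finset.mem_univ, if_true]
    rw [key]; exact h3 i)
  refine ⟨fun j k => if j = i ∨ k = i then d j k else x i * d j k + c j k, ?_, ?_, ?_⟩
  · intro j k
    simp only [or_comm (a := k = i)]
    split_ifs
    · exact g1 _ _
    · rw [g1 j k, h1 j k]; ring
  · intro j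
    simp [g2, h2]
  · intro j
    by_cases hj : j = i
    · subst hj
      have := g3 j
      simp only [hs'', if_true] at this
      convert this using 2
      refine Finset.sum_congr rfl fun k _ => ?_
      by_cases hk : k = j
      · subst hk; simp [g2]
      · simp [hwx k hk, hyx k hk]
    · have a1 := h3 j
      have a2 := Ideal.mul_mem_left J (x i) (g3 j)
      have := add_mem a1 a2
      simp only [hs', hs'', hj, if_false] at this
      convert this using 1
      have : ∀ k, (if j = i ∨ k = i then d j k else x i * d j k + c j k) * w k =
          x i * (d j k * y k) + c j k * x k - (if k = i then c j i * x i else 0) := by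
        intro k
        by_cases hk : k = i
        · subst hk; simp [hw]; ring
        · simp [hj, hk, hwx k hk, hyx k hk]; ring
      simp only [this, Finset.sum_sub_distrib, Finset.sum_add_distrib, ← Finset.mul_sum,
        Finset.sum_ite_eq', Finset.mem_univ, if_true]
      ring

theorem pow {x : ι → S} (hx : SyzTriv J x) (e : ι → ℕ) (he : ∀ i, 1 ≤ e i) :
    SyzTriv J (fun i => x i ^ e i) := by
  classical
  suffices H : ∀ T : Finset ι, SyzTriv J (fun i => x i ^ (if i ∈ T then e i else 1)) by
    simpa using H Finset.univ
  intro T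
  induction T using Finset.induction_on with
  | empty => simpa using hx
  | insert i T hi ih =>
    have H : ∀ k, SyzTriv J (fun j => x j ^ (if j = i then k + 1 else if j ∈ T then e j else 1)) := by
      intro k
      induction k with
      | zero =>
        convert ih using 3 with j
        by_cases hj : j = i
        · subst hj; simp [hi]
        · simp [hj]
      | succ k ihk =>
        refine mul_at i ihk ih (fun j hj => by simp [hj]) (fun j hj => by simp [hj]) ?_
        simp [hi, pow_succ]
    convert H (e i - 1) using 3 with j
    by_cases hj : j = i
    · subst hj; simp [he]
    · simp [hj]

/-- Colon property at one index. -/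
theorem colon_at [DecidableEq ι] {w x : ι → S} (i : ι) {a b : S} (hx : SyzTriv J x)
    (hxi : x i = a) (hw : w i = a * b) (hwx : ∀ j, j ≠ i → w j = x j) {v : S}
    (hv : a * v ∈ J ⊔ Ideal.span (Set.range w)) :
    v ∈ J ⊔ Ideal.span (Set.range (Function.update w i b)) := by
  obtain ⟨s, hs⟩ := mem_sup_span_range.1 hv
  obtain ⟨c, h1, h2, h3⟩ := hx (fun j => if j = i then v - b * s i else - s j) (by
    convert hs using 1
    rw [← Finset.add_sum_erase _ _ (Finset.mem_univ i),
      ← Finset.add_sum_erase (f := fun j => w j * s j) _ (Finset.mem_univ i)]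
    have : ∑ j ∈ Finset.univ.erase i, x j * (if j = i then v - b * s i else - s j) =
        - ∑ j ∈ Finset.univ.erase i, w j * s j := by
      rw [← Finset.sum_neg_distrib]
      refine Finset.sum_congr rfl fun j hj => ?_
      have := Finset.ne_of_mem_erase hj
      simp [this, hwx]
    rw [this]
    simp [hxi, hw]; ring)
  refine mem_sup_span_range.2 ⟨fun j => if j = i then s i else c i j, ?_⟩
  have := h3 i
  simp only [if_true] at this
  convert this using 1
  rw [← Finset.add_sum_erase _ _ (Finset.mem_univ i),
      ← Finset.add_sum_erase (f := fun j => c i j * x j) _ (Finset.mem_univ i)]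
  have : ∑ j ∈ Finset.univ.erase i, Function.update w i b j * (if j = i then s i else c i j) =
      ∑ j ∈ Finset.univ.erase i, c i j * x j := by
    refine Finset.sum_congr rfl fun j hj => ?_
    have := Finset.ne_of_mem_erase hj
    simp [this, hwx, mul_comm]
  rw [this]
  simp [h2]; ring

/-- Multi-exponent colon property. -/
theorem colon {x : ι → S} (hx : SyzTriv J x) (e n : ι → ℕ) (hen : ∀ i, e i ≤ n i) {v : S}
    (hv : (∏ i, x i ^ e i) * v ∈ J ⊔ Ideal.span (Set.range fun i => x i ^ n i)) :
    v ∈ J ⊔ Ideal.span (Set.range fun i => x i ^ (n i - e i)) := by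
  classical
  suffices H : ∀ T : Finset ι, ∀ v, (∏ i ∈ T, x i ^ e i) * v ∈ J ⊔ Ideal.span (Set.range fun i => x i ^ n i) →
      v ∈ J ⊔ Ideal.span (Set.range fun i => x i ^ (n i - if i ∈ T then e i else 0)) by
    simpa using H Finset.univ v hv
  intro T
  induction T using Finset.induction_on with
  | empty => intro v hv; simpa using hv
  | insert i T hi ih =>
    intro v hv
    rw [Finset.prod_insert hi, mul_comm (x i ^ e i), mul_assoc] at hv
    have h1 := ih _ hv
    by_cases htriv : ∃ j, n j - (if j ∈ insert i T then e j else 0) = 0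
    · obtain ⟨j, hj⟩ := htriv
      refine Ideal.mem_sup_right ?_
      have : (1 : S) ∈ Ideal.span (Set.range fun i' => x i' ^ (n i' - if i' ∈ insert i T then e i' else 0)) :=
        Ideal.subset_span ⟨j, by simp only [hj, pow_zero]⟩
      rw [(Ideal.eq_top_iff_one _).2 this]; trivial
    push Not at htriv
    by_cases hei : e i = 0
    · convert h1 using 7 with j
      · by_cases hj : j = i
        · subst hj; simp [hei]
        · simp [hj]
      · simp [hei]
    have h2 := colon_at (J := J) (i := i) (a := x i ^ e i) (b := x i ^ (n i - e i))
      (x := fun j => x j ^ (if j = i then e i else n j - if j ∈ T then e j else 0))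
      (w := fun j => x j ^ (n j - if j ∈ T then e j else 0)) ?_ (by simp)
      (by simp [hi, ← pow_add, hen]) (fun j hj => by simp [hj]) h1
    · convert h2 using 4
      ext j
      by_cases hj : j = i
      · subst hj; simp
      · simp [hj]
    · refine hx.pow _ fun j => ?_
      by_cases hj : j = i
      · subst hj; simp; omega
      · have := htriv j
        simp [hj] at this ⊢; omega

/-- Perturbing a parameter by a combination of the others. -/
theorem of_unit_append_sub {p : S} {x f : ι → S} (h : SyzTriv J (Sum.elim (fun _ : Unit => p) x)) :
    SyzTriv (J ⊔ Ideal.span {p - ∑ i, x i * f i}) x := by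
  intro s hs
  obtain ⟨j, hj, z, hz, hjz⟩ := Submodule.mem_sup.1 hs
  obtain ⟨y, rfl⟩ := Ideal.mem_span_singleton'.1 hz
  obtain ⟨c, h1, h2, h3⟩ := h (Sum.elim (fun _ => - y) (fun i => s i + f i * y)) (by
    simp only [Fintype.sum_sum_type, Sum.elim_inl, Sum.elim_inr, Finset.univ_unique,
      Finset.sum_singleton, mul_add, Finset.sum_add_distrib, ← hjz]
    convert hj using 1
    have : ∑ i, x i * (f i * y) = y * ∑ i, x i * f i := by
      rw [Finset.mul_sum]; exact Finset.sum_congr rfl fun i _ => by ring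
    rw [this]; ring)
  have hy := h3 (Sum.inl ())
  simp only [Fintype.sum_sum_type, Sum.elim_inl, Sum.elim_inr, Finset.univ_unique,
      Finset.sum_singleton, h2, zero_mul, zero_add] at hy
  set d : ι → S := fun i => c (Sum.inl ()) (Sum.inr i) with hd
  refine ⟨fun i k => c (Sum.inr i) (Sum.inr k) + f i * d k - d i * f k, ?_, ?_, ?_⟩
  · intro i k; beta_reduce; rw [h1 (Sum.inr i)]; ring
  · intro i; beta_reduce; rw [h2]; ring
  · intro i
    have hi := h3 (Sum.inr i)
    simp only [Fintype.sum_sum_type, Sum.elim_inl, Sum.elim_inr, Finset.univ_unique,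
      Finset.sum_singleton] at hi
    rw [h1, show c (Sum.inl ()) (Sum.inr i) = d i from rfl] at hi
    have e1 := Ideal.mul_mem_left J (f i) hy
    have key : s i - ∑ k, (c (Sum.inr i) (Sum.inr k) + f i * d k - d i * f k) * x k =
        (s i + f i * y - (- d i * p + ∑ k, c (Sum.inr i) (Sum.inr k) * x k)) +
        f i * (- y - ∑ k, d k * x k) - d i * (p - ∑ k, x k * f k) := by
      simp only [add_mul, sub_mul, Finset.sum_add_distrib, Finset.sum_sub_distrib, mul_assoc,
        ← Finset.mul_sum, mul_comm (f _) (x _)]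
      ring
    rw [key]
    refine sub_mem (Ideal.mem_sup_left (add_mem hi e1)) (Ideal.mem_sup_right ?_)
    exact Ideal.mul_mem_left _ _ (Ideal.mem_span_singleton_self _)

end SyzTriv

section

namespace SyzTriv

variable {S : Type*} [CommRing S] {ι κ : Type*} [Fintype ι] [Fintype κ] {J : Ideal S}

theorem of_surjective {S' : Type*} [CommRing S'] (f : S →+* S') (hf : Function.Surjective f)
    {J' : Ideal S'} {a : ι → S} (h : SyzTriv J' (f ∘ a)) : SyzTriv (J'.comap f) a := by
  classical
  intro s hs
  obtain ⟨c, h1, h2, h3⟩ := h (f ∘ s) (by simpa [Ideal.mem_comap, map_sum] using hs)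
  choose g hg using hf
  let e := Fintype.equivFin ι
  have hlift : ∀ i j, f (if e i < e j then g (c i j) else if e j < e i then - g (c j i) else 0) =
      c i j := by
    intro i j
    split_ifs with h h'
    · exact hg _
    · rw [map_neg, hg, h1 i j]
    · have : i = j := e.injective (le_antisymm (not_lt.1 h') (not_lt.1 h))
      subst this; simp [h2]
  refine ⟨fun i j => if e i < e j then g (c i j) else if e j < e i then - g (c j i) else 0,
    ?_, ?_, ?_⟩
  · intro i j
    rcases lt_trichotomy (e i) (e j) with h | h | h
    · simp [h, h.not_gt]
    · simp [h]
    · simp [h, h.not_gt]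
  · simp
  · intro i
    have := h3 i
    rw [Ideal.mem_comap]
    simp only [map_sub, map_sum, map_mul, hlift]
    simpa using this

theorem map_surjective {S' : Type*} [CommRing S'] (f : S →+* S') (hf : Function.Surjective f)
    {J' : Ideal S'} {a : ι → S} (h : SyzTriv (J'.comap f) a) : SyzTriv J' (f ∘ a) := by
  intro s hs
  choose g hg using hf
  obtain ⟨c, h1, h2, h3⟩ := h (g ∘ s) (by simpa [Ideal.mem_comap, map_sum, hg] using hs)
  refine ⟨fun i j => f (c i j), fun i j => by beta_reduce; rw [h1 i j, map_neg], fun i => by simp [h2], fun i => ?_⟩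
  have := h3 i
  simpa [Ideal.mem_comap, map_sum, hg] using this

theorem quotient_iff {a : ι → S} :
    SyzTriv (⊥ : Ideal (S ⧸ J)) (Ideal.Quotient.mk J ∘ a) ↔ SyzTriv J a := by
  have hJ : (⊥ : Ideal (S ⧸ J)).comap (Ideal.Quotient.mk J) = J := by
    rw [← RingHom.ker_eq_comap_bot, Ideal.mk_ker]
  constructor
  · intro h
    have := of_surjective _ Ideal.Quotient.mk_surjective h
    rwa [hJ] at this
  · intro h
    exact map_surjective _ Ideal.Quotient.mk_surjective (by rwa [hJ])

end SyzTriv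

open IsLocalRing

section Regular

universe u

private theorem span_range_succAbove {A : Type*} [CommRing A] {d : ℕ} (x : Fin (d + 1) → A)
    (i : Fin (d + 1)) {y : A} (hy : x i ∈ Ideal.span {y} ⊔ Ideal.span (Set.range (x ∘ i.succAbove)))
    (hy' : y ∈ Ideal.span (Set.range x)) :
    Ideal.span {y} ⊔ Ideal.span (Set.range (x ∘ i.succAbove)) = Ideal.span (Set.range x) := by
  apply le_antisymm
  · refine sup_le ?_ ?_
    · rwa [Ideal.span_singleton_le_iff_mem]
    · exact Ideal.span_mono (Set.range_comp_subset_range _ _)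
  · rw [Ideal.span_le]
    rintro _ ⟨j, rfl⟩
    rcases Fin.eq_self_or_eq_succAbove i j with rfl | ⟨k, rfl⟩
    · exact hy
    · exact Ideal.mem_sup_right (Ideal.subset_span ⟨k, rfl⟩)

theorem le_ringKrullDim_quotient_singleton {A : Type u} [CommRing A] [IsLocalRing A] [IsNoetherianRing A]
    {d : ℕ} (hd : ((d + 1 : ℕ) : WithBot ℕ∞) ≤ ringKrullDim A) {y : A} (hy : y ∈ maximalIdeal A) :
    ((d : ℕ) : WithBot ℕ∞) ≤ ringKrullDim (A ⧸ Ideal.span {y}) := by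
  have h := ringKrullDim_le_ringKrullDim_quotient_add_card ({y} : Finset A) (by
    simpa [IsLocalRing.ringJacobson_eq_maximalIdeal] using hy)
  rw [Finset.coe_singleton, Finset.card_singleton] at h
  have h2 := hd.trans h
  generalize ringKrullDim (A ⧸ Ideal.span {y}) = a at h2 ⊢
  induction a with
  | bot => simp at h2
  | coe a =>
    induction a with
    | top => exact le_top
    | coe a =>
      have h3 : ((d + 1 : ℕ) : WithBot ℕ∞) ≤ ((a + 1 : ℕ) : WithBot ℕ∞) := by exact_mod_cast h2
      have := Nat.cast_le.1 h3
      have h4 : d ≤ a := by omega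
      exact_mod_cast h4

private theorem map_span_quotient {A : Type u} [CommRing A] [IsLocalRing A] {d : ℕ} {x' : Fin d → A} {y : A}
    [Nontrivial (A ⧸ Ideal.span {y})]
    (h : Ideal.span {y} ⊔ Ideal.span (Set.range x') = maximalIdeal A) 
     :
    haveI := IsLocalRing.of_surjective' (Ideal.Quotient.mk (Ideal.span {y})) Ideal.Quotient.mk_surjective
    Ideal.span (Set.range (Ideal.Quotient.mk (Ideal.span {y}) ∘ x')) =
      maximalIdeal (A ⧸ Ideal.span {y}) := by
  have := IsLocalRing.of_surjective' (Ideal.Quotient.mk (Ideal.span {y})) Ideal.Quotient.mk_surjective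
  rw [← IsLocalRing.map_maximalIdeal_of_surjective _ Ideal.Quotient.mk_surjective, ← h, Ideal.map_sup, Set.range_comp,
    Ideal.map_span _ (Set.range x'), Ideal.map_quotient_self, bot_sup_eq]

theorem isDomain_of_regular (d : ℕ) : ∀ (A : Type u) [CommRing A] [IsLocalRing A] [IsNoetherianRing A]
    (x : Fin d → A), Ideal.span (Set.range x) = maximalIdeal A →
    (d : WithBot ℕ∞) ≤ ringKrullDim A → IsDomain A := by
  induction d with
  | zero =>
    intro A _ _ _ x hx _
    have : maximalIdeal A = ⊥ := by rw [← hx]; simp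
    have := (IsLocalRing.isField_iff_maximalIdeal_eq (R := A)).2 this
    exact this.isDomain
  | succ d ih =>
    intro A _ _ _ x hx hd
    have hnot : ∀ P ∈ minimalPrimes A, ¬ maximalIdeal A ≤ P := by
      intro P hP hle
      have hmax : maximalIdeal A = P :=
        (IsLocalRing.maximalIdeal.isMaximal A).eq_of_le hP.1.1.ne_top hle
      have h0 : (maximalIdeal A).height = 0 := by
        rw [hmax]; have := hP.1.1; exact Ideal.height_eq_zero_iff.2 hP
      have := IsLocalRing.maximalIdeal_height_eq_ringKrullDim (R := A)
      rw [h0] at this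
      rw [← this] at hd
      have h3 : ((d + 1 : ℕ) : WithBot ℕ∞) ≤ ((0 : ℕ) : WithBot ℕ∞) := by simpa using hd
      have := Nat.cast_le.1 h3
      omega
    have hnot2 : ¬ maximalIdeal A ≤ maximalIdeal A ^ 2 := by
      intro hle
      have : maximalIdeal A = ⊥ := by
        refine Submodule.eq_bot_of_le_smul_of_le_jacobson_bot (maximalIdeal A) _
          (IsNoetherian.noetherian _) (by rwa [smul_eq_mul, ← pow_two]) ?_
        exact IsLocalRing.maximalIdeal_le_jacobson _
      obtain ⟨P, hP⟩ := (Ideal.nonempty_minimalPrimes (I := (⊥ : Ideal A)) bot_ne_top)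
      exact hnot P hP (by rw [this]; exact bot_le)
    obtain ⟨y, hym, hy2, hyP⟩ : ∃ y ∈ maximalIdeal A, y ∉ maximalIdeal A ^ 2 ∧
        ∀ P ∈ minimalPrimes A, y ∉ P := by
      by_contra! hcon
      have hfin := minimalPrimes.finite_of_isNoetherianRing A
      classical
      have := (Ideal.subset_union_prime (s := insert (maximalIdeal A ^ 2) hfin.toFinset) (f := id)
        (maximalIdeal A ^ 2) (maximalIdeal A ^ 2) (I := maximalIdeal A) (by
          intro i hi hne _
          rcases Finset.mem_insert.1 hi with h | h
          · exact absurd h hne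
          · exact (hfin.mem_toFinset.1 h).1.1)).1 (by
          intro y hy
          simp only [Set.mem_iUnion]
          by_cases h2 : y ∈ maximalIdeal A ^ 2
          · exact ⟨_, by simp, h2⟩
          · obtain ⟨P, hP, hyP⟩ := hcon y hy h2
            exact ⟨P, by simp [hP], hyP⟩)
      obtain ⟨I, hI, hle⟩ := this
      rcases Finset.mem_insert.1 hI with h | h
      · subst h; exact hnot2 hle
      · exact hnot I (hfin.mem_toFinset.1 h) hle
    obtain ⟨a, ha⟩ := Ideal.mem_span_range_iff_exists_fun.1 (hx ▸ hym)
    obtain ⟨i, hi⟩ : ∃ i, IsUnit (a i) := by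
      by_contra! hcon
      apply hy2
      rw [← ha, pow_two]
      exact sum_mem fun i _ => Ideal.mul_mem_mul ((IsLocalRing.mem_maximalIdeal _).2 (hcon i))
        (hx ▸ Ideal.subset_span ⟨i, rfl⟩)
    have hsup := span_range_succAbove x i (y := y) (by
      obtain ⟨u, hu⟩ := hi
      rw [Fin.sum_univ_succAbove _ i, ← hu] at ha
      have : x i = ↑u⁻¹ * (y - ∑ j, a (i.succAbove j) * x (i.succAbove j)) := by
        rw [← ha]; simp
      rw [this]
      refine Ideal.mul_mem_left _ _ (sub_mem (Ideal.mem_sup_left (Ideal.mem_span_singleton_self _))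
        (sum_mem fun j _ => Ideal.mem_sup_right (Ideal.mul_mem_left _ _ (Ideal.subset_span ⟨j, rfl⟩))))) (hx ▸ hym)
    rw [hx] at hsup
    have : Nontrivial (A ⧸ Ideal.span {y}) := Ideal.Quotient.nontrivial_iff.2 (by
      rw [Ne, Ideal.span_singleton_eq_top]; exact hym)
    have := IsLocalRing.of_surjective' (Ideal.Quotient.mk (Ideal.span {y})) Ideal.Quotient.mk_surjective
    have := ih (A ⧸ Ideal.span {y}) _ (map_span_quotient hsup) (le_ringKrullDim_quotient_singleton hd hym)
    have hprime : (Ideal.span {y}).IsPrime := (Ideal.Quotient.isDomain_iff_prime _).1 this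
    obtain ⟨P, hP, hPy⟩ := Ideal.exists_minimalPrimes_le (I := ⊥) (J := Ideal.span {y}) bot_le
    have hP' := hP.1.1
    have hPbot : P = ⊥ := by
      refine Submodule.eq_bot_of_le_smul_of_le_jacobson_bot (maximalIdeal A) _
          (IsNoetherian.noetherian _) ?_ (IsLocalRing.maximalIdeal_le_jacobson _)
      intro b hb
      obtain ⟨c, rfl⟩ := Ideal.mem_span_singleton'.1 (hPy hb)
      have := (hP'.mem_or_mem hb).resolve_right (hyP P hP)
      rw [mul_comm]
      exact Ideal.mul_mem_mul hym this
    rw [hPbot] at hP'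
    exact IsDomain.of_bot_isPrime A

theorem syzTriv_of_regular (d : ℕ) : ∀ (A : Type u) [CommRing A] [IsLocalRing A] [IsNoetherianRing A]
    (x : Fin d → A), Ideal.span (Set.range x) = maximalIdeal A →
    (d : WithBot ℕ∞) ≤ ringKrullDim A → SyzTriv (⊥ : Ideal A) x := by
  induction d with
  | zero => intro A _ _ _ x _ _; exact SyzTriv.of_isEmpty _
  | succ d ih =>
    intro A _ _ _ x hx hd
    have := isDomain_of_regular _ A x hx hd
    have hym : x 0 ∈ maximalIdeal A := hx ▸ Ideal.subset_span ⟨0, rfl⟩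
    have hsup := span_range_succAbove x 0 (y := x 0)
      (Ideal.mem_sup_left (Ideal.mem_span_singleton_self _)) (Ideal.subset_span ⟨0, rfl⟩)
    rw [hx] at hsup
    have : Nontrivial (A ⧸ Ideal.span {x 0}) := Ideal.Quotient.nontrivial_iff.2 (by
      rw [Ne, Ideal.span_singleton_eq_top]; exact hym)
    have := IsLocalRing.of_surjective' (Ideal.Quotient.mk (Ideal.span {x 0})) Ideal.Quotient.mk_surjective
    have h0 : x 0 ≠ 0 := by
      intro h0
      have hs : Ideal.span (Set.range (x ∘ Fin.succ)) = maximalIdeal A := by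
        rw [← hsup, h0]; simp [Fin.succAbove_zero]
      classical
      have h := ringKrullDim_le_ringKrullDim_quotient_add_card (R := A) (Finset.univ.image (x ∘ Fin.succ)) (by
        rw [IsLocalRing.ringJacobson_eq_maximalIdeal, ← hs]
        rw [Finset.coe_image, Finset.coe_univ, Set.image_univ]
        exact Ideal.subset_span)
      have e : Ideal.span (((Finset.univ.image (x ∘ Fin.succ)) : Finset A) : Set A) = maximalIdeal A := by
        rw [Finset.coe_image, Finset.coe_univ, Set.image_univ, hs]
      rw [e] at h
      let := Ideal.Quotient.field (maximalIdeal A)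
      rw [ringKrullDim_eq_zero_of_field, zero_add] at h
      have h2 := Nat.cast_le.1 (hd.trans h)
      have := (Finset.card_image_le (s := Finset.univ) (f := x ∘ Fin.succ))
      simp at this
      omega
    have h1 := ih (A ⧸ Ideal.span {x 0}) _ (map_span_quotient hsup) (le_ringKrullDim_quotient_singleton hd hym)
    rw [SyzTriv.quotient_iff] at h1
    have h2 : SyzTriv (⊥ : Ideal A) (fun _ : Unit => x 0) :=
      SyzTriv.unique fun s hs => by simpa [h0] using hs
    have h3 := h2.append (b := x ∘ Fin.succ) (by
      rw [bot_sup_eq, Set.range_const]; simpa [Fin.succAbove_zero] using h1)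
    let e : Fin (d + 1) ≃ Unit ⊕ Fin d := (finSuccEquiv d).trans ((Equiv.optionEquivSumPUnit _).trans (Equiv.sumComm _ _))
    convert h3.reindex e using 1
    ext i
    refine Fin.cases ?_ (fun j => ?_) i
    · simp [e]
    · simp [e]

end Regular

end

section

open IsLocalRing

section Gorenstein

variable {A : Type*} [CommRing A] {ι : Type*} [Fintype ι] {x : ι → A}

theorem mk_mul_eq_of_mem_span {I : Ideal A} (T : Finset ι) (j : ι) (k : ι → ℕ) (p v : A)
    (hv : v ∈ Ideal.span (Set.range fun i => x i ^ k i))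
    (hp : ∀ i, i ≠ j → p * x i ^ k i ∈ I) : ∃ v', p * v - p * x j ^ k j * v' ∈ I := by
  classical
  obtain ⟨s, rfl⟩ := Ideal.mem_span_range_iff_exists_fun.1 hv
  refine ⟨s j, ?_⟩
  rw [← Finset.add_sum_erase _ _ (Finset.mem_univ j), mul_add,
    show p * (s j * x j ^ k j) = p * x j ^ k j * s j by ring, add_sub_cancel_left, Finset.mul_sum]
  refine sum_mem fun i hi => ?_
  rw [show p * (s i * x i ^ k i) = p * x i ^ k i * s i by ring]
  exact Ideal.mul_mem_right _ _ (hp i (Finset.ne_of_mem_erase hi))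

theorem prod_pow_mul_mem [DecidableEq ι] {t : ℕ} (ht : 1 ≤ t) (T : Finset ι) (i : ι)
    (k : ι → ℕ) (hk : ∀ i, k i ≠ 0) (hk' : i ∉ T → k i = t) :
    (∏ i ∈ T, x i ^ (t - 1)) * x i ^ k i ∈ Ideal.span (Set.range fun i => x i ^ t) := by
  by_cases hi : i ∈ T
  · rw [← Finset.mul_prod_erase _ _ hi]
    obtain ⟨m, hm⟩ := Nat.exists_eq_succ_of_ne_zero (hk i)
    have : x i ^ (t - 1) * (∏ j ∈ T.erase i, x j ^ (t - 1)) * x i ^ k i =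
        (∏ j ∈ T.erase i, x j ^ (t - 1)) * x i ^ m * x i ^ t := by
      obtain ⟨t, rfl⟩ := Nat.exists_eq_succ_of_ne_zero (by omega : t ≠ 0)
      simp [hm, pow_succ]; ring
    rw [this]
    exact Ideal.mul_mem_left _ _ (Ideal.subset_span ⟨i, rfl⟩)
  · rw [hk' hi]
    exact Ideal.mul_mem_left _ _ (Ideal.subset_span ⟨i, rfl⟩)

variable (hx : SyzTriv (⊥ : Ideal A) x) {t : ℕ} (ht : 1 ≤ t)
include hx ht

theorem SyzTriv.annihilator_mem (T : Finset ι) (y : A)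
    (hy : ∀ i ∈ T, x i * y ∈ Ideal.span (Set.range fun i => x i ^ t)) :
    ∃ v, y - (∏ i ∈ T, x i ^ (t - 1)) * v ∈ Ideal.span (Set.range fun i => x i ^ t) := by
  classical
  induction T using Finset.induction_on with
  | empty => exact ⟨y, by simp⟩
  | insert j T hj ih =>
    obtain ⟨v, hv⟩ := ih fun i hi => hy i (Finset.mem_insert_of_mem hi)
    have h1 : (∏ i, x i ^ (if i = j then 1 else if i ∈ T then t - 1 else 0)) * v ∈
        (⊥ : Ideal A) ⊔ Ideal.span (Set.range fun i => x i ^ t) := by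
      rw [bot_sup_eq]
      have e : (∏ i, x i ^ (if i = j then 1 else if i ∈ T then t - 1 else 0)) =
          x j * ∏ i ∈ T, x i ^ (t - 1) := by
        rw [← Finset.mul_prod_erase _ _ (Finset.mem_univ j)]
        simp only [if_true, pow_one]
        congr 1
        rw [← Finset.prod_subset (Finset.subset_univ T |>.trans' (Finset.Subset.refl T) |> fun _ => 
          (Finset.subset_erase.2 ⟨Finset.subset_univ T, hj⟩))]
        · refine Finset.prod_congr rfl fun i hi => ?_
          have : i ≠ j := fun h => hj (h ▸ hi)
          simp [this, hi]
        · intro i hi hiT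
          simp [Finset.ne_of_mem_erase hi, hiT]
      rw [e]
      have h2 := hy j (Finset.mem_insert_self _ _)
      have h3 := Ideal.mul_mem_left _ (x j) hv
      convert sub_mem h2 h3 using 1
      ring
    have h2 := hx.colon _ _ (fun i => by split_ifs <;> omega) h1
    rw [bot_sup_eq] at h2
    obtain rfl | ht2 : t = 1 ∨ 2 ≤ t := by omega
    · exact ⟨v, by simpa using hv⟩
    obtain ⟨v', hv'⟩ := mk_mul_eq_of_mem_span T j _ (∏ i ∈ T, x i ^ (t - 1)) v h2
      (I := Ideal.span (Set.range fun i => x i ^ t)) (fun i hi => by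
        refine prod_pow_mul_mem (x := x) ht T i
          (fun i => t - if i = j then 1 else if i ∈ T then t - 1 else 0) (fun i => ?_) (fun h => ?_)
        · split_ifs <;> omega
        · simp [h, hi])
    refine ⟨v', ?_⟩
    rw [Finset.prod_insert hj]
    convert add_mem hv hv' using 1
    simp only [if_true]; ring

theorem SyzTriv.exists_mul_eq (y : ι → A)
    (hcomm : ∀ i j, x i * y j - x j * y i ∈ Ideal.span (Set.range fun i => x i ^ t))
    (hkill : ∀ i, x i ^ (t - 1) * y i ∈ Ideal.span (Set.range fun i => x i ^ t)) :
    ∃ g, ∀ i, y i - x i * g ∈ Ideal.span (Set.range fun i => x i ^ t) := by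
  classical
  suffices H : ∀ T : Finset ι, ∃ g, ∀ i ∈ T,
      y i - x i * g ∈ Ideal.span (Set.range fun i => x i ^ t) by simpa using H Finset.univ
  intro T
  induction T using Finset.induction_on with
  | empty => exact ⟨0, by simp⟩
  | insert j T hj ih =>
    obtain ⟨g, hg⟩ := ih
    obtain ⟨v, hv⟩ := hx.annihilator_mem ht T (y j - x j * g) (fun i hi => by
      have := add_mem (hcomm i j) (Ideal.mul_mem_left _ (x j) (hg i hi))
      convert this using 1; ring)
    have h1 : (∏ i, x i ^ (if i ∈ insert j T then t - 1 else 0)) * v ∈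
        (⊥ : Ideal A) ⊔ Ideal.span (Set.range fun i => x i ^ t) := by
      rw [bot_sup_eq]
      have e : (∏ i, x i ^ (if i ∈ insert j T then t - 1 else 0)) =
          x j ^ (t - 1) * ∏ i ∈ T, x i ^ (t - 1) := by
        rw [← Finset.prod_insert (f := fun i => x i ^ (t - 1)) hj, ← Finset.prod_subset (Finset.subset_univ (insert j T))]
        · exact Finset.prod_congr rfl fun i hi => by simp [hi]
        · intro i _ hiT
          simp [hiT]
      rw [e]
      have h2 := hkill j
      have h3 := Ideal.mul_mem_left _ (x j ^ (t - 1)) hv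
      have h4 : x j ^ (t - 1) * (x j * g) ∈ Ideal.span (Set.range fun i => x i ^ t) := by
        rw [← mul_assoc, ← pow_succ, Nat.sub_add_cancel ht]
        exact Ideal.mul_mem_right _ _ (Ideal.subset_span ⟨j, rfl⟩)
      convert sub_mem (sub_mem h2 h4) h3 using 1
      ring
    have h2 := hx.colon _ _ (fun i => by split_ifs <;> omega) h1
    rw [bot_sup_eq] at h2
    obtain ⟨v', hv'⟩ := mk_mul_eq_of_mem_span T j _ (∏ i ∈ T, x i ^ (t - 1)) v h2
      (I := Ideal.span (Set.range fun i => x i ^ t)) (fun i hi => by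
        refine prod_pow_mul_mem (x := x) ht T i
          (fun i => t - if i ∈ insert j T then t - 1 else 0) (fun i => ?_) (fun h => ?_)
        · split_ifs <;> omega
        · simp [h, hi])
    refine ⟨g + (∏ i ∈ T, x i ^ (t - 1)) * v', fun i hi => ?_⟩
    rcases Finset.mem_insert.1 hi with rfl | hi
    · convert add_mem hv hv' using 1
      simp only [Finset.mem_insert_self, if_true, show t - (t - 1) = 1 by omega]; ring
    · have h5 : (∏ i ∈ T, x i ^ (t - 1)) * x i ^ (if i ∈ T then 1 else t) ∈
        Ideal.span (Set.range fun i => x i ^ t) := prod_pow_mul_mem ht T i (fun i => if i ∈ T then 1 else t)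
          (fun i => by split_ifs <;> omega) (fun h => by simp [h])
      simp only [hi, if_true] at h5
      convert sub_mem (hg i hi) (Ideal.mul_mem_right v' _ h5) using 1
      ring

variable [IsLocalRing A] (hm : Ideal.span (Set.range x) = maximalIdeal A)
include hm

omit hx ht in
theorem exists_maximalIdeal_pow_le (t : ℕ) :
    ∃ k, maximalIdeal A ^ k ≤ Ideal.span (Set.range fun i => x i ^ t) := by
  rw [← hm]
  refine Ideal.exists_pow_le_of_le_radical_of_fg ?_ ?_
  · rw [Ideal.span_le]
    rintro _ ⟨i, rfl⟩
    exact ⟨t, Ideal.subset_span ⟨i, rfl⟩⟩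
  · exact ⟨Set.finite_range x |>.toFinset, by simp⟩

omit hx hm in
/-- A nonzero element of a module killed by a power of the maximal ideal has a nonzero multiple in
the socle. -/
theorem exists_socle {M : Type*} [AddCommGroup M] [Module A M] (N : Submodule A M) (m : M)
    (hmN : m ∉ N) (k : ℕ) (hk : ∀ a ∈ maximalIdeal A ^ k, a • m ∈ N) :
    ∃ b : A, b • m ∉ N ∧ ∀ a ∈ maximalIdeal A, a • b • m ∈ N := by
  induction k generalizing m with
  | zero => exact absurd (by simpa using hk 1 (by simp)) hmN
  | succ k ih =>
    by_cases h : ∀ a ∈ maximalIdeal A, a • m ∈ N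
    · exact ⟨1, by simpa using hmN, by simpa using h⟩
    · push Not at h
      obtain ⟨a, ha, ham⟩ := h
      obtain ⟨b, hb, hb'⟩ := ih (a • m) ham fun c hc => by
        rw [smul_smul]; exact hk _ (by rw [pow_succ]; exact Ideal.mul_mem_mul hc ha)
      exact ⟨b * a, by rwa [mul_smul], by simpa only [mul_smul] using hb'⟩

theorem SyzTriv.extend_one_step {M : Type*} [AddCommGroup M] [Module A M] (N : Submodule A M)
    (f : N →ₗ[A] A ⧸ Ideal.span (Set.range fun i => x i ^ t)) (m : M)
    (hM : ∀ a ∈ Ideal.span (Set.range fun i => x i ^ t), a • m = 0)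
    (hmN : ∀ a ∈ maximalIdeal A, a • m ∈ N) :
    ∃ y : A ⧸ Ideal.span (Set.range fun i => x i ^ t), ∀ a (ha : a • m ∈ N),
      a ∈ maximalIdeal A → f ⟨a • m, ha⟩ = a • y := by
  have hxm : ∀ i, x i ∈ maximalIdeal A := fun i => hm ▸ Ideal.subset_span ⟨i, rfl⟩
  choose y hy using fun i => Ideal.Quotient.mk_surjective (f ⟨x i • m, hmN _ (hxm i)⟩)
  have hsm : ∀ (a b : A), a • (Ideal.Quotient.mk (Ideal.span (Set.range fun i => x i ^ t)) b) =
      Ideal.Quotient.mk _ (a * b) := fun a b => rfl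
  obtain ⟨g, hg⟩ := hx.exists_mul_eq ht y (fun i j => by
      rw [← Ideal.Quotient.mk_eq_mk_iff_sub_mem, ← hsm, ← hsm, hy, hy, ← map_smul, ← map_smul]
      congr 1
      ext
      simp [smul_smul, mul_comm]) (fun i => by
      rw [← Ideal.Quotient.eq_zero_iff_mem, ← hsm, hy, ← map_smul]
      convert map_zero f using 2
      ext
      simp only [Submodule.coe_smul, smul_smul, ← pow_succ, Nat.sub_add_cancel ht]
      exact hM _ (Ideal.subset_span ⟨i, rfl⟩))
  refine ⟨Ideal.Quotient.mk _ g, fun a ha ham => ?_⟩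
  rw [← hm] at ham
  obtain ⟨s, rfl⟩ := Ideal.mem_span_range_iff_exists_fun.1 ham
  have : (⟨(∑ i, s i * x i) • m, ha⟩ : N) = ∑ i, s i • ⟨x i • m, hmN _ (hxm i)⟩ := by
    ext; simp [Finset.sum_smul, mul_smul]
  rw [this, map_sum, Finset.sum_smul]
  refine Finset.sum_congr rfl fun i _ => ?_
  rw [map_smul, ← hy, hsm, hsm, mul_assoc, ← hsm, ← hsm (s i) (x i * g)]
  congr 1
  exact (Ideal.Quotient.mk_eq_mk_iff_sub_mem _ _).2 (hg i)

theorem SyzTriv.extend {M : Type*} [AddCommGroup M] [Module A M] [IsNoetherian A M]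
    (hM : ∀ a ∈ Ideal.span (Set.range fun i => x i ^ t), ∀ m : M, a • m = 0)
    (f : M →ₗ.[A] A ⧸ Ideal.span (Set.range fun i => x i ^ t)) :
    ∃ g : M →ₗ[A] A ⧸ Ideal.span (Set.range fun i => x i ^ t), ∀ n : f.domain, g n = f n := by
  obtain ⟨N, f⟩ := f
  induction N using WellFoundedGT.induction with
  | ind N ih =>
  by_cases hN : N = ⊤
  · subst hN
    exact ⟨f ∘ₗ (Submodule.topEquiv (R := A) (M := M)).symm.toLinearMap, fun n => rfl⟩
  obtain ⟨m0, hm0⟩ : ∃ m, m ∉ N := by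
    by_contra! h; exact hN (eq_top_iff.2 fun m _ => h m)
  obtain ⟨k, hk⟩ := exists_maximalIdeal_pow_le hm t
  obtain ⟨b, hb, hb'⟩ := exists_socle ht N m0 hm0 k fun a ha => by rw [hM a (hk ha)]; exact zero_mem _
  set m := b • m0
  obtain ⟨y, hy⟩ := hx.extend_one_step ht hm N f m (fun a ha => hM a ha m) hb'
  have hmem : ∀ a, a • m ∈ N → a ∈ maximalIdeal A := by
    intro a ha
    by_contra h
    rw [IsLocalRing.mem_maximalIdeal, mem_nonunits_iff, not_not] at h
    obtain ⟨u, rfl⟩ := h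
    apply hb
    have := N.smul_mem (↑u⁻¹ : A) ha
    rwa [smul_smul, Units.inv_mul, one_smul] at this
  let g0 : M →ₗ.[A] A ⧸ Ideal.span (Set.range fun i => x i ^ t) :=
    LinearPMap.mkSpanSingleton' m y fun c hc => by
      have h0 : c • m ∈ N := by rw [hc]; exact zero_mem _
      show c • y = 0
      rw [← hy c h0 (hmem c h0)]
      convert map_zero f
      exact hc
  have hagree : ∀ (p : (LinearPMap.mk N f).domain) (q : g0.domain), (p : M) = q →
      (LinearPMap.mk N f) p = g0 q := by
    rintro ⟨p, hp⟩ ⟨q, hq⟩ rfl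
    obtain ⟨c, rfl⟩ := Submodule.mem_span_singleton.1 hq
    rw [LinearPMap.mkSpanSingleton'_apply]
    exact hy c hp (hmem c hp)
  obtain ⟨g, hg⟩ := ih (N ⊔ Submodule.span A {m}) (by
    refine lt_of_le_of_ne le_sup_left fun h => hb ?_
    rw [h]; exact Submodule.mem_sup_right (Submodule.mem_span_singleton_self _))
    ((LinearPMap.mk N f).sup g0 hagree).toFun
  refine ⟨g, fun n => ?_⟩
  have h1 := hg ⟨n, Submodule.mem_sup_left n.2⟩
  rw [h1]
  have h2 := (LinearPMap.left_le_sup (LinearPMap.mk N f) g0 hagree).2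
    (x := n) (y := ⟨n, Submodule.mem_sup_left n.2⟩) rfl
  exact h2.symm

theorem SyzTriv.le_of_prod_notMem (K : Ideal A) (hK : Ideal.span (Set.range fun i => x i ^ t) ≤ K)
    (hz : ∏ i, x i ^ (t - 1) ∉ K) : K ≤ Ideal.span (Set.range fun i => x i ^ t) := by
  intro a haK
  by_contra ha
  obtain ⟨k, hk⟩ := exists_maximalIdeal_pow_le hm t
  obtain ⟨b, hb, hb'⟩ := exists_socle ht (M := A) (Ideal.span (Set.range fun i => x i ^ t)) a ha k
    fun c hc => Ideal.mul_mem_right _ _ (hk hc)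
  have hxm : ∀ i, x i ∈ maximalIdeal A := fun i => hm ▸ Ideal.subset_span ⟨i, rfl⟩
  obtain ⟨v, hv⟩ := hx.annihilator_mem ht Finset.univ (b • a) fun i _ => hb' _ (hxm i)
  by_cases hvu : IsUnit v
  · obtain ⟨u, rfl⟩ := hvu
    apply hz
    have h1 : (∏ i, x i ^ (t - 1)) * u ∈ K := by
      have := sub_mem (Ideal.mul_mem_left K b haK) (hK hv)
      simpa using this
    have := Ideal.mul_mem_right (↑u⁻¹ : A) _ h1
    rwa [mul_assoc, Units.mul_inv, mul_one] at this
  · have hvm : v ∈ maximalIdeal A := hvu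
    rw [← hm] at hvm
    obtain ⟨s, rfl⟩ := Ideal.mem_span_range_iff_exists_fun.1 hvm
    apply hb
    have : (∏ i, x i ^ (t - 1)) * ∑ i, s i * x i ∈ Ideal.span (Set.range fun i => x i ^ t) := by
      classical
      rw [Finset.mul_sum]
      refine sum_mem fun i _ => ?_
      have := prod_pow_mul_mem (x := x) ht Finset.univ i (fun _ => 1) (by simp) (by simp)
      have := Ideal.mul_mem_left _ (s i) this
      convert this using 1; ring
    have := add_mem hv this
    simpa using this

theorem SyzTriv.exists_quotient_splitting {R : Type*} [CommRing R] [Algebra A R] [IsNoetherian A R]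
    (h : ∏ i, x i ^ (t - 1) ∉ ((Ideal.span (Set.range fun i => x i ^ t)).map (algebraMap A R)).comap
      (algebraMap A R)) :
    ∃ g : R →ₗ[A] A ⧸ Ideal.span (Set.range fun i => x i ^ t), g 1 = 1 := by
  set I := Ideal.span (Set.range fun i => x i ^ t) with hI
  have hle := hx.le_of_prod_notMem ht hm _ Ideal.le_comap_map h
  have key : ∀ a : A, a • (1 : R ⧸ I.map (algebraMap A R)) = 0 ↔ a ∈ (I.map (algebraMap A R)).comap
      (algebraMap A R) := by
    intro a
    rw [Ideal.mem_comap, ← Ideal.Quotient.eq_zero_iff_mem, Algebra.smul_def, mul_one]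
    rfl
  have hf : ∀ a : A, a • (1 : R ⧸ I.map (algebraMap A R)) = 0 →
      RingHom.id A a • (1 : A ⧸ I) = 0 := fun c hc => by
    have : c ∈ I := hle ((key c).1 hc)
    rw [RingHom.id_apply, Algebra.smul_def, mul_one]
    exact Ideal.Quotient.eq_zero_iff_mem.2 this
  have hN : IsNoetherian A (R ⧸ I.map (algebraMap A R)) :=
    isNoetherian_of_surjective (Ideal.Quotient.mkₐ A (I.map (algebraMap A R))).toLinearMap
      (LinearMap.range_eq_top.2 Ideal.Quotient.mk_surjective)
  obtain ⟨g, hg⟩ := hx.extend ht hm (M := R ⧸ I.map (algebraMap A R)) (fun a ha m => by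
    rw [Algebra.smul_def]
    have : algebraMap A (R ⧸ I.map (algebraMap A R)) a = 0 :=
      Ideal.Quotient.eq_zero_iff_mem.2 (Ideal.mem_map_of_mem _ ha)
    rw [this, zero_mul]) (LinearPMap.mkSpanSingleton' _ _ hf)
  refine ⟨g ∘ₗ (Ideal.Quotient.mkₐ A (I.map (algebraMap A R))).toLinearMap, ?_⟩
  have h1 : (1 : R ⧸ I.map (algebraMap A R)) ∈ Submodule.span A {(1 : R ⧸ I.map (algebraMap A R))} :=
    Submodule.mem_span_singleton_self _
  have h2 := hg ⟨1, h1⟩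
  have h3 := LinearPMap.mkSpanSingleton'_apply (R := A) _ _ hf (1 : A) (by simpa using h1)
  simp only [one_smul, map_one] at h3
  simp only [LinearMap.comp_apply, AlgHom.toLinearMap_apply, map_one]
  exact h2.trans h3

/-- In `A / (x ^ t)`, the annihilator of the annihilator of `c` is the ideal generated by `c`. -/
theorem SyzTriv.mem_of_annihilator_le [IsNoetherianRing A] (c w : A)
    (h : ∀ a, a * c ∈ Ideal.span (Set.range fun i => x i ^ t) →
      a * w ∈ Ideal.span (Set.range fun i => x i ^ t)) :
    w ∈ Ideal.span {c} ⊔ Ideal.span (Set.range fun i => x i ^ t) := by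
  set I := Ideal.span (Set.range fun i => x i ^ t) with hI
  have key : ∀ a b : A, a • (Ideal.Quotient.mk I b) = 0 ↔ a * b ∈ I := by
    intro a b
    rw [← Ideal.Quotient.eq_zero_iff_mem]
    rfl
  have hf : ∀ a : A, a • (Ideal.Quotient.mk I c) = 0 → RingHom.id A a • (Ideal.Quotient.mk I w) = 0 :=
    fun a ha => (key a w).2 (h a ((key a c).1 ha))
  have hN : IsNoetherian A (A ⧸ I) :=
    isNoetherian_of_surjective (Ideal.Quotient.mkₐ A I).toLinearMap
      (LinearMap.range_eq_top.2 Ideal.Quotient.mk_surjective)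
  obtain ⟨g, hg⟩ := hx.extend ht hm (M := A ⧸ I) (fun a ha m => by
    rw [Algebra.smul_def]
    have : algebraMap A (A ⧸ I) a = 0 := Ideal.Quotient.eq_zero_iff_mem.2 ha
    rw [this, zero_mul]) (LinearPMap.mkSpanSingleton' (Ideal.Quotient.mk I c)
      (Ideal.Quotient.mk I w) hf)
  have h1 : Ideal.Quotient.mk I c ∈ Submodule.span A {Ideal.Quotient.mk I c} :=
    Submodule.mem_span_singleton_self _
  have h2 := hg ⟨_, h1⟩
  have h3 := LinearPMap.mkSpanSingleton'_apply (R := A) _ _ hf (1 : A) (by simpa using h1)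
  simp only [one_smul, map_one] at h3
  have h4 := h2.trans h3
  obtain ⟨b, hb⟩ := Ideal.Quotient.mk_surjective (g 1)
  have h5 : g (Ideal.Quotient.mk I c) = Ideal.Quotient.mk I (c * b) := by
    rw [show Ideal.Quotient.mk I c = c • (1 : A ⧸ I) by rw [Algebra.smul_def, mul_one]; rfl,
      map_smul, ← hb]
    rfl
  have h6 : w - c * b ∈ I := by
    rw [← Ideal.Quotient.mk_eq_mk_iff_sub_mem, ← h5]; exact h4.symm
  have h7 := add_mem (Submodule.mem_sup_left (S := Ideal.span {c}) (T := I)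
    (Ideal.mul_mem_right b _ (Ideal.mem_span_singleton_self c))) (Submodule.mem_sup_right h6)
  simpa using h7

omit hx ht hm in
theorem mem_range_of_forall_pow [IsNoetherianRing A] {M N : Type*} [AddCommGroup M] [Module A M]
    [AddCommGroup N] [Module A N] [Module.Finite A N] (f : M →ₗ[A] N) (y : N)
    (h : ∀ t, ∃ b, f b - y ∈ (maximalIdeal A ^ t) • (⊤ : Submodule A N)) : ∃ b, f b = y := by
  have h1 : (Submodule.Quotient.mk y : N ⧸ LinearMap.range f) = 0 := by
    have := Ideal.iInf_pow_smul_eq_bot_of_isLocalRing (M := N ⧸ LinearMap.range f) (maximalIdeal A)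
      Ideal.IsPrime.ne_top'
    rw [← Submodule.mem_bot A, ← this, Submodule.mem_iInf]
    intro t
    obtain ⟨b, hb⟩ := h t
    have h2 := Submodule.mem_map_of_mem (f := (LinearMap.range f).mkQ) hb
    rw [Submodule.map_smul''] at h2
    have h3 := Submodule.smul_mono le_rfl le_top h2
    rw [map_sub] at h3
    have h4 : (LinearMap.range f).mkQ (f b) = 0 := by simp
    rw [h4, zero_sub, neg_mem_iff] at h3
    exact h3
  simpa using h1

omit ht in
theorem SyzTriv.exists_splitting [IsNoetherianRing A] {R : Type*} [CommRing R] [Algebra A R]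
    [Module.Finite A R]
    (h : ∀ t, 1 ≤ t → ∏ i, x i ^ (t - 1) ∉
      ((Ideal.span (Set.range fun i => x i ^ t)).map (algebraMap A R)).comap (algebraMap A R)) :
    ∃ π : R →ₗ[A] A, π 1 = 1 := by
  obtain ⟨n, f, hf⟩ := Module.Finite.exists_fin' A R
  obtain ⟨e, he⟩ := hf 1
  obtain ⟨s, k, hk⟩ := Submodule.fg_iff_exists_fin_generating_family.1
    (IsNoetherian.noetherian (LinearMap.ker f))
  let K : Option (Fin s) → (Fin n → A) := fun o => o.elim e k
  obtain ⟨b, hb⟩ := mem_range_of_forall_pow (A := A)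
    (LinearMap.pi fun o : Option (Fin s) => Fintype.linearCombination A (K o))
    (Pi.single none 1) (by
      intro t
      obtain ⟨g, hg⟩ := hx.exists_quotient_splitting (t := t + 1) (by omega) hm (h (t + 1) (by omega))
      choose b hb using fun i => Ideal.Quotient.mk_surjective (g (f (Pi.single i 1)))
      refine ⟨b, ?_⟩
      have hgf : ∀ v : Fin n → A, Ideal.Quotient.mk _ (∑ i, b i * v i) = g (f v) := by
        intro v
        conv_rhs => rw [pi_eq_sum_univ' v]
        simp only [map_sum, map_smul, map_mul, hb]
        refine Finset.sum_congr rfl fun i _ => ?_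
        rw [Algebra.smul_def, mul_comm]; rfl
      have hle : Ideal.span (Set.range fun i => x i ^ (t + 1)) ≤ maximalIdeal A ^ t := by
        rw [Ideal.span_le]
        rintro _ ⟨i, rfl⟩
        exact Ideal.pow_le_pow_right (by omega : t ≤ t + 1)
          (Ideal.pow_mem_pow (hm ▸ Ideal.subset_span ⟨i, rfl⟩) _)
      have hmem : ∀ (u : Option (Fin s) → A), (∀ o, u o ∈ maximalIdeal A ^ t) →
          u ∈ maximalIdeal A ^ t • (⊤ : Submodule A (Option (Fin s) → A)) := by
        intro u hu
        rw [pi_eq_sum_univ' u]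
        exact sum_mem fun o _ => Submodule.smul_mem_smul (hu o) trivial
      apply hmem
      intro o
      apply hle
      rw [← Ideal.Quotient.eq_zero_iff_mem]
      simp only [Pi.sub_apply, LinearMap.pi_apply, Fintype.linearCombination_apply, smul_eq_mul,
        map_sub, hgf]
      cases o with
      | none => simp [K, he, hg]
      | some j =>
        have : f (k j) = 0 := by
          have : k j ∈ LinearMap.ker f := hk ▸ Submodule.subset_span ⟨j, rfl⟩
          exact this
        simp [K, this])
  have hb' : ∀ o, ∑ i, b i * K o i = (Pi.single none 1 : Option (Fin s) → A) o := by
    intro o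
    have := congrFun hb o
    simpa [Fintype.linearCombination_apply] using this
  have hker : LinearMap.ker f ≤ LinearMap.ker (Fintype.linearCombination A b) := by
    rw [← hk, Submodule.span_le]
    rintro _ ⟨j, rfl⟩
    have := hb' (some j)
    simp only [K, Option.elim] at this
    simp only [SetLike.mem_coe, LinearMap.mem_ker, Fintype.linearCombination_apply, smul_eq_mul]
    rw [← Finset.sum_congr rfl fun i _ => mul_comm (b i) _]
    simpa using this
  refine ⟨(LinearMap.ker f).liftQ _ hker ∘ₗ (f.quotKerEquivOfSurjective hf).symm.toLinearMap, ?_⟩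
  have : (f.quotKerEquivOfSurjective hf).symm 1 = Submodule.Quotient.mk e := by
    rw [LinearEquiv.symm_apply_eq, ← he]; rfl
  simp only [LinearMap.comp_apply, LinearEquiv.coe_coe, this]
  have h2 := hb' none
  simp only [K, Option.elim, Pi.single_eq_same] at h2
  rw [← h2]
  simp only [Submodule.liftQ_apply, Fintype.linearCombination_apply, smul_eq_mul, mul_comm,
    Submodule.liftQ_mkQ]

end Gorenstein

end

section

open IsLocalRing
section Normality

theorem IsRegularLocal.exists_parameters {A : Type*} [CommRing A] [IsLocalRing A]
    (h : IsRegularLocal A) : IsDomain A ∧ ∃ (d : ℕ) (x : Fin d → A),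
      Ideal.span (Set.range x) = maximalIdeal A ∧ SyzTriv (⊥ : Ideal A) x := by
  obtain ⟨hN, s, hs, hd⟩ := h
  have h1 : Ideal.span (Set.range fun i => (s.equivFin.symm i : A)) = maximalIdeal A := by
    rw [← hs]
    congr 1
    ext a
    constructor
    · rintro ⟨i, rfl⟩; exact (s.equivFin.symm i).2
    · intro ha; exact ⟨s.equivFin ⟨a, ha⟩, by simp⟩
  exact ⟨isDomain_of_regular _ A _ h1 hd.le, _, _, h1, syzTriv_of_regular _ A _ h1 hd.le⟩

theorem IsRegularLocal.of_ringEquiv {A B : Type*} [CommRing A] [IsLocalRing A] [CommRing B]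
    [IsLocalRing B] (e : A ≃+* B) (h : IsRegularLocal A) : IsRegularLocal B := by
  classical
  obtain ⟨hN, s, hs, hd⟩ := h
  refine ⟨isNoetherianRing_of_ringEquiv A e, s.image e, ?_, ?_⟩
  · have h1 := Ideal.map_span (e : A →+* B) s
    rw [hs, RingEquiv.coe_toRingHom] at h1
    rw [Finset.coe_image, ← h1]
    ext b
    rw [show ((e : A →+* B) : A →+* B) = ((e : A ≃+* B) : A →+* B) from rfl, Ideal.map_comap_of_equiv,
      Ideal.mem_comap, mem_maximalIdeal, mem_maximalIdeal, mem_nonunits_iff, mem_nonunits_iff]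
    exact not_congr (MulEquiv.isUnit_map e.symm)
  · rw [Finset.card_image_of_injective _ e.injective, hd, ringKrullDim_eq_of_ringEquiv e]

theorem SyzTriv.mem_span_of_mul_mem {A : Type*} [CommRing A] [IsLocalRing A] [IsNoetherianRing A]
    {ι : Type*} [Fintype ι] {x : ι → A} (hx : SyzTriv (⊥ : Ideal A) x)
    (hm : Ideal.span (Set.range x) = maximalIdeal A) {i j : ι} (hij : i ≠ j) (s : A)
    (h : x i * s ∈ Ideal.span {x j}) : s ∈ Ideal.span {x j} := by
  classical
  obtain ⟨b, hb⟩ := mem_range_of_forall_pow (LinearMap.mulLeft A (x j)) s (by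
    intro t
    have h1 := hx.colon (v := s) (Pi.single i 1) (fun k => if k = j then 1 else t + 1) (fun k => by
      by_cases hk : k = i
      · subst hk; simp [hij]
      · simp [hk]) (by
      rw [bot_sup_eq, Finset.prod_eq_single i (fun k _ hk => by simp [hk]) (by simp),
        Pi.single_eq_same, pow_one]
      refine Ideal.span_mono ?_ h
      rintro _ rfl
      exact ⟨j, by simp⟩)
    rw [bot_sup_eq] at h1
    obtain ⟨c, rfl⟩ := Ideal.mem_span_range_iff_exists_fun.1 h1
    refine ⟨c j, ?_⟩
    rw [← Finset.add_sum_erase _ _ (Finset.mem_univ j)]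
    simp only [LinearMap.mulLeft_apply, if_true, Pi.single_eq_of_ne hij.symm, Nat.sub_zero, pow_one]
    rw [mul_comm, sub_add_cancel_left, neg_mem_iff]
    refine sum_mem fun k hk => ?_
    rw [smul_eq_mul, Ideal.mul_top]
    refine Ideal.mul_mem_left _ _ ?_
    have hxk : x k ∈ maximalIdeal A := hm ▸ Ideal.subset_span ⟨k, rfl⟩
    have hkj := Finset.ne_of_mem_erase hk
    simp only [hkj, if_false]
    refine Ideal.pow_le_pow_right ?_ (Ideal.pow_mem_pow hxk _)
    by_cases hk : k = i
    · subst hk; simp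
    · simp [hk])
  rw [← hb]
  exact Ideal.mul_mem_right _ _ (Ideal.mem_span_singleton_self _)

/-- If the maximal ideal of a regular local ring annihilates a nonzero element modulo `b ≠ 0`, then
the ring is integrally closed. -/
theorem IsRegularLocal.isIntegrallyClosed_of_mul_mem {A : Type*} [CommRing A] [IsLocalRing A]
    (h : IsRegularLocal A) (b y : A) (hb : b ≠ 0) (hy : y ∉ Ideal.span {b})
    (hmy : ∀ a ∈ maximalIdeal A, a * y ∈ Ideal.span {b}) : IsIntegrallyClosed A := by
  have := h.1
  obtain ⟨hdom, d, x, hxm, hx⟩ := h.exists_parameters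
  by_cases hd : d ≤ 1
  · have hpr : (maximalIdeal A).IsPrincipal := by
      rw [← hxm]
      obtain rfl | rfl : d = 0 ∨ d = 1 := by omega
      · rw [Set.range_eq_empty, Ideal.span_empty]; exact ⟨0, by simp⟩
      · rw [Set.range_unique]; exact ⟨_, rfl⟩
    have := ((tfae_of_isNoetherianRing_of_isLocalRing_of_isDomain A).out 0 4).2 hpr
    have h2 := ((tfae_of_isNoetherianRing_of_isLocalRing_of_isDomain A).out 0 3).1 this
    exact h2.1
  · exfalso
    have hxm' : ∀ i, x i ∈ maximalIdeal A := fun i => hxm ▸ Ideal.subset_span ⟨i, rfl⟩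
    let i : Fin d := ⟨0, by omega⟩
    let j : Fin d := ⟨1, by omega⟩
    have hij : i ≠ j := by simp [i, j]
    obtain ⟨s, hs⟩ := Ideal.mem_span_singleton.1 (hmy _ (hxm' i))
    obtain ⟨s', hs'⟩ := Ideal.mem_span_singleton.1 (hmy _ (hxm' j))
    have h1 : x i * s' = x j * s := by
      apply mul_left_cancel₀ hb
      linear_combination (-x i) * hs' + x j * hs
    obtain ⟨w, hw⟩ := Ideal.mem_span_singleton.1
      (hx.mem_span_of_mul_mem hxm hij s' (h1 ▸ Ideal.mul_mem_right _ _ (Ideal.mem_span_singleton_self _)))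
    by_cases hxj : x j = 0
    · have h2 := hx.mem_span_of_mul_mem hxm hij.symm 1 (by rw [hxj, zero_mul]; exact zero_mem _)
      exact (maximalIdeal.isMaximal A).ne_top (Ideal.eq_top_of_isUnit_mem _ (hxm' i)
        (isUnit_of_dvd_one (Ideal.mem_span_singleton.1 h2)))
    apply hy
    refine Ideal.mem_span_singleton.2 ⟨w, mul_left_cancel₀ hxj ?_⟩
    rw [hs', hw]; ring

theorem isIntegrallyClosed_of_regular {A : Type*} [CommRing A] [IsDomain A] [IsNoetherianRing A]
    (h : ∀ (P : Ideal A) [P.IsPrime], IsRegularLocal (Localization.AtPrime P)) :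
    IsIntegrallyClosed A := by
  rw [isIntegrallyClosed_iff (FractionRing A)]
  intro z hz
  by_contra hcon
  obtain ⟨a, b, hb, rfl⟩ := IsFractionRing.div_surjective (A := A) z
  have hb0 : b ≠ 0 := nonZeroDivisors.ne_zero hb
  have hbK : algebraMap A (FractionRing A) b ≠ 0 := by simpa using hb0
  have ha : Ideal.Quotient.mk (Ideal.span {b}) a ≠ 0 := by
    intro h0
    obtain ⟨r, hr⟩ := Ideal.mem_span_singleton.1 (Ideal.Quotient.eq_zero_iff_mem.1 h0)
    exact hcon ⟨r, by rw [hr, map_mul]; field_simp⟩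
  have hnt : Nontrivial (Submodule.span A {Ideal.Quotient.mk (Ideal.span {b}) a}) :=
    ⟨⟨_, Submodule.mem_span_singleton_self _⟩, 0, fun h0 => ha (congrArg Subtype.val h0)⟩
  obtain ⟨P, hP⟩ := associatedPrimes.nonempty A (Submodule.span A {Ideal.Quotient.mk (Ideal.span {b}) a})
  obtain ⟨hPp, ⟨y, hy⟩, hPy⟩ := (isAssociatedPrime_iff).1 hP
  obtain ⟨c, rfl⟩ := Submodule.mem_span_singleton.1 hy
  have hPmem : ∀ r, r ∈ P ↔ r * (c * a) ∈ Ideal.span {b} := by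
    intro r
    rw [hPy, Submodule.mem_colon_singleton, Submodule.mem_bot, ← Subtype.coe_inj]
    rw [← Ideal.Quotient.eq_zero_iff_mem]
    rfl
  have hbne : algebraMap A (Localization.AtPrime P) b ≠ 0 := by
    rw [Ne, FaithfulSMul.algebraMap_eq_zero_iff]
    exact hb0
  have hmem : ∀ u, algebraMap A (Localization.AtPrime P) u ∈
      Ideal.span {algebraMap A (Localization.AtPrime P) b} ↔ ∃ m ∉ P, m * u ∈ Ideal.span {b} := by
    intro u
    rw [← Set.image_singleton, ← Ideal.map_span,
      IsLocalization.algebraMap_mem_map_algebraMap_iff P.primeCompl]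
    rfl
  have hLic := (h P).isIntegrallyClosed_of_mul_mem (algebraMap A _ b) (algebraMap A _ (c * a))
    hbne (by
      rw [hmem]
      rintro ⟨m, hm, hm'⟩
      exact hm ((hPmem m).2 hm')) (by
      intro r hr
      rw [← Localization.AtPrime.map_eq_maximalIdeal] at hr
      have : P.map (algebraMap A (Localization.AtPrime P)) ≤
          (Ideal.span {algebraMap A (Localization.AtPrime P) b}).colon
            {algebraMap A (Localization.AtPrime P) (c * a)} := by
        rw [Ideal.map_le_iff_le_comap]
        intro s hs
        rw [Ideal.mem_comap, Submodule.mem_colon_singleton, smul_eq_mul, ← map_mul, hmem]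
        exact ⟨1, P.one_notMem, by rw [one_mul]; exact (hPmem s).1 hs⟩
      exact Submodule.mem_colon_singleton.1 (this hr))
  obtain ⟨w, hw⟩ := (isIntegrallyClosed_iff (FractionRing A)).1 hLic
    (hz.tower_top (A := Localization.AtPrime P))
  have h1 : algebraMap A (Localization.AtPrime P) a = algebraMap A _ b * w := by
    apply FaithfulSMul.algebraMap_injective (Localization.AtPrime P) (FractionRing A)
    rw [map_mul, hw, ← IsScalarTower.algebraMap_apply, ← IsScalarTower.algebraMap_apply]
    field_simp
  obtain ⟨m, hm, hm'⟩ := (hmem a).1 (Ideal.mem_span_singleton.2 ⟨w, h1⟩)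
  apply hm
  rw [hPmem, mul_left_comm]
  exact Ideal.mul_mem_left _ _ hm'

end Normality

section Domain

variable {A R : Type*} [CommRing A] [CommRing R] [Algebra A R]

theorem exists_splitting_of_isIntegrallyClosed [IsDomain A] [IsDomain R] [Module.Finite A R]
    (hinj : Function.Injective (algebraMap A R)) [IsIntegrallyClosed A]
    (hu : ∀ n : ℕ, n ≠ 0 → IsUnit (n : A)) : ∃ π : R →ₗ[A] A, π 1 = 1 := by
  have : FaithfulSMul A R := (faithfulSMul_iff_algebraMap_injective A R).2 hinj
  let K := FractionRing A
  let L := FractionRing R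
  let : Algebra K L := FractionRing.liftAlgebra A L
  have : IsScalarTower A K L := FractionRing.isScalarTower_liftAlgebra A L
  have : Module.Finite K L := .of_isLocalization A R (nonZeroDivisors A)
  let f : R →ₐ[A] integralClosure A L := IsIntegralClosure.lift A (integralClosure A L) L
  let g := Algebra.intTraceAux A K L (integralClosure A L) ∘ₗ f.toLinearMap
  have hg : g 1 = Module.finrank K L := by
    apply FaithfulSMul.algebraMap_injective A K
    simp only [g, LinearMap.comp_apply, AlgHom.toLinearMap_apply, map_one, Algebra.map_intTraceAux,
      map_natCast]
    rw [← map_one (algebraMap K L), Algebra.trace_algebraMap]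
    simp
  obtain ⟨u, hu⟩ := hu (Module.finrank K L) Module.finrank_pos.ne'
  refine ⟨(↑u⁻¹ : A) • g, ?_⟩
  rw [LinearMap.smul_apply, hg, ← hu, smul_eq_mul, Units.inv_mul]

theorem exists_linearMap_ne_zero [IsDomain A] [IsDomain R] [IsNoetherianRing A] [Module.Finite A R]
    (hinj : Function.Injective (algebraMap A R)) : ∃ φ : R →ₗ[A] A, φ 1 ≠ 0 := by
  have : FaithfulSMul A R := (faithfulSMul_iff_algebraMap_injective A R).2 hinj
  let K := FractionRing A
  let L := FractionRing R
  let : Algebra K L := FractionRing.liftAlgebra A L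
  have : IsScalarTower A K L := FractionRing.isScalarTower_liftAlgebra A L
  obtain ⟨g, hg⟩ := LinearMap.exists_leftInverse_of_injective (Algebra.linearMap K L)
    (LinearMap.ker_eq_bot.2 (algebraMap K L).injective)
  have hg1 : g 1 = 1 := by
    have := LinearMap.congr_fun hg 1
    simpa using this
  let h : R →ₗ[A] K := g.restrictScalars A ∘ₗ (IsScalarTower.toAlgHom A R L).toLinearMap
  have : Module.FinitePresentation A R := Module.finitePresentation_of_finite A R
  obtain ⟨φ, s, hφ⟩ := Module.FinitePresentation.exists_lift_of_isLocalizedModule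
    (nonZeroDivisors A) (Algebra.linearMap A K) h
  refine ⟨φ, fun h0 => ?_⟩
  have := LinearMap.congr_fun hφ 1
  simp [h0, h, hg1, Submonoid.smul_def, Algebra.smul_def] at this
  exact nonZeroDivisors.ne_zero s.2 (FaithfulSMul.algebraMap_injective A K (by simpa using this.symm))

theorem exists_prime_comap_eq_bot [IsDomain A] [Module.Finite A R]
    (hinj : Function.Injective (algebraMap A R)) :
    ∃ Q : Ideal R, Q.IsPrime ∧ Function.Injective (algebraMap A (R ⧸ Q)) := by
  obtain ⟨Q, -, hQ, hc⟩ := Ideal.exists_ideal_over_prime_of_isIntegral (⊥ : Ideal A) (⊥ : Ideal R)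
    (by rw [← RingHom.ker_eq_comap_bot, (RingHom.injective_iff_ker_eq_bot _).1 hinj])
  refine ⟨Q, hQ, (injective_iff_map_eq_zero _).2 fun a ha => ?_⟩
  have : algebraMap A R a ∈ Q := Ideal.Quotient.eq_zero_iff_mem.1 ha
  have : a ∈ Q.comap (algebraMap A R) := this
  rw [show Q.comap (algebraMap A R) = ⊥ from hc] at this
  exact this

theorem SyzTriv.prod_notMem_of_charP [IsDomain A] [IsDomain R] [IsNoetherianRing A] [IsLocalRing A]
    [Module.Finite A R] (hinj : Function.Injective (algebraMap A R)) {ι : Type*} [Fintype ι]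
    {x : ι → A} (hx : SyzTriv (⊥ : Ideal A) x) (hm : Ideal.span (Set.range x) = maximalIdeal A)
    (p : ℕ) [Fact p.Prime] [CharP A p] {t : ℕ} (ht : 1 ≤ t) :
    ∏ i, x i ^ (t - 1) ∉ ((Ideal.span (Set.range fun i => x i ^ t)).map (algebraMap A R)).comap
      (algebraMap A R) := by
  intro hz
  obtain ⟨φ, hφ⟩ := exists_linearMap_ne_zero hinj
  have : CharP R p := charP_of_injective_algebraMap hinj p
  rw [Ideal.mem_comap, Ideal.map_span, ← Set.range_comp] at hz
  obtain ⟨r, hr⟩ := Ideal.mem_span_range_iff_exists_fun.1 hz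
  apply hφ
  rw [← Ideal.mem_bot, ← Ideal.iInf_pow_eq_bot_of_isLocalRing (maximalIdeal A)
    Ideal.IsPrime.ne_top', Ideal.mem_iInf]
  intro e
  have h1 := congrArg (· ^ (p ^ e)) hr
  simp only [Function.comp_apply, sum_pow_char_pow, mul_pow, ← map_pow, mul_comm (r _ ^ _)] at h1
  simp only [← Algebra.smul_def] at h1
  have h2 := congrArg φ h1
  rw [← mul_one (algebraMap A R _), ← Algebra.smul_def] at h2
  simp only [map_sum, map_smul, smul_eq_mul, ← pow_mul, ← Finset.prod_pow] at h2
  have h3 := hx.colon (v := φ 1) (fun _ => (t - 1) * p ^ e) (fun _ => t * p ^ e)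
    (fun _ => Nat.mul_le_mul_right _ (Nat.sub_le _ _)) (by
      rw [← h2]
      refine Ideal.mem_sup_right (sum_mem fun i _ => Ideal.mul_mem_right _ _ (Ideal.subset_span ⟨i, rfl⟩)))
  rw [bot_sup_eq] at h3
  refine (Ideal.span_le.2 ?_) h3
  rintro _ ⟨i, rfl⟩
  refine Ideal.pow_le_pow_right ?_ (Ideal.pow_mem_pow (hm ▸ Ideal.subset_span ⟨i, rfl⟩) _)
  rw [← Nat.sub_mul, Nat.sub_sub_self ht, one_mul]
  exact (Nat.lt_pow_self (Fact.out : p.Prime).one_lt).le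

theorem exists_splitting_of_localization [IsNoetherianRing A] [Module.Finite A R]
    (h : ∀ (P : Ideal A) [P.IsMaximal], ∃ π :
      Localization (Algebra.algebraMapSubmonoid R P.primeCompl) →ₗ[Localization.AtPrime P]
        Localization.AtPrime P, π 1 = 1) : ∃ π : R →ₗ[A] A, π 1 = 1 := by
  have hfp : Module.FinitePresentation A R := Module.finitePresentation_of_finite A R
  let ev : (R →ₗ[A] A) →ₗ[A] A := LinearMap.applyₗ 1
  by_contra hcon
  have hne : (LinearMap.range ev : Ideal A) ≠ ⊤ := by
    intro h0
    have h1 : (1 : A) ∈ LinearMap.range ev := h0 ▸ Submodule.mem_top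
    exact hcon h1
  obtain ⟨P, hP, hle⟩ := Ideal.exists_le_maximal _ hne
  obtain ⟨π, hπ⟩ := h P
  let g : R →ₗ[A] Localization.AtPrime P := π.restrictScalars A ∘ₗ
    (IsScalarTower.toAlgHom A R (Localization (Algebra.algebraMapSubmonoid R P.primeCompl))).toLinearMap
  obtain ⟨φ, s, hφ⟩ := Module.FinitePresentation.exists_lift_of_isLocalizedModule
    P.primeCompl (Algebra.linearMap A (Localization.AtPrime P)) g
  have h1 := LinearMap.congr_fun hφ 1
  simp [g, hπ, Submonoid.smul_def, Algebra.smul_def] at h1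
  have h2 : φ 1 ∈ P := hle ⟨φ, rfl⟩
  obtain ⟨c, hc⟩ := (IsLocalization.eq_iff_exists P.primeCompl _).1 h1
  have h3 : (c : A) * s ∈ P := hc ▸ P.mul_mem_left _ h2
  exact (hP.isPrime.mem_or_mem h3).elim c.2 s.2

end Domain

end

section Triangular

open MvPolynomial

/-- A polynomial is monic in the variable `v` over the preceding variables. -/
def MvPolynomial.IsMonicIn {σ S : Type*} [CommRing S] [LinearOrder σ] (v : σ)
    (r : MvPolynomial σ S) : Prop :=
  ∃ q : Polynomial (supported S (Set.Iio v)), q.Monic ∧ Polynomial.aeval (X v : MvPolynomial σ S) q = r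

theorem Polynomial.Monic.mem_map_C_of_mul_mem {B : Type*} [CommRing B] {m f : Polynomial B}
    (hm : m.Monic) {J : Ideal B} (h : m * f ∈ J.map Polynomial.C) : f ∈ J.map Polynomial.C := by
  have key : ∀ g : Polynomial B, g ∈ J.map Polynomial.C ↔ g.map (Ideal.Quotient.mk J) = 0 := by
    intro g
    rw [Ideal.mem_map_C_iff, Polynomial.ext_iff]
    simp [Ideal.Quotient.eq_zero_iff_mem]
  rw [key] at h ⊢
  rw [Polynomial.map_mul] at h
  exact ((hm.map _).mul_right_eq_zero_iff).1 h

theorem MvPolynomial.IsMonicIn.mem_of_mul_mem {σ S : Type*} [CommRing S] [LinearOrder σ] {v : σ}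
    {r : MvPolynomial σ S} (hr : IsMonicIn v r) {G : Set (MvPolynomial σ S)}
    (hG : G ⊆ supported S (Set.Iio v)) {f : MvPolynomial σ S} (h : r * f ∈ Ideal.span G) :
    f ∈ Ideal.span G := by
  obtain ⟨q, hq, rfl⟩ := hr
  rcases subsingleton_or_nontrivial (MvPolynomial σ S) with hS | hS
  · rw [Subsingleton.elim f 0]
    exact zero_mem _
  let τ : MvPolynomial σ S →ₐ[S] Polynomial (MvPolynomial σ S) :=
    aeval fun b => if b = v then Polynomial.X else Polynomial.C (X b)
  have hτ : ∀ g ∈ supported S (Set.Iio v), τ g = Polynomial.C g := by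
    intro g hg
    let C' : MvPolynomial σ S →ₐ[S] Polynomial (MvPolynomial σ S) := Algebra.ofId _ _ |>.restrictScalars S
    have : supported S (Set.Iio v) ≤ AlgHom.equalizer τ C' := by
      rw [supported, Algebra.adjoin_le_iff]
      rintro _ ⟨b, hb, rfl⟩
      have hb : b ≠ v := ne_of_lt hb
      simp only [SetLike.mem_coe, AlgHom.mem_equalizer, τ, C', aeval_X, if_neg hb]
      rfl
    exact this hg
  have hev : ∀ g, (τ g).eval (X v) = g := by
    intro g
    have : ((Polynomial.aeval (X v : MvPolynomial σ S)).restrictScalars S).comp τ =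
        AlgHom.id S _ := by
      ext b
      by_cases hb : b = v
      · subst hb; simp [τ]
      · simp [τ, hb]
    simpa [Polynomial.aeval_def] using DFunLike.congr_fun this g
  have hq' : τ (Polynomial.aeval (X v : MvPolynomial σ S) q) =
      q.map (algebraMap (supported S (Set.Iio v)) (MvPolynomial σ S)) := by
    rw [Polynomial.aeval_eq_sum_range, map_sum]
    conv_rhs => rw [Polynomial.as_sum_range_C_mul_X_pow (Polynomial.map _ q)]
    rw [hq.natDegree_map]
    refine Finset.sum_congr rfl fun i _ => ?_
    rw [Algebra.smul_def, map_mul, map_pow, Polynomial.coeff_map]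
    congr 1
    · exact hτ _ (q.coeff i).2
    · simp [τ]
  have hmap : ∀ g ∈ Ideal.span G, τ g ∈ (Ideal.span G).map Polynomial.C := by
    intro g hg
    have : Ideal.span G ≤ ((Ideal.span G).map Polynomial.C).comap τ := by
      rw [Ideal.span_le]
      intro b hb
      simp only [SetLike.mem_coe, Ideal.mem_comap]
      rw [hτ b (hG hb)]
      exact Ideal.mem_map_of_mem _ (Ideal.subset_span hb)
    exact this hg
  have h2 := hmap _ h
  rw [map_mul, hq'] at h2
  have h3 := (hq.map _).mem_map_C_of_mul_mem h2
  rw [← hev f, Polynomial.eval_eq_sum_range]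
  exact sum_mem fun i _ => Ideal.mul_mem_right _ _ (Ideal.mem_map_C_iff.1 h3 i)

theorem SyzTriv.map_C {σ S ι : Type*} [CommRing S] [Fintype ι] {x : ι → S} (hx : SyzTriv ⊥ x) :
    SyzTriv ⊥ (fun i => (C (x i) : MvPolynomial σ S)) := by
  classical
  intro s hs
  have hs' : ∀ m, ∑ i, x i * (s i).coeff m ∈ (⊥ : Ideal S) := by
    intro m
    have := congrArg (coeff m) ((Submodule.mem_bot _).1 hs)
    simpa [coeff_sum] using this
  choose c h1 h2 h3 using fun m => hx _ (hs' m)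
  let T := Finset.univ.biUnion fun i => (s i).support
  have hT : ∀ i m, m ∉ T → (s i).coeff m = 0 := by
    intro i m hm
    by_contra h
    exact hm (Finset.mem_biUnion.2 ⟨i, Finset.mem_univ _, mem_support_iff.2 h⟩)
  refine ⟨fun i j => ∑ m ∈ T, monomial m (c m i j), fun i j => ?_, fun i => ?_, fun i => ?_⟩
  · rw [← Finset.sum_neg_distrib]
    exact Finset.sum_congr rfl fun m _ => by rw [h1, map_neg]
  · simp [h2]
  · rw [Submodule.mem_bot, sub_eq_zero]
    ext m
    simp only [coeff_sum, Finset.sum_mul, mul_comm _ (C _), coeff_C_mul, coeff_monomial]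
    by_cases hm : m ∈ T
    · simpa [hm, sub_eq_zero, mul_comm] using h3 m i
    · rw [hT i m hm]
      symm
      refine Finset.sum_eq_zero fun j _ => ?_
      rw [Finset.sum_eq_zero fun m' hm' => ?_, mul_zero]
      rw [if_neg (by rintro rfl; exact hm hm')]

theorem SyzTriv.of_isMonicIn {σ S : Type*} [CommRing S] [LinearOrder σ] {G : Set (MvPolynomial σ S)}
    (hG : ∀ s : Set σ, G ⊆ supported S s) {r : σ → MvPolynomial σ S} (hr : ∀ v, IsMonicIn v (r v))
    (hrs : ∀ v, r v ∈ supported S (Set.Iic v)) :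
    ∀ (n : ℕ) (e : Fin n → σ), StrictMono e → SyzTriv (Ideal.span G) (fun i => r (e i)) := by
  intro n
  induction n with
  | zero => exact fun e _ => SyzTriv.of_isEmpty _
  | succ n ih =>
    intro e he
    have h1 := ih (fun i => e i.castSucc) (fun i j hij => he (by simpa using hij))
    have h2 : SyzTriv (Ideal.span G ⊔ Ideal.span (Set.range fun i : Fin n => r (e i.castSucc)))
        (fun _ : Fin 1 => r (e (Fin.last n))) := by
      refine SyzTriv.unique fun s hs => ?_
      rw [← Ideal.span_union] at hs ⊢
      refine (hr (e (Fin.last n))).mem_of_mul_mem ?_ hs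
      refine Set.union_subset (hG _) ?_
      rintro _ ⟨i, rfl⟩
      refine supported_mono ?_ (hrs (e i.castSucc))
      intro b hb
      exact lt_of_le_of_lt hb (he (Fin.castSucc_lt_last i))
    have h3 := (h1.append h2).reindex finSumFinEquiv.symm
    convert h3 using 1
    ext1 i
    induction i using Fin.lastCases with
    | last =>
      have : Fin.last n = Fin.natAdd n (0 : Fin 1) := by ext; simp
      rw [Function.comp, this, finSumFinEquiv_symm_apply_natAdd]
      simp [← this]
    | cast i =>
      have : i.castSucc = Fin.castAdd 1 i := rfl
      rw [Function.comp, this, finSumFinEquiv_symm_apply_castAdd]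
      rfl

theorem MvPolynomial.IsMonicIn.mem_supported {σ S : Type*} [CommRing S] [LinearOrder σ] {v : σ}
    {r : MvPolynomial σ S} (hr : IsMonicIn v r) : r ∈ supported S (Set.Iic v) := by
  nontriviality S
  obtain ⟨q, -, rfl⟩ := hr
  rw [Polynomial.aeval_eq_sum_range]
  refine sum_mem fun i _ => ?_
  rw [Algebra.smul_def]
  refine mul_mem (supported_mono Set.Iio_subset_Iic_self (q.coeff i).2) (pow_mem ?_ _)
  exact X_mem_supported.2 (Set.mem_Iic.2 le_rfl)

/-- A sequence with trivial first syzygies keeps this property modulo a family of relations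
that is triangular and monic modulo the sequence. -/
theorem SyzTriv.map_C_of_isMonicIn {σ S ι : Type*} [CommRing S] [LinearOrder σ] [Fintype ι]
    {x : ι → S} (hx : SyzTriv ⊥ x) {r r' : σ → MvPolynomial σ S} (hr : ∀ v, IsMonicIn v (r v))
    (hrr : ∀ v, r v - r' v ∈ Ideal.span (Set.range fun i => (C (x i) : MvPolynomial σ S))) :
    SyzTriv (Ideal.span (Set.range r')) (fun i => (C (x i) : MvPolynomial σ S)) := by
  classical
  have hfin : ∀ F : Finset σ, SyzTriv (Ideal.span (r' '' F))
      (fun i => (C (x i) : MvPolynomial σ S)) := by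
    intro F
    have h1 := SyzTriv.of_isMonicIn (G := Set.range fun i => (C (x i) : MvPolynomial σ S))
      (by rintro s _ ⟨i, rfl⟩; exact (supported S s).algebraMap_mem (x i)) hr
      (fun v => (hr v).mem_supported) _ (F.orderEmbOfFin rfl) (OrderEmbedding.strictMono _)
    have h2 := h1.congr (b := fun i => r' (F.orderEmbOfFin rfl i)) (fun i => hrr _)
    have h3 := (hx.map_C (σ := σ)).append (κ := Fin F.card) (by rwa [bot_sup_eq])
    have h4 := h3.of_append_left
    rw [bot_sup_eq] at h4
    convert h4
    rw [← Finset.range_orderEmbOfFin F rfl, ← Set.range_comp]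
    rfl
  intro s hs
  obtain ⟨F, hF⟩ : ∃ F : Finset σ, ∑ i, (C (x i) : MvPolynomial σ S) * s i ∈ Ideal.span (r' '' F) := by
    obtain ⟨c, hc⟩ := (Finsupp.mem_ideal_span_range_iff_exists_finsupp).1 hs
    refine ⟨c.support, ?_⟩
    rw [← hc, Finsupp.sum]
    exact sum_mem fun i hi => Ideal.mul_mem_left _ _ (Ideal.subset_span ⟨i, hi, rfl⟩)
  obtain ⟨c, h1, h2, h3⟩ := hfin F s hF
  exact ⟨c, h1, h2, fun i => Ideal.span_mono (Set.image_subset_range _ _) (h3 i)⟩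

end Triangular

section Gonflement

open MvPolynomial

variable {A K : Type*} [CommRing A] [Field K] [Algebra A K] [LinearOrder K]

/-- The evaluation sending each variable to the element it is named after. -/
noncomputable def evalSelf (A K : Type*) [CommRing A] [Field K] [Algebra A K] :
    MvPolynomial K A →ₐ[A] K := aeval id

theorem evalSelf_X (κ : K) : evalSelf A K (X κ) = κ := by simp [evalSelf]

theorem exists_aeval_eq_of_mem_supported_Iic {κ : K} {f : MvPolynomial K A}
    (hf : f ∈ supported A (Set.Iic κ)) :
    ∃ q : Polynomial (supported A (Set.Iio κ)), Polynomial.aeval (X κ : MvPolynomial K A) q = f := by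
  have h : supported A (Set.Iic κ) =
      (Algebra.adjoin (supported A (Set.Iio κ)) {(X κ : MvPolynomial K A)}).restrictScalars A := by
    have : Set.Iic κ = Set.Iio κ ∪ {κ} := by ext; simp [le_iff_lt_or_eq]
    rw [this, supported, Set.image_union, Algebra.adjoin_union_eq_adjoin_adjoin, Set.image_singleton]
    rfl
  rw [h, Subalgebra.mem_restrictScalars, Algebra.adjoin_singleton_eq_range_aeval] at hf
  exact hf

theorem exists_isMonicIn_evalSelf [WellFoundedLT K] {k : Type*} [Field k] [Algebra k K] [Algebra.IsAlgebraic k K]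
    [Algebra A k] [IsScalarTower A k K] (hk : Function.Surjective (algebraMap A k)) :
    ∃ r : K → MvPolynomial K A, (∀ κ, IsMonicIn κ (r κ)) ∧ (∀ κ, evalSelf A K (r κ) = 0) ∧
      ∀ f, evalSelf A K f = 0 →
        f ∈ ((RingHom.ker (algebraMap A k)).map C) ⊔ Ideal.span (Set.range r) := by
  have hAK : ∀ a, algebraMap A K a = 0 → algebraMap A k a = 0 := by
    intro a ha
    rw [IsScalarTower.algebraMap_apply A k K] at ha
    exact (map_eq_zero _).1 ha
  have key : ∀ κ : K, ∃ q : Polynomial (supported A (Set.Iio κ)), q.Monic ∧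
      Polynomial.aeval κ (q.map ((evalSelf A K).comp (supported A (Set.Iio κ)).val).toRingHom) = 0 ∧
      ∀ g : Polynomial (supported A (Set.Iio κ)), g.degree < q.degree →
        Polynomial.aeval κ (g.map ((evalSelf A K).comp (supported A (Set.Iio κ)).val).toRingHom) = 0 →
        g.map ((evalSelf A K).comp (supported A (Set.Iio κ)).val).toRingHom = 0 := by
    intro κ
    let F := IntermediateField.adjoin k (Set.Iio κ)
    have hmem : ∀ y : supported A (Set.Iio κ), (evalSelf A K) y ∈ F := by
      intro y
      have : supported A (Set.Iio κ) ≤ (F.toSubalgebra.restrictScalars A).comap (evalSelf A K) := by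
        rw [supported, Algebra.adjoin_le_iff]
        rintro _ ⟨b, hb, rfl⟩
        simp only [SetLike.mem_coe, Subalgebra.mem_comap, evalSelf_X]
        exact IntermediateField.subset_adjoin k _ hb
      exact this y.2
    let φ : supported A (Set.Iio κ) →+* F :=
      ((evalSelf A K).comp (supported A (Set.Iio κ)).val).toRingHom.codRestrict F.toSubfield hmem
    have hφ : (algebraMap F K).comp φ = ((evalSelf A K).comp (supported A (Set.Iio κ)).val).toRingHom := rfl
    have hsurj : Function.Surjective φ := by
      rintro ⟨y, hy⟩
      have hy' : y ∈ Algebra.adjoin k (Set.Iio κ) := by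
        rw [← IntermediateField.adjoin_toSubalgebra_of_isAlgebraic (F := k) (S := Set.Iio κ)
          (fun x _ => Algebra.IsAlgebraic.isAlgebraic x)]
        exact hy
      suffices ∃ z : supported A (Set.Iio κ), evalSelf A K z = y by
        obtain ⟨z, hz⟩ := this
        exact ⟨z, Subtype.ext hz⟩
      induction hy' using Algebra.adjoin_induction with
      | mem x hx => exact ⟨⟨X x, Algebra.subset_adjoin ⟨x, hx, rfl⟩⟩, evalSelf_X x⟩
      | algebraMap c =>
        obtain ⟨a, rfl⟩ := hk c
        refine ⟨algebraMap A _ a, ?_⟩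
        rw [← IsScalarTower.algebraMap_apply A k K]
        exact (evalSelf A K).commutes a
      | add u v hu hv h1 h2 =>
        obtain ⟨a, ha⟩ := h1 (IntermediateField.algebra_adjoin_le_adjoin _ _ hu)
        obtain ⟨b, hb⟩ := h2 (IntermediateField.algebra_adjoin_le_adjoin _ _ hv)
        exact ⟨a + b, by simp [ha, hb]⟩
      | mul u v hu hv h1 h2 =>
        obtain ⟨a, ha⟩ := h1 (IntermediateField.algebra_adjoin_le_adjoin _ _ hu)
        obtain ⟨b, hb⟩ := h2 (IntermediateField.algebra_adjoin_le_adjoin _ _ hv)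
        exact ⟨a * b, by simp [ha, hb]⟩
    have hκint : IsIntegral F κ := (Algebra.IsIntegral.isIntegral (R := k) κ).tower_top
    obtain ⟨q, hq1, hq2, hq3⟩ := Polynomial.lifts_and_degree_eq_and_monic (f := φ)
      (p := minpoly F κ) ((Polynomial.lifts_iff_coeff_lifts _).2 fun n => hsurj _) (minpoly.monic hκint)
    refine ⟨q, hq3, ?_, ?_⟩
    · rw [← hφ, ← Polynomial.map_map, hq1]
      simp
    · intro g hg h0
      rw [← hφ, ← Polynomial.map_map] at h0 ⊢
      rw [Polynomial.aeval_map_algebraMap] at h0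
      rw [Polynomial.eq_zero_of_dvd_of_degree_lt (minpoly.dvd F κ h0), Polynomial.map_zero]
      rw [← hq2]
      exact Polynomial.degree_map_le.trans_lt hg
  choose q hq1 hq2 hq3 using key
  have hev : ∀ κ (g : Polynomial (supported A (Set.Iio κ))),
      evalSelf A K (Polynomial.aeval (X κ) g) = Polynomial.aeval κ
        (g.map ((evalSelf A K).comp (supported A (Set.Iio κ)).val).toRingHom) := by
    intro κ g
    change (evalSelf A K).toRingHom _ = _
    rw [Polynomial.aeval_def, Polynomial.hom_eval₂, show (evalSelf A K).toRingHom (X κ) = κ from evalSelf_X κ, Polynomial.aeval_def, Polynomial.eval₂_map]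
    rfl
  refine ⟨fun κ => Polynomial.aeval (X κ) (q κ), fun κ => ⟨q κ, hq1 κ, rfl⟩,
    fun κ => (hev κ _).trans (hq2 κ), ?_⟩
  set I := ((RingHom.ker (algebraMap A k)).map (C : A →+* MvPolynomial K A)) ⊔
    Ideal.span (Set.range fun κ => Polynomial.aeval (X κ) (q κ)) with hI
  suffices H : ∀ κ f, f ∈ supported A (Set.Iic κ) → evalSelf A K f = 0 → f ∈ I by
    intro f hf
    obtain ⟨κ, hκ⟩ : ∃ κ, ∀ v ∈ f.vars, v ≤ κ := by
      classical
      obtain ⟨κ, hκ⟩ := f.vars.bddAbove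
      exact ⟨κ, fun v hv => hκ hv⟩
    exact H κ f (mem_supported.2 fun v hv => hκ v hv) hf
  intro κ
  induction κ using WellFoundedLT.induction with
  | _ κ ih =>
  intro f hf h0
  obtain ⟨g, rfl⟩ := exists_aeval_eq_of_mem_supported_Iic hf
  have hdiv := Polynomial.modByMonic_add_div g (q κ)
  have hdeg : (g %ₘ q κ).degree < (q κ).degree ∨ Subsingleton (supported A (Set.Iio κ)) := by
    rcases subsingleton_or_nontrivial (supported A (Set.Iio κ)) with h | h
    · exact Or.inr h
    · exact Or.inl (Polynomial.degree_modByMonic_lt _ (hq1 κ))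
  rw [← hdiv, map_add, map_mul] at h0 ⊢
  refine add_mem ?_ (Ideal.mul_mem_right _ _ (Ideal.mem_sup_right (Ideal.subset_span ⟨κ, rfl⟩)))
  rcases hdeg with hdeg | hdeg
  swap
  · rw [Subsingleton.elim (g %ₘ q κ) 0, map_zero]; exact zero_mem _
  rw [map_add, map_mul, hev κ (q κ), hq2, zero_mul, add_zero, hev] at h0
  have h1 := hq3 κ _ hdeg h0
  rw [Polynomial.aeval_eq_sum_range]
  refine sum_mem fun i _ => ?_
  rw [Algebra.smul_def]
  refine Ideal.mul_mem_right _ _ ?_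
  have h2 := congrArg (Polynomial.coeff · i) h1
  simp only [Polynomial.coeff_map, Polynomial.coeff_zero] at h2
  set y := (g %ₘ q κ).coeff i
  change evalSelf A K (y : MvPolynomial K A) = 0 at h2
  change (y : MvPolynomial K A) ∈ I
  by_cases hy : (y : MvPolynomial K A).vars.Nonempty
  · refine ih _ (mem_supported.1 y.2 (Finset.max'_mem _ hy)) _ ?_ h2
    exact mem_supported.2 fun v hv => Finset.le_max' _ _ hv
  · rw [Finset.not_nonempty_iff_eq_empty, vars_eq_empty_iff_eq_C] at hy
    rw [hy] at h2 ⊢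
    refine Ideal.mem_sup_left (Ideal.mem_map_of_mem _ ?_)
    rw [RingHom.mem_ker]
    apply hAK
    exact ((evalSelf A K).commutes _).symm.trans h2

end Gonflement

universe u in
/-- Enlarging the residue field: a local ring whose maximal ideal is generated by a sequence
with trivial first syzygies maps to a ring in which the sequence retains this property and
generates an ideal with algebraically closed quotient. -/
theorem SyzTriv.exists_residueField_algClosure {A : Type u} {ι : Type*} [CommRing A] [IsLocalRing A] [Fintype ι]
    {x : ι → A} (hx : SyzTriv ⊥ x)
    (hm : Ideal.span (Set.range x) = IsLocalRing.maximalIdeal A) :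
    ∃ (E : Type u) (_ : CommRing E) (i : A →+* E)
      (q : E →+* AlgebraicClosure (IsLocalRing.ResidueField A)), Function.Surjective q ∧
      RingHom.ker q = Ideal.span (Set.range fun j => i (x j)) ∧ SyzTriv ⊥ (fun j => i (x j)) := by
  classical
  let k := IsLocalRing.ResidueField A
  let K := AlgebraicClosure k
  obtain ⟨_, _⟩ := exists_wellOrder K
  obtain ⟨r, hr, hr0, hker⟩ := exists_isMonicIn_evalSelf (A := A) (K := K) (k := k)
    IsLocalRing.residue_surjective
  have hkm : (RingHom.ker (algebraMap A k)).map (MvPolynomial.C : A →+* MvPolynomial K A) =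
      Ideal.span (Set.range fun i => MvPolynomial.C (x i)) := by
    have : RingHom.ker (algebraMap A k) = Ideal.span (Set.range x) := by
      rw [hm]; exact IsLocalRing.ker_residue
    rw [this, Ideal.map_span, ← Set.range_comp]
    rfl
  have hx0 : ∀ i, evalSelf A K (MvPolynomial.C (x i)) = 0 := by
    intro i
    refine ((evalSelf A K).commutes (x i)).trans ?_
    have : x i ∈ IsLocalRing.maximalIdeal A := hm ▸ Ideal.subset_span ⟨i, rfl⟩
    rw [IsScalarTower.algebraMap_apply A k K]
    rw [show algebraMap A k (x i) = 0 from (IsLocalRing.residue_eq_zero_iff _).2 this, map_zero]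
  let J := Ideal.span (Set.range r)
  have hJ : ∀ f ∈ J, (evalSelf A K).toRingHom f = 0 := by
    intro f hf
    have : J ≤ RingHom.ker (evalSelf A K).toRingHom := by
      rw [Ideal.span_le]
      rintro _ ⟨κ, rfl⟩
      exact hr0 κ
    exact this hf
  refine ⟨MvPolynomial K A ⧸ J, inferInstance, (Ideal.Quotient.mk J).comp MvPolynomial.C,
    Ideal.Quotient.lift J (evalSelf A K).toRingHom hJ, ?_, ?_, ?_⟩
  · exact Ideal.Quotient.lift_surjective_of_surjective _ _ fun κ => ⟨MvPolynomial.X κ, evalSelf_X κ⟩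
  · apply le_antisymm
    · intro f hf
      obtain ⟨f, rfl⟩ := Ideal.Quotient.mk_surjective f
      have h := hker f hf
      rw [hkm] at h
      have h2 := Ideal.mem_map_of_mem (Ideal.Quotient.mk J) h
      rw [Ideal.map_sup, Ideal.map_quotient_self, sup_bot_eq, Ideal.map_span, ← Set.range_comp] at h2
      exact h2
    · rw [Ideal.span_le]
      rintro _ ⟨i, rfl⟩
      exact hx0 i
  · have := hx.map_C_of_isMonicIn hr (r' := r) (fun v => by simp)
    exact SyzTriv.quotient_iff.2 this

section Dwork

open WittVector

variable {p : ℕ} [hpp : Fact p.Prime] {D : Type*} [CommRing D]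

theorem WittVector.ghostComponent_eq_sum (n : ℕ) (x : WittVector p D) :
    ghostComponent n x = ∑ i ∈ Finset.range (n + 1), (p : D) ^ i * x.coeff i ^ p ^ (n - i) := by
  rw [ghostComponent_apply, aeval_wittPolynomial]

theorem WittVector.ext_ghostComponent (hp : ∀ a : D, p * a = 0 → a = 0) {x y : WittVector p D}
    (h : ∀ n, ghostComponent n x = ghostComponent n y) : x = y := by
  have hpn : ∀ (n : ℕ) (a : D), (p : D) ^ n * a = 0 → a = 0 := by
    intro n
    induction n with
    | zero => intro a ha; simpa using ha
    | succ n ih => intro a ha; exact ih _ (hp _ (by rw [← ha]; ring))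
  ext n
  induction n using Nat.strong_induction_on with
  | _ n ih =>
  have := h n
  rw [ghostComponent_eq_sum, ghostComponent_eq_sum, Finset.sum_range_succ, Finset.sum_range_succ,
    Finset.sum_congr rfl fun i hi => by rw [ih i (Finset.mem_range.1 hi)]] at this
  have h2 := add_left_cancel this
  simp only [Nat.sub_self, pow_zero, pow_one] at h2
  exact sub_eq_zero.1 (hpn n _ (by rw [mul_sub, h2, sub_self]))

/-- **Dwork's lemma**: a Frobenius lift on a `p`-torsion free ring gives a section to
Witt vectors. -/
theorem exists_ringHom_wittVector (hp : ∀ a : D, p * a = 0 → a = 0) (φ : D →+* D)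
    (hφ : ∀ a, (p : D) ∣ φ a - a ^ p) :
    ∃ s : D →+* WittVector p D, ∀ n a, ghostComponent n (s a) = φ^[n] a := by
  have step : ∀ (a : D) (n : ℕ) (c : ℕ → D),
      (∀ m < n, ∑ i ∈ Finset.range (m + 1), (p : D) ^ i * c i ^ p ^ (m - i) = φ^[m] a) →
      ∃ b, ∑ i ∈ Finset.range n, (p : D) ^ i * c i ^ p ^ (n - i) + (p : D) ^ n * b = φ^[n] a := by
    intro a n c hc
    rcases n with _ | n
    · exact ⟨a, by simp⟩
    have h1 := hc n (Nat.lt_succ_self n)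
    rw [Function.iterate_succ_apply', ← h1, map_sum]
    have : (p : D) ^ (n + 1) ∣ ∑ i ∈ Finset.range (n + 1), φ ((p : D) ^ i * c i ^ p ^ (n - i)) -
        ∑ i ∈ Finset.range (n + 1), (p : D) ^ i * c i ^ p ^ (n + 1 - i) := by
      rw [← Finset.sum_sub_distrib]
      refine Finset.dvd_sum fun i hi => ?_
      have hi' : i ≤ n := Nat.lt_succ_iff.1 (Finset.mem_range.1 hi)
      rw [map_mul, map_pow, map_natCast, map_pow, ← mul_sub, Nat.succ_sub hi', pow_succ' p,
        pow_mul (c i) p]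
      have := dvd_sub_pow_of_dvd_sub (hφ (c i)) (n - i)
      have h3 : (p : D) ^ (n + 1) = (p : D) ^ i * (p : D) ^ (n - i + 1) := by
        rw [← pow_add]; congr 1; omega
      rw [h3]
      exact mul_dvd_mul_left _ this
    obtain ⟨b, hb⟩ := this
    exact ⟨b, by rw [← hb]; ring⟩
  have hex : ∀ a : D, ∃ x : WittVector p D, ∀ n, ghostComponent n x = φ^[n] a := by
    intro a
    choose! b hb using step a
    -- coefficients by strong recursion
    let F : (n : ℕ) → ((m : ℕ) → m < n → D) → D := fun n prev =>
      b n (fun m => if h : m < n then prev m h else 0)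
    let c : ℕ → D := fun n => Nat.strongRec (motive := fun _ => D) F n
    have hcF : ∀ n, c n = b n (fun m => if m < n then c m else 0) := by
      intro n
      change Nat.strongRec (motive := fun _ => D) F n = _
      rw [Nat.strongRec_eq]
      rfl
    have hc : ∀ n, ∑ i ∈ Finset.range (n + 1), (p : D) ^ i * c i ^ p ^ (n - i) = φ^[n] a := by
      intro n
      induction n using Nat.strong_induction_on with
      | _ n ih =>
      have := hb n (fun m => if m < n then c m else 0) (fun m hm => by
        rw [← ih m hm]
        refine Finset.sum_congr rfl fun i hi => ?_
        rw [if_pos (lt_of_lt_of_le (Finset.mem_range.1 hi) hm)])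
      rw [← hcF] at this
      rw [← this, Finset.sum_range_succ]
      congr 1
      · refine Finset.sum_congr rfl fun i hi => ?_
        rw [if_pos (Finset.mem_range.1 hi)]
      · simp
    exact ⟨WittVector.mk p c, fun n => by rw [ghostComponent_eq_sum]; exact hc n⟩
  choose s hs using hex
  refine ⟨{ toFun := s, map_one' := ?_, map_mul' := ?_, map_zero' := ?_, map_add' := ?_ }, fun n a => hs a n⟩
  · exact ext_ghostComponent hp fun n => by rw [hs, map_one, iterate_map_one]
  · exact fun a b => ext_ghostComponent hp fun n => by rw [hs, map_mul, hs, hs, iterate_map_mul]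
  · exact ext_ghostComponent hp fun n => by rw [hs, map_zero, iterate_map_zero]
  · exact fun a b => ext_ghostComponent hp fun n => by rw [hs, map_add, hs, hs, iterate_map_add]

end Dwork

section Theta

open WittVector

variable {p : ℕ} [hpp : Fact p.Prime] {E K : Type*} [CommRing E] [CommRing K] [CharP K p]

theorem WittVector.map_frobenius' (q : E →+* K) (u : WittVector p E) :
    WittVector.map q (WittVector.frobenius u) = WittVector.frobenius (WittVector.map q u) := by
  ext n
  rw [WittVector.map_coeff, WittVector.coeff_frobenius, WittVector.coeff_frobenius,
    MvPolynomial.map_aeval, MvPolynomial.aeval_def, MvPolynomial.coe_eval₂Hom]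
  congr 1
  ext n
  simp

theorem ghostComponent_mem_pow_of_map_eq_zero (q : E →+* K) {n : ℕ} {u : WittVector p E}
    (hu : WittVector.map q u = 0) : ghostComponent n u ∈ RingHom.ker q ^ (n + 1) := by
  rw [ghostComponent_eq_sum]
  refine sum_mem fun i hi => ?_
  have hp : (p : E) ∈ RingHom.ker q := by rw [RingHom.mem_ker, map_natCast, CharP.cast_eq_zero]
  have hc : u.coeff i ∈ RingHom.ker q := by
    rw [RingHom.mem_ker, ← WittVector.map_coeff, hu, WittVector.zero_coeff]
  have hi' : i ≤ n := Nat.lt_succ_iff.1 (Finset.mem_range.1 hi)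
  refine Ideal.pow_le_pow_right ?_ (pow_add (RingHom.ker q) i _ ▸
    Ideal.mul_mem_mul (Ideal.pow_mem_pow hp i) (Ideal.pow_mem_pow hc (p ^ (n - i))))
  have := Nat.lt_pow_self hpp.1.one_lt (n := n - i)
  omega

/-- Compatible ring homomorphisms from Witt vectors of a perfect quotient to the
infinitesimal neighbourhoods of that quotient. -/
theorem exists_wittVector_ringHom_quotient [PerfectRing K p] {q : E →+* K}
    (hq : Function.Surjective q) :
    ∃ θ : ∀ n : ℕ, WittVector p K →+* E ⧸ RingHom.ker q ^ (n + 1),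
      (∀ n y e, θ (n + 1) y = Ideal.Quotient.mk _ e → θ n y = Ideal.Quotient.mk _ e) ∧
      ∀ n y e, θ n y = Ideal.Quotient.mk _ e → q e = y.coeff 0 := by
  classical
  have hW := WittVector.map_surjective (p := p) q hq
  let θ' : ∀ n : ℕ, WittVector p K →+* E ⧸ RingHom.ker q ^ (n + 1) := fun n =>
    RingHom.liftOfSurjective (WittVector.map q) hW
      ⟨(Ideal.Quotient.mk _).comp (ghostComponent n), fun u hu => by
        rw [RingHom.mem_ker, RingHom.comp_apply, Ideal.Quotient.eq_zero_iff_mem]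
        exact ghostComponent_mem_pow_of_map_eq_zero q hu⟩
  have hθ' : ∀ n u, θ' n (WittVector.map q u) = Ideal.Quotient.mk _ (ghostComponent n u) :=
    fun n u => RingHom.liftOfRightInverse_comp_apply _ _ _ _ u
  let σ : WittVector p K →+* WittVector p K := (WittVector.frobeniusEquiv p K).symm.toRingHom
  have hσ : ∀ y, WittVector.frobenius (σ y) = y := fun y => (WittVector.frobeniusEquiv p K).apply_symm_apply y
  have hc : ∀ n y e, (θ' (n + 1)).comp (σ ^ (n + 1)) y = Ideal.Quotient.mk _ e →
      (θ' n).comp (σ ^ n) y = Ideal.Quotient.mk _ e := by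
    intro n y e h
    obtain ⟨u, hu⟩ := hW ((σ ^ (n + 1)) y)
    have h1 : (σ ^ n) y = WittVector.map q (WittVector.frobenius u) := by
      rw [WittVector.map_frobenius', hu, pow_succ']
      exact (hσ _).symm
    rw [RingHom.comp_apply, ← hu, hθ', Ideal.Quotient.eq] at h
    rw [RingHom.comp_apply, h1, hθ', ghostComponent_frobenius, Ideal.Quotient.eq]
    exact Ideal.pow_le_pow_right (Nat.le_succ _) h
  refine ⟨fun n => (θ' n).comp (σ ^ n), hc, ?_⟩
  intro n
  induction n with
  | zero =>
    intro y e h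
    obtain ⟨u, rfl⟩ := hW y
    change θ' 0 _ = _ at h
    rw [hθ', Ideal.Quotient.eq, zero_add, pow_one, RingHom.mem_ker, map_sub, sub_eq_zero] at h
    rw [← h, WittVector.map_coeff, ghostComponent_eq_sum]
    simp
  | succ n ih => exact fun y e h => ih y e (hc n y e h)

end Theta

section SuccessiveApproximation

open MvPowerSeries

theorem MvPowerSeries.exists_limit {σ W : Type*} [CommRing W] (Q : ℕ → MvPowerSeries σ W → Prop)
    (h0 : Q 0 0) (hs : ∀ n s, Q n s → ∃ h, (n : ℕ∞) ≤ h.order ∧ Q (n + 1) (s + h)) :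
    ∃ d, ∀ n, ∃ s, Q n s ∧ (n : ℕ∞) ≤ (d - s).order := by
  choose! h hh1 hh2 using hs
  let s : ℕ → MvPowerSeries σ W := fun n => Nat.rec 0 (fun n s => s + h n s) n
  have hsQ : ∀ n, Q n (s n) := by
    intro n
    induction n with
    | zero => exact h0
    | succ n ih => exact hh2 n _ ih
  have hst : ∀ (n k : ℕ) (m : σ →₀ ℕ), m.degree < n → coeff m (s (n + k)) = coeff m (s n) := by
    intro n k m hm
    induction k with
    | zero => rfl
    | succ k ih =>
      rw [← ih]
      change coeff m (s (n + k) + h _ _) = _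
      rw [map_add, coeff_of_lt_order (f := h _ _), add_zero]
      refine lt_of_lt_of_le ?_ (hh1 _ _ (hsQ _))
      exact_mod_cast hm.trans_le (Nat.le_add_right _ _)
  let d : MvPowerSeries σ W := fun m => coeff m (s (m.degree + 1))
  refine ⟨d, fun n => ⟨s n, hsQ n, le_order fun m hm => ?_⟩⟩
  have hm' : m.degree < n := by exact_mod_cast hm
  rw [map_sub, sub_eq_zero]
  change coeff m (s (m.degree + 1)) = _
  obtain ⟨k, rfl⟩ := Nat.exists_eq_add_of_le (Nat.succ_le_of_lt hm')
  rw [hst _ _ _ (Nat.lt_succ_self _)]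

end SuccessiveApproximation

section PowerSeriesPresentation

open MvPowerSeries

variable {ι W E : Type*} [CommRing W] [CommRing E] [Fintype ι]

theorem eval₂_mem_pow {B : Type*} [CommRing B] (θ : W →+* B) (x : ι → B) {I : Ideal B} (hx : ∀ i, x i ∈ I) {n : ℕ}
    {P : MvPolynomial ι W} (hP : P ∈ MvPolynomial.idealOfVars ι W ^ n) :
    MvPolynomial.eval₂Hom θ x P ∈ I ^ n := by
  have h1 : (MvPolynomial.idealOfVars ι W).map (MvPolynomial.eval₂Hom θ x) ≤ I := by
    rw [MvPolynomial.idealOfVars, Ideal.map_span, Ideal.span_le]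
    rintro _ ⟨_, ⟨i, rfl⟩, rfl⟩
    simpa using hx i
  have h2 := Ideal.mem_map_of_mem (MvPolynomial.eval₂Hom θ x) hP
  rw [Ideal.map_pow] at h2
  exact Ideal.pow_right_mono h1 n h2

theorem span_range_pow_le (x : ι → E) (m : ι →₀ ℕ) :
    Ideal.span (Set.range x) ^ (m.degree + 1) ≤ Ideal.span (Set.range fun i => x i ^ (m i + 1)) := by
  have h1 : (MvPolynomial.idealOfVars ι E).map (MvPolynomial.eval₂Hom (RingHom.id E) x) =
      Ideal.span (Set.range x) := by
    rw [MvPolynomial.idealOfVars, Ideal.map_span, ← Set.range_comp]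
    congr 2
    ext i
    simp
  rw [← h1, ← Ideal.map_pow, Ideal.map_le_iff_le_comap]
  intro P hP
  rw [MvPolynomial.mem_pow_idealOfVars_iff'] at hP
  rw [Ideal.mem_comap, MvPolynomial.coe_eval₂Hom, MvPolynomial.eval₂_eq']
  refine sum_mem fun m' hm' => Ideal.mul_mem_left _ _ ?_
  have hd : m.degree < m'.degree := by
    by_contra h
    exact MvPolynomial.mem_support_iff.1 hm' (hP m' (by omega))
  obtain ⟨i, hi⟩ : ∃ i, m i < m' i := by
    by_contra! h
    rw [Finsupp.degree_eq_sum, Finsupp.degree_eq_sum] at hd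
    exact absurd hd (not_lt.2 (Finset.sum_le_sum fun i _ => h i))
  refine Ideal.mem_of_dvd _ (Finset.dvd_prod_of_mem _ (Finset.mem_univ i)) ?_
  exact Ideal.mem_of_dvd _ (pow_dvd_pow _ hi) (Ideal.subset_span ⟨i, rfl⟩)

/-- The monomials of a given degree in a sequence with trivial first syzygies are
linearly independent modulo the next power. -/
theorem SyzTriv.mem_of_sum_monomial_mem {x : ι → E} (hx : SyzTriv ⊥ x) {n : ℕ}
    {T : Finset (ι →₀ ℕ)} (hT : ∀ m ∈ T, m.degree = n) (e : (ι →₀ ℕ) → E)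
    (h : ∑ m ∈ T, e m * ∏ i, x i ^ m i ∈ Ideal.span (Set.range x) ^ (n + 1))
    {m : ι →₀ ℕ} (hm : m ∈ T) : e m ∈ Ideal.span (Set.range x) := by
  classical
  have h1 : (∏ i, x i ^ m i) * e m ∈ (⊥ : Ideal E) ⊔ Ideal.span (Set.range fun i => x i ^ (m i + 1)) := by
    rw [bot_sup_eq]
    rw [← Finset.add_sum_erase _ _ hm, ← hT m hm] at h
    have h2 := span_range_pow_le x m h
    rw [mul_comm]
    refine (add_mem_cancel_right (sum_mem fun m' hm' => ?_)).1 h2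
    obtain ⟨hne, hm'⟩ := Finset.mem_erase.1 hm'
    obtain ⟨i, hi⟩ : ∃ i, m i < m' i := by
      by_contra! hle
      apply hne
      have hd : ∑ i, m' i = ∑ i, m i := by
        rw [← Finsupp.degree_eq_sum, ← Finsupp.degree_eq_sum, hT _ hm, hT _ hm']
      ext i
      exact (Finset.sum_eq_sum_iff_of_le fun i _ => hle i).1 hd i (Finset.mem_univ i)
    refine Ideal.mul_mem_left _ _ (Ideal.mem_of_dvd _ (Finset.dvd_prod_of_mem _ (Finset.mem_univ i)) ?_)
    exact Ideal.mem_of_dvd _ (pow_dvd_pow _ hi) (Ideal.subset_span ⟨i, rfl⟩)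
  have h2 := hx.colon _ _ (fun i => Nat.le_succ (m i)) h1
  simpa using h2

/-- Evaluation of power series modulo a power of the ideal generated by the values. -/
theorem exists_powerSeries_eval {x : ι → E} {I : Ideal E} (hxI : ∀ i, x i ∈ I) (n : ℕ)
    (θ : W →+* E ⧸ I ^ n) : ∃ Θ : MvPowerSeries ι W →+* E ⧸ I ^ n,
      ∀ g, Θ g = MvPolynomial.eval₂Hom θ (fun i => Ideal.Quotient.mk _ (x i)) (truncTotal n g) := by
  refine ⟨(Ideal.Quotient.lift (MvPolynomial.idealOfVars ι W ^ n) (MvPolynomial.eval₂Hom θ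
    (fun i => Ideal.Quotient.mk _ (x i))) ?_).comp (truncTotalAlgHom ι W n).toRingHom, fun g => ?_⟩
  · intro P hP
    have := eval₂_mem_pow θ (fun i => Ideal.Quotient.mk (I ^ n) (x i)) (I := I.map (Ideal.Quotient.mk (I ^ n)))
      (fun i => Ideal.mem_map_of_mem _ (hxI i)) hP
    rwa [← Ideal.map_pow, Ideal.map_quotient_self] at this
  · rfl

end PowerSeriesPresentation

section Presentation

open MvPowerSeries

/-- A ring in which a sequence with trivial first syzygies cuts out a perfect ring `K` maps to a
quotient of a power series ring over the Witt vectors of `K` by a distinguished element. -/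
theorem SyzTriv.exists_ringHom_powerSeries_quotient {p : ℕ} [hpp : Fact p.Prime] {ι E K : Type*} [CommRing E]
    [CommRing K] [CharP K p] [PerfectRing K p] [Fintype ι] {x : ι → E} (hx : SyzTriv ⊥ x)
    {q : E →+* K} (hq : Function.Surjective q) (hker : RingHom.ker q = Ideal.span (Set.range x)) :
    ∃ (f : ι → MvPowerSeries ι (WittVector p K)) (g : E →+* MvPowerSeries ι (WittVector p K) ⧸
        Ideal.span {(p : MvPowerSeries ι (WittVector p K)) - ∑ i, X i * f i}),
      ∀ i, g (x i) = Ideal.Quotient.mk _ (X i) := by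
  classical
  have hθ := exists_wittVector_ringHom_quotient (p := p) hq
  obtain ⟨I, hI⟩ : ∃ I, I = RingHom.ker q := ⟨_, rfl⟩
  rw [← hI] at hθ hker
  obtain ⟨θ, hθ1, hθ2⟩ := hθ
  have hxI : ∀ i, x i ∈ I := fun i => hker ▸ Ideal.subset_span ⟨i, rfl⟩
  choose Θ hΘ using fun n => exists_powerSeries_eval hxI (n + 1) (θ n)
  -- basic properties of the evaluation maps
  have hΘ0 : ∀ n g, ((n + 1 : ℕ) : ℕ∞) ≤ g.order → Θ n g = 0 := by
    intro n g hg
    rw [hΘ]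
    have : truncTotal (n + 1) g = 0 := by
      refine MvPolynomial.ext _ _ fun m => ?_
      rw [MvPolynomial.coeff_zero]
      by_cases hm : m.degree < n + 1
      · rw [coeff_truncTotal _ hm]
        exact coeff_of_lt_order (lt_of_lt_of_le (by exact_mod_cast hm) hg)
      · exact coeff_truncTotal_eq_zero _ (not_lt.1 hm)
    rw [this, map_zero]
  have hΘp : ∀ n (P : MvPolynomial ι (WittVector p K)), Θ n (P : MvPowerSeries ι (WittVector p K)) =
      MvPolynomial.eval₂Hom (θ n) (fun i => Ideal.Quotient.mk _ (x i)) P := by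
    intro n P
    rw [hΘ, ← sub_eq_zero, ← map_sub]
    have h1 : truncTotal (n + 1) (P : MvPowerSeries ι (WittVector p K)) - P ∈
        MvPolynomial.idealOfVars ι (WittVector p K) ^ (n + 1) := by
      rw [MvPolynomial.mem_pow_idealOfVars_iff']
      intro m hm
      rw [MvPolynomial.coeff_sub, coeff_truncTotal _ hm, MvPolynomial.coeff_coe, sub_self]
    have := eval₂_mem_pow (θ n) (fun i => Ideal.Quotient.mk (I ^ (n + 1)) (x i))
      (I := I.map (Ideal.Quotient.mk (I ^ (n + 1)))) (fun i => Ideal.mem_map_of_mem _ (hxI i)) h1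
    rwa [← Ideal.map_pow, Ideal.map_quotient_self] at this
  have hΘX : ∀ n i, Θ n (X i) = Ideal.Quotient.mk _ (x i) := by
    intro n i
    rw [← MvPolynomial.coe_X, hΘp]; simp
  have hΘC : ∀ n w, Θ n (C w) = θ n w := by
    intro n i
    rw [← MvPolynomial.coe_C, hΘp]; simp
  have hcompat : ∀ n g e, Θ (n + 1) g = Ideal.Quotient.mk _ e → Θ n g = Ideal.Quotient.mk _ e := by
    intro n g e h
    let τ : E ⧸ I ^ (n + 1 + 1) →+* E ⧸ I ^ (n + 1) :=
      Ideal.Quotient.factor (Ideal.pow_le_pow_right (Nat.le_succ _))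
    have hτ : ∀ e, τ (Ideal.Quotient.mk _ e) = Ideal.Quotient.mk _ e := fun e => rfl
    have h1 : τ.comp (θ (n + 1)) = θ n := by
      ext w
      obtain ⟨e, he⟩ := Ideal.Quotient.mk_surjective (θ (n + 1) w)
      rw [RingHom.comp_apply, ← he, hτ, hθ1 n w e he.symm]
    have h2 : τ.comp (MvPolynomial.eval₂Hom (θ (n + 1)) (fun i => Ideal.Quotient.mk _ (x i))) =
        MvPolynomial.eval₂Hom (θ n) (fun i => Ideal.Quotient.mk _ (x i)) := by
      refine MvPolynomial.ringHom_ext (fun w => ?_) (fun i => ?_)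
      · simp [← h1]
      · simp [hτ]
    rw [← hτ, ← h, hΘ (n + 1), ← RingHom.comp_apply, h2, ← hΘp, ← sub_eq_zero, ← map_sub]
    refine hΘ0 _ _ (le_order fun m hm => ?_)
    rw [map_sub, MvPolynomial.coeff_coe, coeff_truncTotal, sub_self]
    have : m.degree < n + 1 := by exact_mod_cast hm
    omega
  -- elements of a power of the ideal are approximated by series of the corresponding order
  have happ : ∀ (N n : ℕ) (z : E), z ∈ I ^ n → ∃ (h : MvPowerSeries ι (WittVector p K)) (z' : E),
      (n : ℕ∞) ≤ h.order ∧ Θ N h = Ideal.Quotient.mk _ z' ∧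
      z - z' ∈ I ^ (n + 1) := by
    intro N n
    induction n with
    | zero =>
      intro z _
      obtain ⟨e, he⟩ := Ideal.Quotient.mk_surjective (θ N (WittVector.teichmuller p (q z)))
      refine ⟨C (WittVector.teichmuller p (q z)), e, by simp, by rw [hΘC, he], ?_⟩
      rw [zero_add, pow_one, hI, RingHom.mem_ker, map_sub, hθ2 _ _ _ he.symm,
        WittVector.teichmuller_coeff_zero, sub_self]
    | succ n ih =>
      intro z hz
      rw [pow_succ'] at hz
      refine Submodule.mul_induction_on hz ?_ ?_
      · intro a ha b hb
        rw [hker, Ideal.mem_span_range_iff_exists_fun] at ha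
        obtain ⟨r, rfl⟩ := ha
        choose h z' h1 h2 h3 using fun i => ih (r i * b) (Ideal.mul_mem_left _ _ hb)
        refine ⟨∑ i, X i * h i, ∑ i, x i * z' i, ?_, ?_, ?_⟩
        · refine le_order fun m hm => ?_
          rw [map_sum]
          refine Finset.sum_eq_zero fun i _ => coeff_of_lt_order (lt_of_lt_of_le hm ?_)
          refine le_trans ?_ le_order_mul
          rw [add_comm n, Nat.cast_add]
          refine add_le_add ?_ (h1 i)
          rw [Nat.cast_one, one_le_order_iff_constCoeff_eq_zero]
          simp
        · rw [map_sum, map_sum]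
          exact Finset.sum_congr rfl fun i _ => by rw [map_mul, hΘX, h2, map_mul]
        · rw [Finset.sum_mul, ← Finset.sum_sub_distrib]
          refine sum_mem fun i _ => ?_
          rw [show r i * x i * b - x i * z' i = x i * (r i * b - z' i) by ring, pow_succ' I (n + 1)]
          exact Ideal.mul_mem_mul (hxI i) (h3 i)
      · rintro y z ⟨h, y', h1, h2, h3⟩ ⟨k, z', k1, k2, k3⟩
        refine ⟨h + k, y' + z', le_trans (le_min h1 k1) min_order_le_add, by
          rw [map_add, h2, k2, map_add], ?_⟩
        rw [add_sub_add_comm]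
        exact add_mem h3 k3
  have hsurj : ∀ e, ∃ d, ∀ n, Θ n d = Ideal.Quotient.mk _ e := by
    intro e
    obtain ⟨d, hd⟩ := exists_limit (fun n s => ∀ m < n, Θ m s = Ideal.Quotient.mk _ e) (by simp) (by
      intro n s hs
      obtain ⟨e1, he1⟩ := Ideal.Quotient.mk_surjective (Θ n s)
      have hz : e - e1 ∈ I ^ n := by
        rcases n with _ | n
        · simp
        · have h1 := hcompat n s e1 he1.symm
          rw [hs n (Nat.lt_succ_self n), Ideal.Quotient.eq] at h1
          exact h1
      obtain ⟨h, z', h1, h2, h3⟩ := happ n n _ hz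
      refine ⟨h, h1, fun m hm => ?_⟩
      rw [map_add]
      rcases Nat.lt_succ_iff_lt_or_eq.1 hm with hm | rfl
      · rw [hs m hm, hΘ0 m h (le_trans (by exact_mod_cast hm) h1), add_zero]
      · rw [h2, ← he1, ← map_add, eq_comm, Ideal.Quotient.eq]
        convert h3 using 1
        ring)
    refine ⟨d, fun n => ?_⟩
    obtain ⟨s, hs1, hs2⟩ := hd (n + 1)
    have := hΘ0 n _ hs2
    rw [map_sub, sub_eq_zero] at this
    rw [this, hs1 n (Nat.lt_succ_self n)]
  obtain ⟨a, ha⟩ : ∃ a : ι → E, ∑ i, x i * a i = p := by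
    have : (p : E) ∈ I := by rw [hI, RingHom.mem_ker, map_natCast, CharP.cast_eq_zero]
    rw [hker, Ideal.mem_span_range_iff_exists_fun] at this
    obtain ⟨c, hc⟩ := this
    exact ⟨c, by rw [← hc]; exact Finset.sum_congr rfl fun i _ => mul_comm _ _⟩
  choose f hf using fun i => hsurj (a i)
  set ξ := (p : MvPowerSeries ι (WittVector p K)) - ∑ i, X i * f i with hξ
  have hΘξ : ∀ n, Θ n ξ = 0 := by
    intro n
    rw [hξ, map_sub, map_natCast, map_sum, sub_eq_zero]
    simp_rw [map_mul, hΘX, hf, ← map_mul]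
    rw [← map_sum, ha, map_natCast]
  have hkerΘ : ∀ v, (∀ n, Θ n v = 0) → v ∈ Ideal.span {ξ} := by
    intro v hv
    obtain ⟨d, hd⟩ := exists_limit (fun n s => (n : ℕ∞) ≤ (v - ξ * s).order) (by simp) (by
      intro n s hs
      set v' := v - ξ * s with hv'
      have hv'0 : Θ n v' = 0 := by rw [hv', map_sub, hv, map_mul, hΘξ, zero_mul, sub_zero]
      have hcoef : ∀ m : ι →₀ ℕ, m.degree = n → ∃ w : WittVector p K, coeff m v' = p * w := by
        intro m hm
        choose e he using fun m => Ideal.Quotient.mk_surjective (I := I ^ (n + 1)) (θ n (coeff m v'))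
        rw [hΘ, MvPolynomial.coe_eval₂Hom, MvPolynomial.eval₂_eq'] at hv'0
        have hT : ∀ m ∈ (truncTotal (n + 1) v').support, m.degree = n := by
          intro m hm
          rw [MvPolynomial.mem_support_iff] at hm
          by_contra hne
          rcases lt_or_gt_of_ne hne with h | h
          · rw [coeff_truncTotal _ (by omega), coeff_of_lt_order (lt_of_lt_of_le (by exact_mod_cast h) hs)] at hm
            exact hm rfl
          · exact hm (coeff_truncTotal_eq_zero _ h)
        have h1 : ∑ m ∈ (truncTotal (n + 1) v').support, e m * ∏ i, x i ^ m i ∈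
            Ideal.span (Set.range x) ^ (n + 1) := by
          rw [← hker, ← Ideal.Quotient.eq_zero_iff_mem, ← hv'0, map_sum]
          refine Finset.sum_congr rfl fun m hm => ?_
          rw [map_mul, he, map_prod, coeff_truncTotal _ (by rw [hT m hm]; omega)]
          simp
        have h2 : (coeff m v').coeff 0 = 0 := by
          by_cases hmT : m ∈ (truncTotal (n + 1) v').support
          · have := hx.mem_of_sum_monomial_mem hT e h1 hmT
            rw [← hker, hI, RingHom.mem_ker, hθ2 _ _ _ (he m).symm] at this
            exact this
          · rw [MvPolynomial.notMem_support_iff, coeff_truncTotal _ (by omega)] at hmT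
            rw [hmT, WittVector.zero_coeff]
        rw [← WittVector.mem_span_p_iff_coeff_zero_eq_zero, Ideal.mem_span_singleton'] at h2
        obtain ⟨w, hw⟩ := h2
        exact ⟨w, by rw [← hw, mul_comm]⟩
      choose! w hw using hcoef
      let h : MvPowerSeries ι (WittVector p K) := fun m => if m.degree = n then w m else 0
      have hh : ∀ m, coeff m h = if m.degree = n then w m else 0 := fun m => rfl
      have hho : (n : ℕ∞) ≤ h.order := le_order fun m hm => by
        rw [hh, if_neg]
        exact ne_of_lt (by exact_mod_cast hm)
      refine ⟨h, hho, le_order fun m hm => ?_⟩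
      have hm' : m.degree ≤ n := by
        have : m.degree < n + 1 := by exact_mod_cast hm
        omega
      have h3 : coeff m ((∑ i, X i * f i) * h) = 0 := by
        refine coeff_of_lt_order (lt_of_lt_of_le hm (le_trans ?_ le_order_mul))
        rw [add_comm n, Nat.cast_add]
        refine add_le_add ?_ hho
        rw [Nat.cast_one, one_le_order_iff_constCoeff_eq_zero]
        simp
      have h4 : v - ξ * (s + h) = v' - C (p : WittVector p K) * h + (∑ i, X i * f i) * h := by
        rw [hv', hξ, map_natCast]; ring
      rw [h4, map_add, h3, add_zero, map_sub, coeff_C_mul, hh]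
      rcases hm'.lt_or_eq with hlt | heq
      · rw [if_neg hlt.ne, mul_zero, sub_zero]
        exact coeff_of_lt_order (lt_of_lt_of_le (by exact_mod_cast hlt) hs)
      · rw [if_pos heq, hw m heq, sub_self])
    rw [Ideal.mem_span_singleton']
    refine ⟨d, ?_⟩
    rw [mul_comm, eq_comm, ← sub_eq_zero, ← order_eq_top_iff, ENat.eq_top_iff_forall_ge]
    intro n
    obtain ⟨s, hs1, hs2⟩ := hd n
    rw [show v - ξ * d = (v - ξ * s) + ξ * (-(d - s)) by ring]
    refine le_trans (le_min hs1 ?_) min_order_le_add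
    refine le_trans ?_ le_order_mul
    rw [order_neg]
    exact le_trans hs2 le_add_self
  choose δ hδ using hsurj
  have hmk : ∀ e d, (∀ n, Θ n d = Ideal.Quotient.mk _ e) →
      Ideal.Quotient.mk (Ideal.span {ξ}) (δ e) = Ideal.Quotient.mk (Ideal.span {ξ}) d := by
    intro e d hd
    rw [Ideal.Quotient.eq]
    exact hkerΘ _ fun n => by rw [map_sub, hδ, hd, sub_self]
  refine ⟨f, { toFun := fun e => Ideal.Quotient.mk (Ideal.span {ξ}) (δ e), map_one' := ?_, map_mul' := ?_, map_zero' := ?_, map_add' := ?_ }, ?_⟩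
  · rw [hmk 1 1 (fun n => by simp), map_one]
  · intro a b
    rw [hmk (a * b) (δ a * δ b) (fun n => by rw [map_mul, hδ, hδ, map_mul]), map_mul]
  · beta_reduce
    rw [hmk 0 0 (fun n => by simp), map_zero]
  · intro a b
    beta_reduce
    rw [hmk (a + b) (δ a + δ b) (fun n => by rw [map_add, hδ, hδ, map_add]), map_add]
  · exact fun i => hmk _ _ fun n => hΘX n i

end Presentation

section PowerSeriesToWitt

open WittVector MvPowerSeries

variable {p : ℕ} [hpp : Fact p.Prime] {ι K : Type*} [CommRing K] [CharP K p] [PerfectRing K p]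

/-- Power series over `W(K)` map to the Witt vectors of power series over `K`, with the variables
going to their Teichmüller representatives. -/
theorem exists_powerSeries_wittVector_teichmuller :
    ∃ ψ : MvPowerSeries ι (WittVector p K) →+* WittVector p (MvPowerSeries ι K),
      ∀ i, ψ (X i) = teichmuller p (X i) := by
  have hmul : ∀ (a : MvPowerSeries ι (WittVector p K)) m,
      coeff m ((p : MvPowerSeries ι (WittVector p K)) * a) = coeff m a * p := by
    intro a m
    rw [← nsmul_eq_mul, map_nsmul, nsmul_eq_mul, mul_comm]
  have hp : ∀ a : MvPowerSeries ι (WittVector p K),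
      (p : MvPowerSeries ι (WittVector p K)) * a = 0 → a = 0 := by
    intro a ha
    refine MvPowerSeries.ext fun m => ?_
    rw [map_zero]
    exact eq_zero_of_p_mul_eq_zero _ (by rw [← hmul, ha, map_zero])
  have hdvd : ∀ a : MvPowerSeries ι (WittVector p K),
      MvPowerSeries.map WittVector.constantCoeff a = 0 → (p : MvPowerSeries ι (WittVector p K)) ∣ a := by
    intro a ha
    have : ∀ m, ∃ b, coeff m a = b * p := by
      intro m
      have h1 : (coeff m a).coeff 0 = 0 := by
        have := congrArg (MvPowerSeries.coeff m) ha
        rwa [MvPowerSeries.coeff_map, map_zero] at this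
      rw [← mem_span_p_iff_coeff_zero_eq_zero, Ideal.mem_span_singleton'] at h1
      obtain ⟨b, hb⟩ := h1
      exact ⟨b, hb.symm⟩
    choose b hb using this
    let b' : MvPowerSeries ι (WittVector p K) := fun m => b m
    refine ⟨b', MvPowerSeries.ext fun m => ?_⟩
    rw [hmul, hb]; rfl
  have hp0 : p ≠ 0 := hpp.out.ne_zero
  obtain ⟨φ, hφd⟩ : ∃ φ : MvPowerSeries ι (WittVector p K) →+* MvPowerSeries ι (WittVector p K),
      ∀ a, φ a = MvPowerSeries.map WittVector.frobenius (MvPowerSeries.expand p hp0 a) :=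
    ⟨(MvPowerSeries.map WittVector.frobenius).comp
      (RingHomClass.toRingHom (MvPowerSeries.expand p hp0)), fun a => rfl⟩
  have hφX : ∀ i, φ (X i) = X i ^ p := by
    intro i
    rw [hφd, expand_X, map_pow, MvPowerSeries.map_X]
  have hφ : ∀ a, (p : MvPowerSeries ι (WittVector p K)) ∣ φ a - a ^ p := by
    intro a
    apply hdvd
    rw [map_sub, map_pow, sub_eq_zero]
    have h1 : MvPowerSeries.map WittVector.constantCoeff (φ a) = MvPowerSeries.map (_root_.frobenius K p)
        (MvPowerSeries.map WittVector.constantCoeff (MvPowerSeries.expand p hp0 a)) := by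
      refine MvPowerSeries.ext fun m => ?_
      rw [hφd, MvPowerSeries.coeff_map, MvPowerSeries.coeff_map, MvPowerSeries.coeff_map, MvPowerSeries.coeff_map]
      change (WittVector.frobenius _).coeff 0 = _
      rw [coeff_frobenius_charP]; rfl
    rw [h1, map_expand, map_frobenius_expand]
  obtain ⟨s, hs⟩ := exists_ringHom_wittVector hp φ hφ
  have hsX : ∀ i, s (X i) = teichmuller p (X i) := by
    intro i
    refine WittVector.ext_ghostComponent hp fun n => ?_
    rw [hs, ghostComponent_teichmuller]
    induction n with
    | zero => simp
    | succ n ih => rw [Function.iterate_succ_apply', ih, map_pow, hφX, ← pow_mul, pow_succ']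
  refine ⟨(WittVector.map (MvPowerSeries.map WittVector.constantCoeff)).comp s, fun i => ?_⟩
  rw [RingHom.comp_apply, hsX, map_teichmuller, MvPowerSeries.map_X]

end PowerSeriesToWitt

section PerfectClosureLemmas

variable {p : ℕ} [hpp : Fact p.Prime] {Q : Type*} [CommRing Q] [CharP Q p]

theorem PerfectClosure.of_injective [IsReduced Q] :
    Function.Injective (PerfectClosure.of Q p) := by
  intro a b h
  simpa using (PerfectClosure.eq_iff Q p (0, a) (0, b)).1 h

theorem PerfectClosure.exists_pow_eq_of {ι : Type*} [Fintype ι] (s : ι → PerfectClosure Q p) :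
    ∃ (n : ℕ) (b : ι → Q), ∀ i, s i ^ p ^ n = PerfectClosure.of Q p (b i) := by
  have h1 : ∀ a : PerfectClosure Q p, ∃ (n : ℕ) (b : Q), a ^ p ^ n = PerfectClosure.of Q p b := by
    intro a
    obtain ⟨⟨n, b⟩, rfl⟩ := PerfectClosure.mk_surjective Q p a
    refine ⟨n, b, ?_⟩
    rw [← PerfectClosure.iterate_frobenius_mk, iterate_frobenius]
  choose m b hb using fun i => h1 (s i)
  refine ⟨∑ i, m i, fun i => b i ^ p ^ (∑ j, m j - m i), fun i => ?_⟩
  have : m i ≤ ∑ j, m j := Finset.single_le_sum (f := m) (fun _ _ => Nat.zero_le _)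
    (Finset.mem_univ i)
  rw [map_pow, ← hb, ← pow_mul, ← pow_add, Nat.add_sub_cancel' this]

theorem PerfectClosure.isDomain [IsDomain Q] : IsDomain (PerfectClosure Q p) := by
  have : NoZeroDivisors (PerfectClosure Q p) := by
    refine ⟨fun {a b} hab => ?_⟩
    obtain ⟨n, c, hc⟩ := PerfectClosure.exists_pow_eq_of ![a, b]
    have h0 := hc 0
    have h1 := hc 1
    simp only [Matrix.cons_val_zero, Matrix.cons_val_one] at h0 h1
    have hn : p ^ n ≠ 0 := (pow_pos hpp.out.pos n).ne'
    have : c 0 * c 1 = 0 := by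
      apply PerfectClosure.of_injective (p := p)
      rw [map_mul, ← h0, ← h1, ← mul_pow, hab, zero_pow hn, map_zero]
    rcases mul_eq_zero.1 this with h | h
    · left; rw [h, map_zero] at h0; exact eq_zero_of_pow_eq_zero h0
    · right; rw [h, map_zero] at h1; exact eq_zero_of_pow_eq_zero h1
  exact NoZeroDivisors.to_isDomain _

theorem SyzTriv.perfectClosure [IsReduced Q] {ι : Type*} [Fintype ι] {x : ι → Q}
    (hx : SyzTriv ⊥ x) : SyzTriv ⊥ (fun i => PerfectClosure.of Q p (x i)) := by
  intro s hs
  obtain ⟨n, b, hb⟩ := PerfectClosure.exists_pow_eq_of s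
  have hn : 1 ≤ p ^ n := Nat.one_le_pow _ _ hpp.out.pos
  obtain ⟨c, h1, h2, h3⟩ := hx.pow (fun _ => p ^ n) (fun _ => hn) b (by
    rw [Ideal.mem_bot] at hs ⊢
    apply PerfectClosure.of_injective (p := p)
    have := congrArg (iterateFrobenius _ p n) hs
    simp only [map_sum, map_mul, iterateFrobenius_def, map_zero, hb] at this
    simpa using this)
  let F := iterateFrobeniusEquiv (PerfectClosure Q p) p n
  have hF : ∀ a, F a = a ^ p ^ n := fun a => iterateFrobeniusEquiv_apply _ _ _ _
  refine ⟨fun i j => F.symm (PerfectClosure.of Q p (c i j)), fun i j => ?_, fun i => ?_, fun i => ?_⟩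
  · beta_reduce; rw [h1 i j, map_neg, map_neg]
  · beta_reduce; rw [h2, map_zero, map_zero]
  · rw [Ideal.mem_bot]
    apply F.injective
    have := h3 i
    rw [Ideal.mem_bot] at this
    have := congrArg (PerfectClosure.of Q p) this
    simp only [map_sub, map_sum, map_mul, map_zero, map_pow] at this
    rw [map_sub, map_sum, map_zero, hF, hb]
    simp only [map_mul, RingEquiv.apply_symm_apply, hF, mul_pow] at this ⊢
    simp only [← hF, RingEquiv.apply_symm_apply]
    simp only [hF]
    exact this

theorem PerfectClosure.exists_pow_eq_of_mem_span [IsReduced Q] {ι : Type*} [Fintype ι] {x : ι → Q}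
    {a : PerfectClosure Q p} (ha : a ∈ Ideal.span (Set.range fun i => PerfectClosure.of Q p (x i))) :
    ∃ (n : ℕ) (b : Q), b ∈ Ideal.span (Set.range x) ∧ a ^ p ^ n = PerfectClosure.of Q p b := by
  obtain ⟨s, rfl⟩ := Ideal.mem_span_range_iff_exists_fun.1 ha
  obtain ⟨n, b, hb⟩ := PerfectClosure.exists_pow_eq_of s
  have hn : p ^ n ≠ 0 := (pow_pos hpp.out.pos n).ne'
  refine ⟨n, ∑ i, b i * x i ^ p ^ n, sum_mem fun i _ => Ideal.mul_mem_left _ _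
    (Ideal.pow_mem_of_mem _ (Ideal.subset_span (Set.mem_range_self i)) _
      (Nat.pos_of_ne_zero hn)), ?_⟩
  rw [← iterateFrobenius_def, map_sum]
  simp [iterateFrobenius_def, hb, mul_pow]

theorem PerfectClosure.one_notMem_span [IsReduced Q] {ι : Type*} [Fintype ι] {x : ι → Q}
    (h : (1 : Q) ∉ Ideal.span (Set.range x)) :
    (1 : PerfectClosure Q p) ∉ Ideal.span (Set.range fun i => PerfectClosure.of Q p (x i)) := by
  intro h1
  obtain ⟨n, b, hb, h2⟩ := PerfectClosure.exists_pow_eq_of_mem_span h1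
  rw [one_pow, ← map_one (PerfectClosure.of Q p)] at h2
  exact h (PerfectClosure.of_injective (p := p) h2 ▸ hb)

end PerfectClosureLemmas

section WittLemmas

open WittVector

variable {p : ℕ} [hpp : Fact p.Prime] {P : Type*} [CommRing P] [CharP P p]

theorem WittVector.isUnit_of_isUnit_coeff_zero {w : WittVector p P} (h : IsUnit (w.coeff 0)) :
    IsUnit w :=
  (mkUnit (a := h.unit) (A := w) rfl).isUnit

theorem SyzTriv.wittVector_append [PerfectRing P p] {ι : Type*} [Fintype ι] {x : ι → P}
    (hx : SyzTriv ⊥ x) :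
    SyzTriv (⊥ : Ideal (WittVector p P))
      (Sum.elim (fun _ : Unit => (p : WittVector p P)) fun i => teichmuller p (x i)) := by
  refine SyzTriv.append (SyzTriv.unique fun s hs => ?_) ?_
  · rw [Ideal.mem_bot] at hs ⊢
    exact eq_zero_of_p_mul_eq_zero s (by rw [mul_comm]; exact hs)
  · have h1 : (⊥ : Ideal (WittVector p P)) ⊔ Ideal.span (Set.range fun _ : Unit => (p : WittVector p P)) =
        (⊥ : Ideal P).comap (constantCoeff : WittVector p P →+* P) := by
      rw [bot_sup_eq, Set.range_const, ← RingHom.ker_eq_comap_bot, ker_constantCoeff]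
    rw [h1]
    refine SyzTriv.of_surjective _ (constantCoeff_surjective p) ?_
    convert hx using 1
    funext i
    exact teichmuller_coeff_zero p (x i)

theorem one_notMem_span_teichmuller {ι : Type*} {x : ι → P} (hx : (1 : P) ∉ Ideal.span (Set.range x))
    {ξ : WittVector p P} (hξ : ξ.coeff 0 ∈ Ideal.span (Set.range x)) :
    (1 : WittVector p P ⧸ Ideal.span {ξ}) ∉
      Ideal.span (Set.range fun i => Ideal.Quotient.mk _ (teichmuller p (x i))) := by
  intro h
  have h0 : (Set.range fun i => Ideal.Quotient.mk (Ideal.span {ξ}) (teichmuller p (x i))) =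
      Ideal.Quotient.mk (Ideal.span {ξ}) '' (Set.range fun i => teichmuller p (x i)) := by
    rw [← Set.range_comp]; rfl
  rw [h0, ← Ideal.map_span, ← map_one (Ideal.Quotient.mk (Ideal.span {ξ})),
    Ideal.mem_quotient_iff_mem_sup] at h
  have h2 := Ideal.mem_map_of_mem (constantCoeff : WittVector p P →+* P) h
  rw [map_one] at h2
  have h3 : Ideal.map (constantCoeff : WittVector p P →+* P)
      (Ideal.span (Set.range fun i => teichmuller p (x i)) ⊔ Ideal.span {ξ}) ≤
      Ideal.span (Set.range x) := by
    rw [Ideal.map_le_iff_le_comap, sup_le_iff, Ideal.span_le, Ideal.span_le]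
    constructor
    · rintro _ ⟨i, rfl⟩
      change (teichmuller p (x i)).coeff 0 ∈ Ideal.span (Set.range x)
      rw [teichmuller_coeff_zero]
      exact Ideal.subset_span ⟨i, rfl⟩
    · rintro _ rfl
      exact hξ
  exact hx (h3 h2)

end WittLemmas

section Descent

open IsLocalRing

/-- Parameters with trivial syzygies detect membership in their power ideals after any base change
that keeps the syzygies trivial. -/
theorem SyzTriv.mem_of_map_mem {A B ι : Type*} [CommRing A] [CommRing B] [Fintype ι]
    [IsLocalRing A] [IsNoetherianRing A] {x : ι → A} (hx : SyzTriv ⊥ x)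
    (hm : Ideal.span (Set.range x) = maximalIdeal A) (g : A →+* B)
    (hy : SyzTriv ⊥ (fun i => g (x i))) (h1 : (1 : B) ∉ Ideal.span (Set.range fun i => g (x i)))
    {t : ℕ} (ht : 1 ≤ t) {a : A} (ha : g a ∈ Ideal.span (Set.range fun i => g (x i) ^ t)) :
    a ∈ Ideal.span (Set.range fun i => x i ^ t) := by
  have hmap : (Ideal.span (Set.range fun i => g (x i) ^ t)) =
      (Ideal.span (Set.range fun i => x i ^ t)).map g := by
    rw [Ideal.map_span, ← Set.range_comp]
    simp [Function.comp_def]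
  refine SyzTriv.le_of_prod_notMem hx ht hm ((Ideal.span (Set.range fun i => g (x i) ^ t)).comap g)
    ?_ ?_ ha
  · rw [hmap]; exact Ideal.le_comap_map
  · intro hz
    rw [Ideal.mem_comap, map_prod] at hz
    apply h1
    have := hy.colon (fun _ => t - 1) (fun _ => t) (fun _ => Nat.sub_le _ _) (v := 1) (by
      rw [bot_sup_eq, mul_one]; simpa using hz)
    rw [bot_sup_eq] at this
    simpa [Nat.sub_sub_self ht] using this

theorem SyzTriv.eq_zero_of_map_mem {A B ι : Type*} [CommRing A] [CommRing B] [Fintype ι]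
    [IsLocalRing A] [IsNoetherianRing A] {x : ι → A} (hx : SyzTriv ⊥ x)
    (hm : Ideal.span (Set.range x) = maximalIdeal A) (g : A →+* B)
    (hy : SyzTriv ⊥ (fun i => g (x i))) (h1 : (1 : B) ∉ Ideal.span (Set.range fun i => g (x i)))
    {a : A} (ha : ∀ t, 1 ≤ t → g a ∈ Ideal.span (Set.range fun i => g (x i) ^ t)) : a = 0 := by
  have : a ∈ (⨅ n : ℕ, maximalIdeal A ^ n) := by
    rw [Ideal.mem_iInf]
    intro n
    rcases Nat.eq_zero_or_pos n with rfl | hn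
    · simp
    · refine (Ideal.span_le.2 ?_) (SyzTriv.mem_of_map_mem hx hm g hy h1 hn (ha n hn))
      rintro _ ⟨i, rfl⟩
      exact Ideal.pow_mem_pow (hm ▸ Ideal.subset_span ⟨i, rfl⟩) n
  rwa [Ideal.iInf_pow_eq_bot_of_isLocalRing _ (maximalIdeal.isMaximal A).ne_top, Ideal.mem_bot]
    at this

end Descent

universe u v

section WittPresentation

open WittVector IsLocalRing

theorem MvPowerSeries.one_notMem_span_X {ι K : Type*} [CommRing K] [Nontrivial K] :
    (1 : MvPowerSeries ι K) ∉ Ideal.span (Set.range (MvPowerSeries.X : ι → MvPowerSeries ι K)) := by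
  intro h
  have : Ideal.span (Set.range (MvPowerSeries.X : ι → MvPowerSeries ι K)) ≤
      RingHom.ker (MvPowerSeries.constantCoeff (σ := ι) (R := K)) := by
    rw [Ideal.span_le]
    rintro _ ⟨i, rfl⟩
    exact MvPowerSeries.constantCoeff_X i
  have := this h
  rw [RingHom.mem_ker, map_one] at this
  exact one_ne_zero this

theorem PerfectClosure.isUnit_one_sub_powerSeries {p : ℕ} [hpp : Fact p.Prime] {ι K : Type*} [Fintype ι]
    [Field K] [CharP (MvPowerSeries ι K) p] {a : PerfectClosure (MvPowerSeries ι K) p}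
    (ha : a ∈ Ideal.span (Set.range fun i => PerfectClosure.of (MvPowerSeries ι K) p (MvPowerSeries.X i))) :
    IsUnit (1 - a) := by
  obtain ⟨n, b, hb, h⟩ := PerfectClosure.exists_pow_eq_of_mem_span ha
  have hn : p ^ n ≠ 0 := (pow_pos hpp.out.pos n).ne'
  rw [← isUnit_pow_iff hn, sub_pow_char_pow, one_pow, h, ← map_one (PerfectClosure.of _ p), ← map_sub]
  apply IsUnit.map
  rw [MvPowerSeries.isUnit_iff_constantCoeff]
  have : Ideal.span (Set.range (MvPowerSeries.X : ι → MvPowerSeries ι K)) ≤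
      RingHom.ker (MvPowerSeries.constantCoeff (σ := ι) (R := K)) := by
    rw [Ideal.span_le]
    rintro _ ⟨i, rfl⟩
    exact MvPowerSeries.constantCoeff_X i
  have := this hb
  rw [RingHom.mem_ker] at this
  rw [map_sub, map_one, this, sub_zero]
  exact isUnit_one

theorem SyzTriv.of_forall_finset {S ι : Type*} [CommRing S] [Fintype ι] {x : ι → S}
    (h : ∀ (T : Finset ι) (j : ι), j ∉ T → ∀ s, x j * s ∈ Ideal.span (x '' T) →
      s ∈ Ideal.span (x '' T)) : SyzTriv ⊥ x := by
  classical
  have key : ∀ (n : ℕ) (e : Fin n → ι), Function.Injective e → SyzTriv ⊥ (fun i => x (e i)) := by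
    intro n
    induction n with
    | zero => exact fun e _ => SyzTriv.of_isEmpty _
    | succ n ih =>
      intro e he
      have h1 := ih (fun i => e i.castSucc) (fun i j hij => Fin.castSucc_injective n (he hij))
      have h2 : SyzTriv (⊥ ⊔ Ideal.span (Set.range fun i : Fin n => x (e i.castSucc)))
          (fun _ : Fin 1 => x (e (Fin.last n))) := by
        have hr : (Set.range fun i : Fin n => x (e i.castSucc)) =
            x '' (Finset.univ.image fun i : Fin n => e i.castSucc : Finset ι) := by
          rw [Finset.coe_image, Finset.coe_univ, Set.image_univ, ← Set.range_comp]; rfl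
        refine SyzTriv.unique fun s hs => ?_
        rw [bot_sup_eq, hr] at hs ⊢
        refine h _ _ (fun hmem => ?_) s hs
        obtain ⟨i, -, hi⟩ := Finset.mem_image.1 hmem
        exact (Fin.castSucc_lt_last i).ne (he hi)
      have h3 := (h1.append h2).reindex finSumFinEquiv.symm
      convert h3 using 1
      ext1 i
      induction i using Fin.lastCases with
      | last =>
        have : Fin.last n = Fin.natAdd n (0 : Fin 1) := by ext; simp
        rw [Function.comp, this, finSumFinEquiv_symm_apply_natAdd]
        simp [← this]
      | cast i =>
        have : i.castSucc = Fin.castAdd 1 i := rfl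
        rw [Function.comp, this, finSumFinEquiv_symm_apply_castAdd]
        rfl
  have h1 := (key _ (Fintype.equivFin ι).symm (Equiv.injective _)).reindex (Fintype.equivFin ι)
  convert h1 using 1
  funext i
  simp

theorem MvPowerSeries.mem_span_X_image_iff {ι K : Type*} [CommRing K] (T : Finset ι)
    {s : MvPowerSeries ι K} :
    s ∈ Ideal.span ((X : ι → MvPowerSeries ι K) '' T) ↔
      ∀ m : ι →₀ ℕ, (∀ i ∈ T, m i = 0) → coeff m s = 0 := by
  classical
  constructor
  · intro hs
    induction hs using Submodule.span_induction with
    | mem y hy =>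
      intro m hm
      obtain ⟨i, hi, rfl⟩ := hy
      exact X_dvd_iff.1 dvd_rfl m (hm i hi)
    | zero => simp
    | add a b _ _ ha hb => exact fun m hm => by rw [map_add, ha m hm, hb m hm, add_zero]
    | smul a b _ hb =>
      intro m hm
      rw [smul_eq_mul, coeff_mul]
      refine Finset.sum_eq_zero fun y hy => ?_
      rw [hb y.2 fun i hi => ?_, mul_zero]
      have := DFunLike.congr_fun (Finset.HasAntidiagonal.mem_antidiagonal.1 hy) i
      rw [hm i hi, Finsupp.add_apply] at this
      omega
  · induction T using Finset.induction_on generalizing s with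
    | empty =>
      intro h
      have : s = 0 := MvPowerSeries.ext fun m => by rw [h m (by simp), map_zero]
      rw [this]; exact zero_mem _
    | insert j T hj ih =>
      intro h
      let s0 : MvPowerSeries ι K := fun m => if m j = 0 then coeff m s else 0
      have hs0 : ∀ m, coeff m s0 = if m j = 0 then coeff m s else 0 := fun m => rfl
      have h1 : s0 ∈ Ideal.span ((X : ι → MvPowerSeries ι K) '' T) := by
        refine ih fun m hm => ?_
        rw [hs0]
        split_ifs with hmj
        · exact h m fun i hi => (Finset.mem_insert.1 hi).elim (fun h => h ▸ hmj) (hm i)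
        · rfl
      have h2 : X j ∣ s - s0 := by
        refine X_dvd_iff.2 fun m hm => ?_
        rw [map_sub, hs0, if_pos hm, sub_self]
      rw [Finset.coe_insert, Set.image_insert_eq, Ideal.span_insert]
      rw [← sub_add_cancel s s0]
      exact add_mem (Ideal.mem_sup_left (Ideal.mem_span_singleton.2 h2)) (Ideal.mem_sup_right h1)

theorem SyzTriv.mvPowerSeries_X {ι K : Type*} [Fintype ι] [CommRing K] :
    SyzTriv ⊥ (MvPowerSeries.X : ι → MvPowerSeries ι K) := by
  classical
  refine SyzTriv.of_forall_finset fun T j hj s hs => ?_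
  rw [MvPowerSeries.mem_span_X_image_iff] at hs ⊢
  intro m hm
  have := hs (Finsupp.single j 1 + m) fun i hi => by
    have : j ≠ i := fun h => hj (h ▸ hi)
    simp [this, hm i hi]
  rw [MvPowerSeries.X, MvPowerSeries.coeff_add_monomial_mul, one_mul] at this
  exact this

theorem WittVector.coeff_zero_pow_mem {p : ℕ} [hpp : Fact p.Prime] {P : Type*} [CommRing P] [CharP P p]
    {I : Ideal P} {G F : WittVector p P} {ϖ : P} (hF : WittVector.map (Ideal.Quotient.mk I) F = 0)
    (hϖ : ϖ ∈ I) (h : F - teichmuller p ϖ = G * p) : G.coeff 0 ^ p ∈ I := by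
  rcases subsingleton_or_nontrivial (P ⧸ I) with hs | hs
  · rw [← Ideal.Quotient.eq_zero_iff_mem]; exact Subsingleton.elim _ _
  have : CharP (P ⧸ I) p := by
    refine (CharP.charP_iff_prime_eq_zero hpp.out).2 ?_
    rw [← map_natCast (Ideal.Quotient.mk I), CharP.cast_eq_zero, map_zero]
  have h1 := congrArg (WittVector.map (Ideal.Quotient.mk I)) h
  rw [map_sub, hF, map_teichmuller, Ideal.Quotient.eq_zero_iff_mem.2 hϖ, teichmuller_zero, sub_zero,
    map_mul, map_natCast] at h1
  have h2 := mul_charP_coeff_succ (WittVector.map (Ideal.Quotient.mk I) G) 0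
  rw [← h1, zero_coeff, map_coeff, ← map_pow] at h2
  exact Ideal.Quotient.eq_zero_iff_mem.1 h2.symm

theorem WittVector.exists_unit_natCast_sub_eq {p : ℕ} [hpp : Fact p.Prime] {P : Type*} [CommRing P]
    [CharP P p] [PerfectRing P p] {I : Ideal P} {F : WittVector p P}
    (hF : WittVector.map (Ideal.Quotient.mk I) F = 0) (hI : ∀ a ∈ I, IsUnit (1 - a)) :
    ∃ u : (WittVector p P)ˣ,
      Ideal.span {(p : WittVector p P) - F} =
        Ideal.span {(p : WittVector p P) - teichmuller p (F.coeff 0) * (u : WittVector p P)} := by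
  have hϖ : F.coeff 0 ∈ I := by
    rw [← Ideal.Quotient.eq_zero_iff_mem, ← map_coeff, hF, zero_coeff]
  obtain ⟨G, hG⟩ : ∃ G, G * p = F - teichmuller p (F.coeff 0) := by
    rw [← Ideal.mem_span_singleton', mem_span_p_iff_coeff_zero_eq_zero, ← constantCoeff_apply,
      map_sub, constantCoeff_apply, constantCoeff_apply, teichmuller_coeff_zero, sub_self]
  have hG0 := coeff_zero_pow_mem hF hϖ hG.symm
  have hu : IsUnit (1 - G) := by
    apply isUnit_of_isUnit_coeff_zero
    rw [← constantCoeff_apply, map_sub, map_one, constantCoeff_apply,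
      ← isUnit_pow_iff hpp.out.ne_zero, sub_pow_char, one_pow]
    exact hI _ hG0
  obtain ⟨u, hu⟩ := hu
  have hξ : (p : WittVector p P) - F =
      (u : WittVector p P) * (p - teichmuller p (F.coeff 0) * ((u⁻¹ : (WittVector p P)ˣ) : WittVector p P)) := by
    rw [mul_sub, mul_left_comm, Units.mul_inv, mul_one, hu]
    linear_combination hG
  refine ⟨u⁻¹, ?_⟩
  rw [hξ, Ideal.span_singleton_mul_left_unit u.isUnit]

/-- A regular local ring of mixed characteristic maps to a primitive quotient of the Witt vectors
of a perfect domain, with parameters going to Teichmüller representatives. -/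
theorem SyzTriv.exists_wittVector_hom {A : Type u} {ι : Type v} [CommRing A] [IsLocalRing A] [IsNoetherianRing A]
    [Fintype ι] {x : ι → A} (hx : SyzTriv ⊥ x) (hm : Ideal.span (Set.range x) = maximalIdeal A)
    (p : ℕ) [hpp : Fact p.Prime] (hp : (p : A) ∈ maximalIdeal A) (hp0 : (p : A) ≠ 0) :
    ∃ (P : Type (max u v)) (_ : CommRing P) (_ : IsDomain P) (_ : CharP P p) (_ : PerfectRing P p)
      (X : ι → P) (ϖ : P) (u : (WittVector p P)ˣ)
      (g : A →+* WittVector p P ⧸ Ideal.span {(p : WittVector p P) - teichmuller p ϖ * u}),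
      SyzTriv ⊥ X ∧ (1 : P) ∉ Ideal.span (Set.range X) ∧ ϖ ∈ Ideal.span (Set.range X) ∧ ϖ ≠ 0 ∧
      (∀ i, g (x i) = Ideal.Quotient.mk _ (teichmuller p (X i))) ∧ ∃ f : ι → WittVector p P,
        Ideal.span {(p : WittVector p P) - ∑ i, teichmuller p (X i) * f i} =
          Ideal.span {(p : WittVector p P) - teichmuller p ϖ * u} := by
  obtain ⟨E, _, i, q, hq, hker, hxE⟩ := SyzTriv.exists_residueField_algClosure hx hm
  have : CharP (ResidueField A) p := by
    refine (CharP.charP_iff_prime_eq_zero hpp.out).2 ?_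
    rw [← map_natCast (residue A), residue_eq_zero_iff]
    exact hp
  have : CharP (AlgebraicClosure (ResidueField A)) p :=
    charP_of_injective_ringHom (algebraMap (ResidueField A) _).injective p
  have : PerfectRing (AlgebraicClosure (ResidueField A)) p := PerfectField.toPerfectRing p
  obtain ⟨f, g0, hg0⟩ := SyzTriv.exists_ringHom_powerSeries_quotient (p := p) hxE hq hker
  obtain ⟨ψ, hψ⟩ := exists_powerSeries_wittVector_teichmuller (p := p) (ι := ι) (K := AlgebraicClosure (ResidueField A))
  have : CharP (MvPowerSeries ι (AlgebraicClosure (ResidueField A))) p :=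
    charP_of_injective_ringHom (MvPowerSeries.C_injective) p
  have : IsDomain (MvPowerSeries ι (AlgebraicClosure (ResidueField A))) :=
    NoZeroDivisors.to_isDomain _
  let ofW := WittVector.map (p := p) (PerfectClosure.of (MvPowerSeries ι (AlgebraicClosure (ResidueField A))) p)
  let X : ι → PerfectClosure (MvPowerSeries ι (AlgebraicClosure (ResidueField A))) p :=
    fun i => PerfectClosure.of _ p (MvPowerSeries.X i)
  have hX : SyzTriv ⊥ X := SyzTriv.mvPowerSeries_X.perfectClosure
  have h1X : (1 : PerfectClosure (MvPowerSeries ι (AlgebraicClosure (ResidueField A))) p) ∉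
    Ideal.span (Set.range X) :=
    PerfectClosure.one_notMem_span (MvPowerSeries.one_notMem_span_X)
  have hψX : ∀ i, ofW (ψ (MvPowerSeries.X i)) = teichmuller p (X i) := fun i => by
    rw [hψ, map_teichmuller]
  obtain ⟨F, hF⟩ : ∃ F, F = ∑ i, teichmuller p (X i) * ofW (ψ (f i)) := ⟨_, rfl⟩
  have hFmap : WittVector.map (Ideal.Quotient.mk (Ideal.span (Set.range X))) F = 0 := by
    rw [hF, map_sum]
    refine Finset.sum_eq_zero fun i _ => ?_
    rw [map_mul, map_teichmuller, Ideal.Quotient.eq_zero_iff_mem.2 (Ideal.subset_span (Set.mem_range_self i)),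
      teichmuller_zero, zero_mul]
  have hϖ : F.coeff 0 ∈ Ideal.span (Set.range X) := by
    rw [← Ideal.Quotient.eq_zero_iff_mem, ← map_coeff, hFmap, zero_coeff]
  obtain ⟨u, hspan⟩ := exists_unit_natCast_sub_eq hFmap
    fun a ha => PerfectClosure.isUnit_one_sub_powerSeries ha
  have hle : Ideal.span {(p : MvPowerSeries ι (WittVector p (AlgebraicClosure (ResidueField A)))) -
      ∑ i, MvPowerSeries.X i * f i} ≤ (Ideal.span {(p : WittVector p _) -
        teichmuller p (F.coeff 0) * (u : WittVector p _)}).comap (ofW.comp ψ) := by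
    rw [Ideal.span_singleton_le_iff_mem, Ideal.mem_comap, ← hspan, RingHom.comp_apply, map_sub,
      map_sub, map_natCast, map_natCast, map_sum, map_sum]
    simp only [map_mul, hψX]
    rw [← hF]
    exact Ideal.mem_span_singleton_self _
  let g : A →+* WittVector p (PerfectClosure (MvPowerSeries ι (AlgebraicClosure (ResidueField A))) p) ⧸
      Ideal.span {(p : WittVector p _) - teichmuller p (F.coeff 0) * (u : WittVector p _)} :=
    (Ideal.quotientMap _ (ofW.comp ψ) hle).comp (g0.comp i)
  have hg : ∀ j, g (x j) = Ideal.Quotient.mk _ (teichmuller p (X j)) := by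
    intro j
    change Ideal.quotientMap _ (ofW.comp ψ) hle (g0 (i (x j))) = _
    rw [hg0, Ideal.quotientMap_mk, RingHom.comp_apply, hψX]
  refine ⟨_, _, PerfectClosure.isDomain, inferInstance, inferInstance, X, F.coeff 0, u, g, hX, h1X, hϖ,
    fun h0 => hp0 ?_, hg,
    fun i => ofW (ψ (f i)), by rw [← hspan, hF]⟩
  refine SyzTriv.eq_zero_of_map_mem hx hm g ?_ ?_ fun t ht => ?_
  · simp only [hg]
    refine SyzTriv.quotient_iff.2 ?_
    rw [← hspan, hF, ← bot_sup_eq (Ideal.span _)]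
    exact hX.wittVector_append.of_unit_append_sub
  · simp only [hg]
    refine one_notMem_span_teichmuller h1X ?_
    rw [h0, teichmuller_zero, zero_mul, sub_zero]
    have : (p : WittVector p (PerfectClosure (MvPowerSeries ι (AlgebraicClosure (ResidueField A))) p)).coeff 0 = 0 :=
      (mem_span_p_iff_coeff_zero_eq_zero _).1 (Ideal.mem_span_singleton_self _)
    rw [this]
    exact zero_mem _
  · have : g (p : A) = 0 := by
      rw [map_natCast, ← map_natCast (Ideal.Quotient.mk _), Ideal.Quotient.eq_zero_iff_mem, h0,
        teichmuller_zero, zero_mul, sub_zero]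
      exact Ideal.mem_span_singleton_self _
    rw [this]
    exact zero_mem _

end WittPresentation

section Andre

open WittVector MvPolynomial

variable {p : ℕ} [hpp : Fact p.Prime] {P : Type u} [CommRing P] (F : Polynomial (WittVector p P))
  (a : WittVector p P)

/-- The generic expression `F([z₀]) + a y`, for `y` the Witt vector with coordinates
`z₁, z₂, …`. -/
noncomputable def genericWitt : WittVector p (MvPolynomial ℕ P) :=
  F.eval₂ (WittVector.map C) (teichmuller p (X 0)) +
    WittVector.map C a * WittVector.mk p fun n => X (n + 1)

/-- The coordinates of the equation `F([z₀]) + a y = p y`. -/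
noncomputable def genericRel : ℕ → MvPolynomial ℕ P
  | 0 => (genericWitt F a).coeff 0
  | n + 1 => X (n + 1) ^ p - (genericWitt F a).coeff (n + 1)

theorem map_genericWitt {B : Type*} [CommRing B] (h : MvPolynomial ℕ P →+* B) :
    WittVector.map h (genericWitt F a) =
      F.eval₂ (WittVector.map (h.comp C)) (teichmuller p (h (X 0))) +
        WittVector.map (h.comp C) a * WittVector.mk p fun n => h (X (n + 1)) := by
  have h1 : ∀ b : WittVector p P, WittVector.map h (WittVector.map C b) = WittVector.map (h.comp C) b := by
    intro b; ext n; simp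
  rw [genericWitt, map_add, map_mul, h1, Polynomial.hom_eval₂, map_teichmuller]
  congr 1

theorem genericRel_iff {B : Type*} [CommRing B] [CharP B p] (h : MvPolynomial ℕ P →+* B) :
    (∀ n, h (genericRel F a n) = 0) ↔
      F.eval₂ (WittVector.map (h.comp C)) (teichmuller p (h (X 0))) +
        WittVector.map (h.comp C) a * (WittVector.mk p fun n => h (X (n + 1))) =
        (WittVector.mk p fun n => h (X (n + 1))) * p := by
  rw [← map_genericWitt]
  constructor
  · intro hn
    ext n
    rw [map_coeff]
    cases n with
    | zero => rw [mul_charP_coeff_zero]; exact hn 0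
    | succ n =>
      rw [mul_charP_coeff_succ, coeff_mk]
      have := hn (n + 1)
      rw [genericRel, map_sub, map_pow, sub_eq_zero] at this
      exact this.symm
  · intro h1 n
    have h2 := congrArg (fun w => WittVector.coeff w n) h1
    simp only [map_coeff] at h2
    cases n with
    | zero => rw [genericRel, h2, mul_charP_coeff_zero]
    | succ n =>
      rw [genericRel, map_sub, map_pow, h2, mul_charP_coeff_succ, coeff_mk, sub_self]

theorem coeff_eval₂_teichmuller_mem_supported [Nontrivial P] (n : ℕ) :
    (F.eval₂ (WittVector.map C) (teichmuller p (X 0))).coeff n ∈ supported P {(0 : ℕ)} := by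
  have h1 : F.eval₂ (WittVector.map C) (teichmuller p (X 0)) =
      WittVector.map (supported P {(0 : ℕ)}).subtype
        (F.eval₂ (WittVector.map (algebraMap P (supported P {(0 : ℕ)})))
          (teichmuller p ⟨X 0, X_mem_supported.2 rfl⟩)) := by
    rw [Polynomial.hom_eval₂, map_teichmuller]
    congr 1
  rw [h1, map_coeff]
  exact Subtype.property _

theorem exists_isMonicIn_genericRel [Nontrivial P] {F : Polynomial (WittVector p P)} (hF : F.Monic) {I : Ideal P}
    (ha : WittVector.map (Ideal.Quotient.mk I) a = 0) :
    ∃ r : ℕ → MvPolynomial ℕ P, (∀ v, IsMonicIn v (r v)) ∧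
      ∀ v, r v - genericRel F a v ∈ I.map C := by
  have key : ∀ n, (F.eval₂ (WittVector.map C) (teichmuller p (X 0))).coeff n -
      (genericWitt F a).coeff n ∈ I.map C := by
    intro n
    rw [← Ideal.Quotient.eq_zero_iff_mem, map_sub, ← map_coeff, ← map_coeff, genericWitt, map_add,
      map_mul]
    have : WittVector.map (Ideal.Quotient.mk (I.map C)) (WittVector.map (C (σ := ℕ)) a) = 0 := by
      ext n
      rw [map_coeff, map_coeff, zero_coeff, Ideal.Quotient.eq_zero_iff_mem]
      apply Ideal.mem_map_of_mem
      rw [← Ideal.Quotient.eq_zero_iff_mem, ← map_coeff, ha, zero_coeff]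
    rw [this, zero_mul, add_zero, sub_self]
  refine ⟨fun v => match v with
    | 0 => (F.eval₂ (WittVector.map C) (teichmuller p (X 0))).coeff 0
    | n + 1 => X (n + 1) ^ p - (F.eval₂ (WittVector.map C) (teichmuller p (X 0))).coeff (n + 1),
    fun v => ?_, fun v => ?_⟩
  · match v with
    | 0 =>
      refine ⟨(F.map WittVector.constantCoeff).map (algebraMap P _), (hF.map _).map _, ?_⟩
      rw [← constantCoeff_apply, Polynomial.hom_eval₂, constantCoeff_apply, teichmuller_coeff_zero,
        Polynomial.aeval_map_algebraMap, Polynomial.aeval_def, Polynomial.eval₂_map]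
      rfl
    | n + 1 =>
      have hs : ({0} : Set ℕ) ⊆ Set.Iio (n + 1) := by
        rintro _ rfl; exact Nat.succ_pos n
      let b : supported P (Set.Iio (n + 1)) :=
        ⟨_, supported_mono hs (coeff_eval₂_teichmuller_mem_supported F (n + 1))⟩
      refine ⟨Polynomial.X ^ p - Polynomial.C b, Polynomial.monic_X_pow_sub_C _ hpp.out.ne_zero, ?_⟩
      rw [Polynomial.aeval_def, Polynomial.eval₂_sub, Polynomial.eval₂_pow, Polynomial.eval₂_X, Polynomial.eval₂_C]; rfl
  · match v with
    | 0 => exact key 0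
    | n + 1 =>
      have := neg_mem (key (n + 1))
      change X (n + 1) ^ p - _ - (X (n + 1) ^ p - _) ∈ _
      convert this using 1
      ring

end Andre

section Andre

open WittVector MvPolynomial

theorem SyzTriv.mem_of_mul_mem {S : Type*} [CommRing S] {J : Ideal S} {a s : S}
    (h : SyzTriv J fun _ : Unit => a) (hs : a * s ∈ J) : s ∈ J := by
  obtain ⟨c, -, hc0, hc⟩ := h (fun _ => s) (by simpa using hs)
  have := hc ()
  rwa [Fintype.sum_unique, hc0, zero_mul, sub_zero] at this

variable {p : ℕ} [hpp : Fact p.Prime] {P : Type u} [CommRing P] {F : Polynomial (WittVector p P)}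
  {a : WittVector p P}

theorem syzTriv_genericRel [Nontrivial P] (hF : F.Monic) {ι : Type*} [Fintype ι] {x : ι → P}
    (hx : SyzTriv ⊥ x) (ha : WittVector.map (Ideal.Quotient.mk (Ideal.span (Set.range x))) a = 0) :
    SyzTriv (Ideal.span (Set.range (genericRel F a)))
      (fun i => (C (x i) : MvPolynomial ℕ P)) := by
  obtain ⟨r, hr, hrr⟩ := exists_isMonicIn_genericRel a hF ha
  refine hx.map_C_of_isMonicIn hr fun v => ?_
  have := hrr v
  rwa [Ideal.map_span, ← Set.range_comp] at this

theorem exists_ringHom_genericRel_eq_zero (hF : F.Monic) (hF0 : F.natDegree ≠ 0) {L : Type*}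
    [Field L] [IsAlgClosed L] (κ : P →+* L) (ha : WittVector.map κ a = 0) :
    ∃ χ : MvPolynomial ℕ P →+* L, χ.comp C = κ ∧ ∀ n, χ (genericRel F a n) = 0 := by
  obtain ⟨t, ht⟩ : ∃ t, ((F.map WittVector.constantCoeff).map κ).eval t = 0 := by
    refine IsAlgClosed.exists_root _ ?_
    rw [Polynomial.degree_map_eq_of_leadingCoeff_ne_zero]
    · have : Nontrivial P := κ.domain_nontrivial
      rw [hF.degree_map, Polynomial.degree_eq_natDegree]
      · exact_mod_cast hF0
      · rintro rfl; simp at hF0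
    · rw [(hF.map _).leadingCoeff]; simp
  choose s hs using fun n => IsAlgClosed.exists_pow_nat_eq
    ((F.eval₂ (WittVector.map κ) (teichmuller p t)).coeff (n + 1)) hpp.out.pos
  let z : ℕ → L := fun n => match n with
    | 0 => t
    | n + 1 => s n
  have hC : (eval₂Hom κ z).comp C = κ := RingHom.ext fun b => by simp
  have hw : WittVector.map (eval₂Hom κ z) (genericWitt F a) =
      F.eval₂ (WittVector.map κ) (teichmuller p t) := by
    rw [map_genericWitt, hC, ha, zero_mul, add_zero, eval₂Hom_X']
  refine ⟨eval₂Hom κ z, hC, fun n => ?_⟩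
  cases n with
  | zero =>
    rw [genericRel, ← map_coeff, hw, ← WittVector.constantCoeff_apply, Polynomial.hom_eval₂,
      WittVector.constantCoeff_apply, teichmuller_coeff_zero, ← ht, Polynomial.map_map,
      Polynomial.eval_map]
    congr 1
  | succ n =>
    rw [genericRel, map_sub, map_pow, ← map_coeff, hw, eval₂Hom_X', sub_eq_zero]
    exact hs n

theorem map_genericWitt_eq_of_comp {B B' : Type*} [CommRing B] [CommRing B']
    (h : MvPolynomial ℕ P →+* B) (k : B →+* B') (hh : WittVector.map h (genericWitt F a) =
      (WittVector.mk p fun n => h (X (n + 1))) * p) :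
    WittVector.map (k.comp h) (genericWitt F a) =
      (WittVector.mk p fun n => k.comp h (X (n + 1))) * p := by
  have h2 := congrArg (WittVector.map k) hh
  rw [map_mul, map_natCast] at h2
  convert h2 using 1
  · ext n; simp only [map_coeff]; rfl
  · congr 1

theorem ringHom_ext_of_map_genericWitt {B : Type*} [CommRing B] {b b' : MvPolynomial ℕ P →+* B}
    (hC : b'.comp C = b.comp C) (h0 : b' (X 0) = b (X 0))
    (hb' : WittVector.map b' (genericWitt F a) = (WittVector.mk p fun n => b' (X (n + 1))) * p)
    (hb : WittVector.map b (genericWitt F a) = (WittVector.mk p fun n => b (X (n + 1))) * p)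
    (hu : IsUnit ((p : WittVector p B) - WittVector.map (b.comp C) a)) : b' = b := by
  rw [map_genericWitt] at hb hb'
  rw [hC, h0] at hb'
  have h : (WittVector.mk p fun n => b' (X (n + 1))) = WittVector.mk p fun n => b (X (n + 1)) := by
    rw [← hu.mul_right_inj]
    linear_combination hb - hb'
  refine MvPolynomial.ringHom_ext (fun r => RingHom.congr_fun hC r) fun i => ?_
  cases i with
  | zero => exact h0
  | succ n => simpa using congrArg (fun w => WittVector.coeff w n) h

theorem exists_ker_eq_span_genericRel [IsDomain P] [CharP P p] {ϖ : P} (hϖ : ϖ ≠ 0)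
    {u : (WittVector p P)ˣ} (ha : a = teichmuller p ϖ * u)
    (h1 : (1 : MvPolynomial ℕ P) ∉ Ideal.span (Set.range (genericRel F a)))
    (hn : ∀ g, C ϖ * g ∈ Ideal.span (Set.range (genericRel F a)) →
      g ∈ Ideal.span (Set.range (genericRel F a))) :
    ∃ ev : MvPolynomial ℕ P →+* Polynomial (Localization.Away ϖ),
      ev.comp C = Polynomial.C.comp (algebraMap P _) ∧
      RingHom.ker ev = Ideal.span (Set.range (genericRel F a)) := by
  have hle : Submonoid.powers ϖ ≤ nonZeroDivisors P :=
    powers_le_nonZeroDivisors_of_noZeroDivisors hϖ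
  have : IsDomain (Localization.Away ϖ) := IsLocalization.isDomain_localization hle
  obtain ⟨ι₀, hι₀⟩ : ∃ ι₀ : P →+* Polynomial (Localization.Away ϖ),
    ι₀ = Polynomial.C.comp (algebraMap P _) := ⟨_, rfl⟩
  have hinj : Function.Injective ι₀ := by
    rw [hι₀]
    exact Polynomial.C_injective.comp (IsLocalization.injective _ hle)
  have : CharP (Polynomial (Localization.Away ϖ)) p := charP_of_injective_ringHom hinj p
  obtain ⟨ξ, hξ⟩ : ∃ ξ, ξ = (p : WittVector p (Polynomial (Localization.Away ϖ))) -
    WittVector.map ι₀ a := ⟨_, rfl⟩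
  have hξu : IsUnit ξ := by
    apply WittVector.isUnit_of_isUnit_coeff_zero
    rw [hξ, ← WittVector.constantCoeff_apply, map_sub, map_natCast, CharP.cast_eq_zero, zero_sub,
      ha, map_mul, map_mul]
    refine IsUnit.neg (IsUnit.mul ?_ ((u.isUnit.map (WittVector.map ι₀)).map WittVector.constantCoeff))
    rw [map_teichmuller, WittVector.constantCoeff_apply, teichmuller_coeff_zero, hι₀]
    exact (IsLocalization.Away.algebraMap_isUnit (S := Localization.Away ϖ) ϖ).map Polynomial.C
  obtain ⟨η, hη⟩ := hξu.exists_right_inv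
  obtain ⟨y, hy⟩ : ∃ y, y = η * F.eval₂ (WittVector.map ι₀) (teichmuller p Polynomial.X) :=
    ⟨_, rfl⟩
  let z : ℕ → Polynomial (Localization.Away ϖ) := fun n => match n with
    | 0 => Polynomial.X
    | n + 1 => y.coeff n
  have hz : (WittVector.mk p fun n => eval₂Hom ι₀ z (X (n + 1))) = y := by
    ext n; rw [coeff_mk, eval₂Hom_X']
  have hC : (eval₂Hom ι₀ z).comp C = ι₀ := RingHom.ext fun b => by simp
  have hrel : WittVector.map (eval₂Hom ι₀ z) (genericWitt F a) =
      (WittVector.mk p fun n => eval₂Hom ι₀ z (X (n + 1))) * p := by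
    have : ξ * y = F.eval₂ (WittVector.map ι₀) (teichmuller p Polynomial.X) := by
      rw [hy, ← mul_assoc, hη, one_mul]
    rw [map_genericWitt, hC, hz, eval₂Hom_X', ← this, hξ]; ring
  have hI : ∀ n, eval₂Hom ι₀ z (genericRel F a n) = 0 := by
    rw [genericRel_iff, ← map_genericWitt]
    exact hrel
  refine ⟨eval₂Hom ι₀ z, hC.trans hι₀, le_antisymm ?_ ?_⟩
  swap
  · rw [Ideal.span_le]
    rintro _ ⟨n, rfl⟩
    exact hI n
  intro g hg
  rw [RingHom.mem_ker] at hg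
  obtain ⟨I, hIdef⟩ : ∃ I, I = Ideal.span (Set.range (genericRel F a)) := ⟨_, rfl⟩
  rw [← hIdef] at h1 hn ⊢
  have : Nontrivial (MvPolynomial ℕ P ⧸ I) :=
    Ideal.Quotient.nontrivial_iff.2 ((Ideal.ne_top_iff_one _).2 h1)
  have : CharP (MvPolynomial ℕ P ⧸ I) p := by
    rw [CharP.charP_iff_prime_eq_zero hpp.out, ← map_natCast (Ideal.Quotient.mk I),
      CharP.cast_eq_zero, map_zero]
  obtain ⟨B, _, b, hbu, hbr, hbk⟩ : ∃ (B : Type u) (_ : CommRing B) (b : MvPolynomial ℕ P →+* B),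
      IsUnit (b (C ϖ)) ∧ WittVector.map b (genericWitt F a) =
        (WittVector.mk p fun n => b (X (n + 1))) * p ∧
      ∀ g, b g = 0 → ∃ N : ℕ, C ϖ ^ N * g ∈ I := by
    have hq : ∀ n, Ideal.Quotient.mk I (genericRel F a n) = 0 := fun n => by
      rw [Ideal.Quotient.eq_zero_iff_mem, hIdef]
      exact Ideal.subset_span (Set.mem_range_self n)
    refine ⟨Localization.Away (Ideal.Quotient.mk I (C ϖ)), inferInstance,
      (algebraMap _ _).comp (Ideal.Quotient.mk I),
      IsLocalization.Away.algebraMap_isUnit (Ideal.Quotient.mk I (C ϖ)), ?_, fun g hg => ?_⟩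
    · rw [genericRel_iff, ← map_genericWitt] at hq
      exact map_genericWitt_eq_of_comp _ _ hq
    · rw [RingHom.comp_apply, IsLocalization.map_eq_zero_iff
        (Submonoid.powers (Ideal.Quotient.mk I (C ϖ)))] at hg
      obtain ⟨⟨_, N, rfl⟩, hN⟩ := hg
      refine ⟨N, ?_⟩
      rw [← Ideal.Quotient.eq_zero_iff_mem, map_mul, map_pow]
      exact hN
  have hbu' : IsUnit (b.comp C ϖ) := hbu
  obtain ⟨μ, hμC, hμX⟩ : ∃ μ : Polynomial (Localization.Away ϖ) →+* B,
      (∀ r, μ (ι₀ r) = b (C r)) ∧ μ Polynomial.X = b (X 0) := by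
    refine ⟨Polynomial.eval₂RingHom (IsLocalization.Away.lift ϖ hbu') (b (X 0)), fun r => ?_, ?_⟩
    · rw [hι₀, RingHom.comp_apply, Polynomial.coe_eval₂RingHom, Polynomial.eval₂_C,
        IsLocalization.Away.lift_eq]
      rfl
    · rw [Polynomial.coe_eval₂RingHom, Polynomial.eval₂_X]
  have hb : μ.comp (eval₂Hom ι₀ z) = b := by
    refine ringHom_ext_of_map_genericWitt ?_ ?_ (map_genericWitt_eq_of_comp _ _ hrel) hbr ?_
    · rw [RingHom.comp_assoc, hC]
      exact RingHom.ext hμC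
    · rw [RingHom.comp_apply, eval₂Hom_X']
      exact hμX
    · have := hξu.map (WittVector.map μ)
      rw [hξ, map_sub, map_natCast] at this
      convert this using 2
      ext n
      simp only [map_coeff]
      exact (hμC _).symm
  obtain ⟨N, hN⟩ := hbk g (by rw [← hb, RingHom.comp_apply, hg, map_zero])
  clear hg
  induction N with
  | zero => simpa using hN
  | succ N ih => exact ih (hn _ (by rw [← mul_assoc, ← pow_succ']; exact hN))

/-- A monic polynomial over `W(P)` acquires a root of Teichmüller form modulo `p - [ϖ] u` in a
faithful enough perfect extension of `P`. -/
theorem SyzTriv.exists_perfect_extension_root [IsDomain P] [CharP P p] {ι : Type*} [Fintype ι]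
    {x : ι → P} (hx : SyzTriv ⊥ x) (hx1 : (1 : P) ∉ Ideal.span (Set.range x)) {ϖ : P}
    (hϖ : ϖ ≠ 0) (hϖx : ϖ ∈ Ideal.span (Set.range x)) (u : (WittVector p P)ˣ)
    (hF : F.Monic) (hF0 : F.natDegree ≠ 0) :
    ∃ (P' : Type u) (_ : CommRing P') (_ : IsDomain P') (_ : CharP P' p) (_ : PerfectRing P' p)
      (j : P →+* P'), Function.Injective j ∧ SyzTriv ⊥ (fun i => j (x i)) ∧
      (1 : P') ∉ Ideal.span (Set.range fun i => j (x i)) ∧ ∃ (T : P') (y : WittVector p P'),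
      F.eval₂ (WittVector.map j) (teichmuller p T) =
        y * ((p : WittVector p P') - teichmuller p (j ϖ) * WittVector.map j u) := by
  obtain ⟨a, ha⟩ : ∃ a : WittVector p P, a = teichmuller p ϖ * u := ⟨_, rfl⟩
  have hmap : ∀ {B : Type u} [CommRing B] (f : P →+* B), f ϖ = 0 → WittVector.map f a = 0 := by
    intro B _ f hf
    rw [ha, map_mul, map_teichmuller, hf, teichmuller_zero, zero_mul]
  have hϖr : SyzTriv (⊥ : Ideal P) fun _ : Unit => ϖ := SyzTriv.unique fun s hs => by
    rw [Ideal.mem_bot] at hs ⊢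
    exact (mul_eq_zero.1 hs).resolve_left hϖ
  have hsx := syzTriv_genericRel hF hx (a := a) (hmap _ (Ideal.Quotient.eq_zero_iff_mem.2 hϖx))
  have hsϖ := syzTriv_genericRel hF hϖr (a := a)
    (hmap _ (Ideal.Quotient.eq_zero_iff_mem.2 (Ideal.subset_span ⟨(), rfl⟩)))
  obtain ⟨I, hI⟩ : ∃ I, I = Ideal.span (Set.range (genericRel F a)) := ⟨_, rfl⟩
  obtain ⟨𝔪, h𝔪, hle⟩ := Ideal.exists_le_maximal _ ((Ideal.ne_top_iff_one _).2 hx1)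
  let := Ideal.Quotient.field 𝔪
  obtain ⟨χ, hχC, hχ⟩ := exists_ringHom_genericRel_eq_zero hF hF0 (a := a)
    ((algebraMap (P ⧸ 𝔪) (AlgebraicClosure (P ⧸ 𝔪))).comp (Ideal.Quotient.mk 𝔪))
    (hmap _ (by rw [RingHom.comp_apply, Ideal.Quotient.eq_zero_iff_mem.2 (hle hϖx), map_zero]))
  have hIχ : ∀ g ∈ I, χ g = 0 := by
    suffices I ≤ RingHom.ker χ from fun g hg => this hg
    rw [hI, Ideal.span_le]
    rintro _ ⟨n, rfl⟩
    exact hχ n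
  have hI1 : (1 : MvPolynomial ℕ P) ∉ I := fun h => by simpa using hIχ _ h
  obtain ⟨ev, hevC, hev⟩ := exists_ker_eq_span_genericRel hϖ ha (hI ▸ hI1)
    fun g hg => hsϖ.mem_of_mul_mem hg
  have hle' : Submonoid.powers ϖ ≤ nonZeroDivisors P :=
    powers_le_nonZeroDivisors_of_noZeroDivisors hϖ
  have : IsDomain (Localization.Away ϖ) := IsLocalization.isDomain_localization hle'
  rw [← hI] at hev hsx
  have : I.IsPrime := hev ▸ RingHom.ker_isPrime ev
  have hinj : Function.Injective ((Ideal.Quotient.mk I).comp C) := by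
    rw [injective_iff_map_eq_zero]
    intro r hr
    rw [RingHom.comp_apply, Ideal.Quotient.eq_zero_iff_mem, ← hev, RingHom.mem_ker,
      ← RingHom.comp_apply, hevC] at hr
    exact (injective_iff_map_eq_zero (Polynomial.C.comp (algebraMap P (Localization.Away ϖ)))).1
      (Polynomial.C_injective.comp (IsLocalization.injective (Localization.Away ϖ) hle')) r hr
  have : CharP (MvPolynomial ℕ P ⧸ I) p := charP_of_injective_ringHom hinj p
  have hQx : SyzTriv ⊥ fun i => Ideal.Quotient.mk I (C (x i)) := SyzTriv.quotient_iff.2 hsx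
  have hQ1 : 1 ∉ Ideal.span (Set.range fun i => Ideal.Quotient.mk I (C (x i))) := by
    intro h
    have := Ideal.mem_map_of_mem (Ideal.Quotient.lift I χ hIχ) h
    rw [map_one, Ideal.map_span, ← Set.range_comp] at this
    have h0 : Ideal.span (Set.range (⇑(Ideal.Quotient.lift I χ hIχ) ∘
        fun i => Ideal.Quotient.mk I (C (x i)))) = ⊥ := by
      rw [Ideal.span_eq_bot]
      rintro _ ⟨i, rfl⟩
      simp only [Function.comp_apply, Ideal.Quotient.lift_mk]
      rw [← RingHom.comp_apply χ, hχC, RingHom.comp_apply,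
        Ideal.Quotient.eq_zero_iff_mem.2 (hle (Ideal.subset_span (Set.mem_range_self i))), map_zero]
    rw [h0] at this
    simpa using this
  have hq : ∀ n, Ideal.Quotient.mk I (genericRel F a n) = 0 := fun n => by
    rw [Ideal.Quotient.eq_zero_iff_mem, hI]
    exact Ideal.subset_span (Set.mem_range_self n)
  rw [genericRel_iff, ← map_genericWitt] at hq
  have hrel := map_genericWitt_eq_of_comp _ (PerfectClosure.of (MvPolynomial ℕ P ⧸ I) p) hq
  rw [map_genericWitt] at hrel
  have := PerfectClosure.isDomain (Q := MvPolynomial ℕ P ⧸ I) (p := p)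
  refine ⟨PerfectClosure (MvPolynomial ℕ P ⧸ I) p, inferInstance, inferInstance,
    inferInstance, inferInstance,
    (PerfectClosure.of (MvPolynomial ℕ P ⧸ I) p).comp ((Ideal.Quotient.mk I).comp C),
    PerfectClosure.of_injective.comp hinj, hQx.perfectClosure,
    PerfectClosure.one_notMem_span hQ1,
    ((PerfectClosure.of (MvPolynomial ℕ P ⧸ I) p).comp (Ideal.Quotient.mk I)) (X 0),
    WittVector.mk p fun n =>
      ((PerfectClosure.of (MvPolynomial ℕ P ⧸ I) p).comp (Ideal.Quotient.mk I)) (X (n + 1)), ?_⟩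
  rw [RingHom.comp_assoc] at hrel
  rw [eq_sub_of_add_eq hrel, ha, map_mul, map_teichmuller]
  ring

end Andre

section PRoot

variable (p : ℕ) [hpp : Fact p.Prime] {P Q : Type*} [CommRing P] [CharP P p] [PerfectRing P p]
  [CommRing Q] [CharP Q p] [PerfectRing Q p]

/-- The unique `p ^ k`-th root of an element of a perfect ring. -/
noncomputable def pRoot (k : ℕ) (x : P) : P := (iterateFrobeniusEquiv P p k).symm x

theorem pRoot_pow (k : ℕ) (x : P) : pRoot p k x ^ p ^ k = x := by
  rw [pRoot, ← iterateFrobeniusEquiv_def, RingEquiv.apply_symm_apply]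

theorem pRoot_eq {k : ℕ} {x y : P} (h : y ^ p ^ k = x) : pRoot p k x = y := by
  rw [pRoot, RingEquiv.symm_apply_eq, iterateFrobeniusEquiv_def, h]

theorem pRoot_mul (k : ℕ) (x y : P) : pRoot p k (x * y) = pRoot p k x * pRoot p k y :=
  map_mul _ _ _

theorem pRoot_pow_comm (k n : ℕ) (x : P) : pRoot p k (x ^ n) = pRoot p k x ^ n :=
  map_pow _ _ _

theorem map_pRoot (f : P →+* Q) (k : ℕ) (x : P) : f (pRoot p k x) = pRoot p k (f x) :=
  (pRoot_eq p (by rw [← map_pow, pRoot_pow])).symm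

theorem pRoot_add_pow (k r : ℕ) (x : P) : pRoot p (k + r) x ^ p ^ r = pRoot p k x := by
  refine (pRoot_eq p ?_).symm
  rw [← pow_mul, ← pow_add, add_comm r k, pRoot_pow]

theorem pRoot_pow_sub {k r : ℕ} (h : k ≤ r) (x : P) :
    pRoot p r x ^ p ^ (r - k) = pRoot p k x := by
  obtain ⟨s, rfl⟩ := Nat.exists_eq_add_of_le h
  rw [Nat.add_sub_cancel_left, pRoot_add_pow]

theorem pRoot_pRoot (k r : ℕ) (x : P) : pRoot p k (pRoot p r x) = pRoot p (r + k) x :=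
  pRoot_eq p (pRoot_add_pow p r k x)

theorem dvd_of_pow_dvd_pow (k : ℕ) {x y : P} (h : x ^ p ^ k ∣ y ^ p ^ k) : x ∣ y := by
  obtain ⟨z, hz⟩ := h
  refine ⟨pRoot p k z, ?_⟩
  rw [← pRoot_eq p (rfl : y ^ p ^ k = y ^ p ^ k), hz, pRoot_mul, pRoot_eq p rfl]

end PRoot

section Untilt

open WittVector

variable {p : ℕ} [hpp : Fact p.Prime] {P : Type*} [CommRing P] (ϖ : P) (u : (WittVector p P)ˣ)

/-- The untilt `W(P) / (p - [ϖ] u)`. -/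
abbrev Untilt : Type _ := WittVector p P ⧸ Ideal.span {(p : WittVector p P) - teichmuller p ϖ * u}

/-- The projection from Witt vectors to an untilt. -/
noncomputable abbrev Untilt.mk : WittVector p P →+* Untilt ϖ u := Ideal.Quotient.mk _

/-- The map `P → W(P) / ξ` induced by Teichmüller lifts. -/
noncomputable abbrev Untilt.sharp : P →* Untilt ϖ u :=
  (Untilt.mk ϖ u : WittVector p P →* Untilt ϖ u).comp (teichmuller p)

namespace Untilt

theorem natCast_eq : (p : Untilt ϖ u) = sharp ϖ u ϖ * mk ϖ u u := by
  have h : mk ϖ u ((p : WittVector p P) - teichmuller p ϖ * u) = 0 :=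
    Ideal.Quotient.eq_zero_iff_mem.2 (Ideal.mem_span_singleton_self _)
  rw [map_sub, map_natCast, map_mul, sub_eq_zero] at h
  exact h

theorem sharp_eq : sharp ϖ u ϖ = p * mk ϖ u ↑u⁻¹ := by
  rw [natCast_eq, mul_assoc, ← map_mul, Units.mul_inv, map_one, mul_one]

theorem sharp_pow_eq (n : ℕ) : sharp ϖ u ϖ ^ n = p ^ n * mk ϖ u ↑u⁻¹ ^ n := by
  rw [sharp_eq, mul_pow]

variable [CharP P p] [PerfectRing P p]

theorem exists_mk_eq_add {w w' : WittVector p P} (h : w.coeff 0 = w'.coeff 0) :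
    ∃ z, mk ϖ u w = mk ϖ u w' + p * mk ϖ u z := by
  have h1 : w - w' ∈ Ideal.span {(p : WittVector p P)} := by
    rw [mem_span_p_iff_coeff_zero_eq_zero, ← constantCoeff_apply, map_sub, constantCoeff_apply,
      constantCoeff_apply, h, sub_self]
  obtain ⟨z, hz⟩ := Ideal.mem_span_singleton.1 h1
  refine ⟨z, ?_⟩
  rw [eq_add_of_sub_eq' hz, map_add, map_mul, map_natCast]

theorem exists_mk_eq_sharp_add (w : WittVector p P) :
    ∃ z, mk ϖ u w = sharp ϖ u (w.coeff 0) + p * z := by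
  obtain ⟨z, hz⟩ := exists_mk_eq_add ϖ u (w := w) (w' := teichmuller p (w.coeff 0))
    (teichmuller_coeff_zero _ _).symm
  exact ⟨_, hz⟩

theorem p_dvd_mk_iff {w : WittVector p P} : (p : Untilt ϖ u) ∣ mk ϖ u w ↔ ϖ ∣ w.coeff 0 := by
  constructor
  · rintro ⟨a, ha⟩
    obtain ⟨a, rfl⟩ := Ideal.Quotient.mk_surjective a
    have h1 : mk ϖ u (w - p * a) = 0 := by
      rw [map_sub, map_mul, map_natCast, ha, sub_self]
    obtain ⟨b, hb⟩ := Ideal.mem_span_singleton.1 (Ideal.Quotient.eq_zero_iff_mem.1 h1)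
    have h2 := congrArg WittVector.constantCoeff hb
    simp only [map_sub, map_mul, map_natCast, CharP.cast_eq_zero, constantCoeff_apply,
      teichmuller_coeff_zero, zero_mul, sub_zero, zero_sub] at h2
    rw [h2]
    exact ⟨-((u : WittVector p P).coeff 0 * b.coeff 0), by ring⟩
  · rintro ⟨a, ha⟩
    obtain ⟨z, hz⟩ := exists_mk_eq_sharp_add ϖ u w
    rw [hz, ha, map_mul]
    refine dvd_add (Dvd.dvd.mul_right ?_ _) (dvd_mul_right _ _)
    exact ⟨_, sharp_eq ϖ u⟩

variable [IsDomain P] {ϖ} (hϖ : ϖ ≠ 0)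

include hϖ in
theorem eq_zero_of_p_mul {a : Untilt ϖ u} (h : p * a = 0) : a = 0 := by
  obtain ⟨a, rfl⟩ := Ideal.Quotient.mk_surjective a
  rw [← map_natCast (mk ϖ u), ← map_mul, Ideal.Quotient.eq_zero_iff_mem,
    Ideal.mem_span_singleton] at h
  obtain ⟨b, hb⟩ := h
  have hu : (u : WittVector p P).coeff 0 ≠ 0 := (u.isUnit.map WittVector.constantCoeff).ne_zero
  have h2 := congrArg WittVector.constantCoeff hb
  simp only [map_sub, map_mul, map_natCast, CharP.cast_eq_zero, constantCoeff_apply,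
    teichmuller_coeff_zero, zero_mul, zero_sub] at h2
  have h3 : b.coeff 0 = 0 :=
    (mul_eq_zero.1 h2.symm).resolve_left (neg_ne_zero.2 (mul_ne_zero hϖ hu))
  rw [← mem_span_p_iff_coeff_zero_eq_zero, Ideal.mem_span_singleton] at h3
  obtain ⟨c, rfl⟩ := h3
  rw [Ideal.Quotient.eq_zero_iff_mem, Ideal.mem_span_singleton]
  refine ⟨c, sub_eq_zero.1 (eq_zero_of_p_mul_eq_zero _ ?_)⟩
  linear_combination hb

include hϖ in
theorem eq_of_p_pow_mul {a b : Untilt ϖ u} (n : ℕ) (h : p ^ n * a = p ^ n * b) : a = b := by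
  induction n with
  | zero => simpa using h
  | succ n ih =>
    refine ih (sub_eq_zero.1 (eq_zero_of_p_mul u hϖ ?_))
    linear_combination h

include hϖ in
theorem eq_of_sharp_mul {a b : Untilt ϖ u} (n : ℕ)
    (h : sharp ϖ u ϖ ^ n * a = sharp ϖ u ϖ ^ n * b) : a = b := by
  refine eq_of_p_pow_mul u hϖ n ?_
  rw [natCast_eq, mul_pow]
  linear_combination mk ϖ u u ^ n * h

include hϖ in
/-- Root lowering in a perfectoid ring. -/
theorem exists_eq_sharp_pRoot_pow_mul (s M : ℕ) {y a : Untilt ϖ u}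
    (h : y ^ p ^ s = sharp ϖ u ϖ ^ M * a) : ∃ b, y = sharp ϖ u (pRoot p s ϖ) ^ M * b := by
  induction M generalizing y with
  | zero => exact ⟨y, by simp⟩
  | succ M ih =>
    have hps : p ^ s ≠ 0 := (pow_pos hpp.out.pos s).ne'
    have hs : sharp ϖ u (pRoot p s ϖ) ^ p ^ s = sharp ϖ u ϖ := by rw [← map_pow, pRoot_pow]
    obtain ⟨w, rfl⟩ := Ideal.Quotient.mk_surjective y
    have h1 : (p : Untilt ϖ u) ∣ mk ϖ u (w ^ p ^ s) := by
      rw [map_pow, h, pow_succ', mul_assoc, sharp_eq, mul_assoc]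
      exact dvd_mul_right _ _
    rw [p_dvd_mk_iff, ← constantCoeff_apply, map_pow, constantCoeff_apply] at h1
    have h2 : pRoot p s ϖ ∣ w.coeff 0 := dvd_of_pow_dvd_pow p s (by rwa [pRoot_pow])
    obtain ⟨b, hb⟩ := h2
    obtain ⟨z, hz⟩ := exists_mk_eq_sharp_add ϖ u w
    have h3 : mk ϖ u w = sharp ϖ u (pRoot p s ϖ) * (sharp ϖ u b +
        sharp ϖ u (pRoot p s ϖ) ^ (p ^ s - 1) * mk ϖ u u * z) := by
      have h4 : sharp ϖ u ϖ = sharp ϖ u (pRoot p s ϖ) ^ (p ^ s - 1) * sharp ϖ u (pRoot p s ϖ) := by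
        rw [← pow_succ, Nat.sub_add_cancel (Nat.pos_of_ne_zero hps), hs]
      rw [hz, hb, map_mul, natCast_eq, h4]
      ring
    obtain ⟨b', hb'⟩ := ih (y := sharp ϖ u b +
        sharp ϖ u (pRoot p s ϖ) ^ (p ^ s - 1) * mk ϖ u u * z) (by
      refine eq_of_sharp_mul u hϖ 1 ?_
      rw [pow_one]
      change mk ϖ u w ^ p ^ s = _ at h
      rw [h3, mul_pow, hs] at h
      rw [h]; ring)
    refine ⟨b', ?_⟩
    change mk ϖ u w = _
    rw [h3, hb']; ring

end Untilt

end Untilt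

section Hebbarkeit

open WittVector Untilt

variable {p : ℕ} [hpp : Fact p.Prime] {P Q : Type*} [CommRing P] [CommRing Q]

/-- Functoriality of untilts. -/
noncomputable def Untilt.map (f : P →+* Q) {ϖ : P} {u : (WittVector p P)ˣ} {ϖ' : Q}
    {u' : (WittVector p Q)ˣ} (hϖ : f ϖ = ϖ') (hu : WittVector.map f (u : WittVector p P) = (u' : WittVector p Q)) :
    Untilt ϖ u →+* Untilt ϖ' u' :=
  Ideal.Quotient.lift _ ((Untilt.mk ϖ' u').comp (WittVector.map f)) fun a ha => by
    obtain ⟨b, rfl⟩ := Ideal.mem_span_singleton.1 ha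
    rw [RingHom.comp_apply, Ideal.Quotient.eq_zero_iff_mem, map_mul, map_sub, map_natCast, map_mul,
      map_teichmuller, hϖ, hu]
    exact Ideal.mul_mem_right _ _ (Ideal.mem_span_singleton_self _)

theorem Untilt.map_sharp (f : P →+* Q) {ϖ : P} {u : (WittVector p P)ˣ} {ϖ' : Q}
    {u' : (WittVector p Q)ˣ} (hϖ : f ϖ = ϖ') (hu : WittVector.map f (u : WittVector p P) = (u' : WittVector p Q)) (x : P) :
    Untilt.map f hϖ hu (sharp ϖ u x) = sharp ϖ' u' (f x) := by
  change Untilt.mk ϖ' u' (WittVector.map f (teichmuller p x)) = _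
  rw [map_teichmuller]; rfl

variable [CharP P p] [PerfectRing P p] [CharP Q p] [PerfectRing Q p] [IsDomain Q]

theorem Untilt.eq_of_sharp_pRoot_mul {ϖ : Q} {u : (WittVector p Q)ˣ} (hϖ : ϖ ≠ 0) (s N : ℕ)
    {a b : Untilt ϖ u}
    (h : sharp ϖ u (pRoot p s ϖ) ^ N * a = sharp ϖ u (pRoot p s ϖ) ^ N * b) : a = b := by
  refine eq_of_sharp_mul u hϖ N ?_
  have h1 : sharp ϖ u ϖ ^ N = sharp ϖ u (pRoot p s ϖ) ^ (p ^ s * N - N) *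
      sharp ϖ u (pRoot p s ϖ) ^ N := by
    rw [← pow_add, Nat.sub_add_cancel (Nat.le_mul_of_pos_left _ (pow_pos hpp.out.pos s)), pow_mul,
      ← map_pow _ _ (p ^ s), pRoot_pow]
  rw [h1]
  linear_combination sharp ϖ u (pRoot p s ϖ) ^ (p ^ s * N - N) * h

theorem Untilt.exists_sharp_mul_eq (f : P →+* Q) {ϖ : P} {u : (WittVector p P)ˣ} {ϖ' : Q}
    {u' : (WittVector p Q)ˣ} (hϖ : f ϖ = ϖ') (hu : WittVector.map f (u : WittVector p P) = (u' : WittVector p Q)) (hϖ' : ϖ' ≠ 0)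
    {C : P} {H : Untilt ϖ u} (hH : ∀ j, ∃ g, H ^ (j + 1) = sharp ϖ u C ^ j * g) {V : Q} {n : ℕ}
    (hV : V * f C = ϖ' ^ n) (s : ℕ) : ∃ y : Untilt ϖ' u', sharp ϖ' u' (f C) * y =
      sharp ϖ' u' (pRoot p s ϖ') ^ n * Untilt.map f hϖ hu H := by
  obtain ⟨q, hq⟩ : ∃ q, p ^ s = q + 1 := Nat.exists_eq_succ_of_ne_zero (pow_pos hpp.out.pos s).ne'
  obtain ⟨g, hg⟩ := hH q
  have hg' := congrArg (Untilt.map f hϖ hu) hg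
  rw [map_mul, map_pow, map_pow, Untilt.map_sharp] at hg'
  have hV' := congrArg (sharp ϖ' u') hV
  rw [map_mul, map_pow] at hV'
  obtain ⟨y, hy⟩ := exists_eq_sharp_pRoot_pow_mul u' hϖ' s (n * q)
    (y := sharp ϖ' u' V * Untilt.map f hϖ hu H)
    (a := sharp ϖ' u' V * Untilt.map f hϖ hu g) (by
      rw [pow_mul, ← hV', hq, mul_pow, hg']; ring)
  refine ⟨y, eq_of_sharp_pRoot_mul hϖ' s (n * q) ?_⟩
  have h1 : sharp ϖ' u' ϖ' ^ n = sharp ϖ' u' (pRoot p s ϖ') ^ (n * q) *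
      sharp ϖ' u' (pRoot p s ϖ') ^ n := by
    rw [← pow_add, ← Nat.mul_succ, Nat.succ_eq_add_one, ← hq, mul_comm n, pow_mul,
      ← map_pow _ _ (p ^ s), pRoot_pow]
  rw [h1] at hV'
  linear_combination Untilt.map f hϖ hu H * hV' - sharp ϖ' u' (f C) * hy

variable [IsDomain P]

theorem exists_mul_eq_of_adjoin (i : P →+* Q) (hi : Function.Injective i) {ϖ C : P} (hϖ : ϖ ≠ 0)
    {V : Q} {a : ℕ} (hV : V * i C = i ϖ ^ p ^ a)
    (hgen : ∀ x k, ∃ r, k ≤ r ∧ ∃ G : Polynomial P, x = G.eval₂ i (pRoot p r V)) {g : P}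
    (hg : i ϖ ∣ i g) : ϖ ∣ pRoot p a C ^ 2 * g := by
  obtain ⟨x, hx⟩ := hg
  obtain ⟨r, har, G, rfl⟩ := hgen x a
  let := i.toAlgebra
  have hVa : pRoot p a V * i (pRoot p a C) = i ϖ := by
    rw [map_pRoot, ← pRoot_mul, hV, pRoot_eq p rfl]
  obtain ⟨x, hxG⟩ : ∃ x, x = G.eval₂ i (pRoot p r V) := ⟨_, rfl⟩
  obtain ⟨v, hv⟩ : ∃ v, v = i (pRoot p a C) * x := ⟨_, rfl⟩
  rw [← hxG] at hx
  have hvV : v * pRoot p r V ^ p ^ (r - a) = i g := by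
    rw [pRoot_pow_sub p har, hv, hx, ← hVa]; ring
  obtain ⟨D, hD⟩ : ∃ D, D = G.natDegree + 1 + p ^ (r - a) := ⟨_, rfl⟩
  obtain ⟨M, hM⟩ : ∃ M : Submodule P Q, M =
      Submodule.span P ((fun l : ℕ => pRoot p r V ^ l) '' Set.Iio D) := ⟨_, rfl⟩
  have hmem : ∀ l < D, pRoot p r V ^ l ∈ M := fun l hl => by
    rw [hM]; exact Submodule.subset_span ⟨l, hl, rfl⟩
  have hsm : ∀ b : P, ∀ y ∈ M, i b * y ∈ M := fun b y hy => M.smul_mem b hy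
  have hstab : ∀ y ∈ M, v * y ∈ M := by
    intro y hy
    rw [hM] at hy
    induction hy using Submodule.span_induction with
    | zero => rw [mul_zero]; exact zero_mem _
    | add y z _ _ hy hz => rw [mul_add]; exact add_mem hy hz
    | smul b y _ hy =>
      rw [Algebra.smul_def, mul_left_comm]
      exact hsm _ _ hy
    | mem y hy =>
      obtain ⟨l, hl, rfl⟩ := hy
      beta_reduce
      by_cases hlr : p ^ (r - a) ≤ l
      · obtain ⟨l', rfl⟩ := Nat.exists_eq_add_of_le hlr
        rw [pow_add, ← mul_assoc, hvV]
        refine hsm _ _ (hmem _ ?_)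
        have : p ^ (r - a) + l' < D := hl
        omega
      · rw [hv, mul_assoc, hxG, Polynomial.eval₂_eq_sum_range, Finset.sum_mul]
        refine hsm _ _ (sum_mem fun e he => ?_)
        rw [mul_assoc, ← pow_add]
        refine hsm _ _ (hmem _ ?_)
        have := Finset.mem_range.1 he
        omega
  have hpow : ∀ s : ℕ, v ^ s ∈ M := by
    intro s
    induction s with
    | zero => simpa using hmem 0 (by omega)
    | succ s ih => rw [pow_succ']; exact hstab _ ih
  have hVr : pRoot p r V * i (pRoot p r C) = i (pRoot p r ϖ ^ p ^ a) := by
    rw [map_pRoot, ← pRoot_mul, hV, map_pow, map_pRoot, pRoot_pow_comm]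
  have hden : ∀ y ∈ M, ∃ b, i (pRoot p r C) ^ D * y = i b := by
    intro y hy
    rw [hM] at hy
    induction hy using Submodule.span_induction with
    | zero => exact ⟨0, by simp⟩
    | add y z _ _ hy hz =>
      obtain ⟨b, hb⟩ := hy
      obtain ⟨c, hc⟩ := hz
      exact ⟨b + c, by rw [mul_add, hb, hc, map_add]⟩
    | smul c y _ hy =>
      obtain ⟨b, hb⟩ := hy
      refine ⟨c * b, ?_⟩
      rw [Algebra.smul_def, mul_left_comm, hb, map_mul]; rfl
    | mem y hy =>
      obtain ⟨l, hl, rfl⟩ := hy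
      obtain ⟨l', hl'⟩ := Nat.exists_eq_add_of_le (le_of_lt (show l < D from hl))
      refine ⟨pRoot p r C ^ l' * (pRoot p r ϖ ^ p ^ a) ^ l, ?_⟩
      rw [map_mul, map_pow _ _ l, ← hVr, hl', map_pow]; ring
  obtain ⟨b, hb⟩ := hden _ (hpow (p ^ D))
  have hb' : i (pRoot p (r + D) C) ^ D * v = i (pRoot p D b) := by
    rw [map_pRoot p i D b, ← hb, pRoot_mul, pRoot_eq p rfl, pRoot_pow_comm, ← map_pRoot, pRoot_pRoot]
  have hdvd : pRoot p (r + D) C ^ D ∣ pRoot p a C := by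
    rw [← pRoot_pow_sub p (show a ≤ r + D by omega)]
    refine pow_dvd_pow _ ((Nat.lt_pow_self hpp.out.one_lt).le.trans
      (Nat.pow_le_pow_right hpp.out.pos (by omega)))
  obtain ⟨d, hd⟩ := hdvd
  refine ⟨d * pRoot p D b, hi ?_⟩
  rw [map_mul, map_mul, map_mul, ← hb', hx, map_pow]
  have hd' := congrArg i hd
  rw [map_mul, map_pow] at hd'
  rw [hv]
  linear_combination (i (pRoot p a C) * i ϖ * x) * hd'

theorem Untilt.exists_sharp_pow_mul_eq (i : P →+* Q) (hi : Function.Injective i) {ϖ C : P}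
    (hϖ : ϖ ≠ 0) {u : (WittVector p P)ˣ} {ϖ' : Q} {u' : (WittVector p Q)ˣ} (hϖ' : i ϖ = ϖ')
    (hu : WittVector.map i (u : WittVector p P) = (u' : WittVector p Q)) {V : Q} {a : ℕ} (hV : V * i C = ϖ' ^ p ^ a)
    (hgen : ∀ x k, ∃ r, k ≤ r ∧ ∃ G : Polynomial P, x = G.eval₂ i (pRoot p r V)) (m : ℕ)
    {g : Untilt ϖ u} {b : Untilt ϖ' u'} (hg : Untilt.map i hϖ' hu g = p ^ m * b) :
    ∃ g', sharp ϖ u (pRoot p a C) ^ (2 * m) * g = p ^ m * g' := by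
  have hϖ0 : ϖ' ≠ 0 := by
    rw [← hϖ']; exact (map_ne_zero_iff i hi).2 hϖ
  induction m generalizing g b with
  | zero => exact ⟨g, by simp⟩
  | succ m ih =>
    obtain ⟨w, rfl⟩ := Ideal.Quotient.mk_surjective g
    have h1 : ϖ' ∣ (WittVector.map i w).coeff 0 := by
      rw [← p_dvd_mk_iff ϖ' u']
      refine ⟨p ^ m * b, ?_⟩
      rw [← mul_assoc, ← pow_succ', ← hg]; rfl
    rw [map_coeff, ← hϖ'] at h1
    have h2 := exists_mul_eq_of_adjoin i hi hϖ (by rw [hV, hϖ']) hgen h1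
    have h3 : (p : Untilt ϖ u) ∣ mk ϖ u (teichmuller p (pRoot p a C) ^ 2 * w) := by
      rw [p_dvd_mk_iff, ← constantCoeff_apply, map_mul, map_pow, constantCoeff_apply,
        constantCoeff_apply, teichmuller_coeff_zero]
      exact h2
    obtain ⟨g1, hg1⟩ := h3
    have h4 : sharp ϖ u (pRoot p a C) ^ 2 * mk ϖ u w = p * g1 := by
      rw [← hg1, map_mul, map_pow]; rfl
    have h5 : Untilt.map i hϖ' hu g1 = p ^ m * (sharp ϖ' u' (i (pRoot p a C)) ^ 2 * b) := by
      refine eq_of_p_pow_mul u' hϖ0 1 ?_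
      have := congrArg (Untilt.map i hϖ' hu) h4
      rw [map_mul, map_mul, map_pow, Untilt.map_sharp, map_natCast] at this
      rw [pow_one, ← this]
      change sharp ϖ' u' _ ^ 2 * Untilt.map i hϖ' hu (Ideal.Quotient.mk _ w) = _
      rw [hg]; ring
    obtain ⟨g', hg'⟩ := ih h5
    refine ⟨g', ?_⟩
    change _ * mk ϖ u w = _
    rw [mul_add, mul_one, pow_add, mul_assoc, h4]
    linear_combination (p : Untilt ϖ u) * hg'

theorem Untilt.exists_map_add (f : P →+* Q) (hf : Function.Injective f) {Q' : Type*} [CommRing Q']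
    [CharP Q' p] [PerfectRing Q' p] (f' : P →+* Q') (j : Q' →+* Q) (hj : j.comp f' = f) {ϖ C : P}
    (hC : C ≠ 0) {u : (WittVector p P)ˣ} {ϖ₁ : Q} {u₁ : (WittVector p Q)ˣ} {ϖ₂ : Q'}
    {u₂ : (WittVector p Q')ˣ} (hϖ₁ : f ϖ = ϖ₁) (hu₁ : WittVector.map f (u : WittVector p P) = (u₁ : WittVector p Q))
    (hϖ₂ : j ϖ₂ = ϖ₁) (hu₂ : WittVector.map j (u₂ : WittVector p Q') = (u₁ : WittVector p Q)) {V : Q} {V' : Q'} {n m k : ℕ}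
    (hV : V * f C = f ϖ ^ n) (hV' : V' * f' C = f' ϖ ^ (n + m * p ^ k))
    (hgen : ∀ x k, ∃ r, k ≤ r ∧ ∃ G : Polynomial P, x = G.eval₂ f' (pRoot p r V'))
    (y : Untilt ϖ₂ u₂) : ∃ w v, sharp ϖ₁ u₁ (f (pRoot p k C)) * Untilt.map j hϖ₂ hu₂ y =
      Untilt.map f hϖ₁ hu₁ w + p ^ m * v := by
  have hjf : ∀ x, j (f' x) = f x := fun x => RingHom.congr_fun hj x
  obtain ⟨S, hS⟩ : ∃ S : AddSubgroup (Untilt ϖ₁ u₁), ∀ x, x ∈ S ↔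
      ∃ w v, x = Untilt.map f hϖ₁ hu₁ w + p ^ m * v := by
    refine ⟨(Untilt.map f hϖ₁ hu₁).range.toAddSubgroup ⊔
      (Ideal.span {(p : Untilt ϖ₁ u₁) ^ m}).toAddSubgroup, fun x => ?_⟩
    rw [AddSubgroup.mem_sup]
    constructor
    · rintro ⟨_, ⟨w, rfl⟩, z, hz, rfl⟩
      obtain ⟨v, rfl⟩ := Ideal.mem_span_singleton.1 hz
      exact ⟨w, v, rfl⟩
    · rintro ⟨w, v, rfl⟩
      exact ⟨_, ⟨w, rfl⟩, _, Ideal.mem_span_singleton.2 ⟨v, rfl⟩, rfl⟩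
  rw [← hS]
  have hSp : ∀ x ∈ S, ∀ e : ℕ, (p : Untilt ϖ₁ u₁) ^ e * x ∈ S := by
    intro x hx e
    rw [← Nat.cast_pow, ← nsmul_eq_mul]
    exact nsmul_mem hx _
  obtain ⟨T, hT⟩ : ∃ T : AddSubgroup (Untilt ϖ₂ u₂), ∀ y, y ∈ T ↔
      sharp ϖ₁ u₁ (f (pRoot p k C)) * Untilt.map j hϖ₂ hu₂ y ∈ S :=
    ⟨S.comap ((AddMonoidHom.mulLeft (sharp ϖ₁ u₁ (f (pRoot p k C)))).comp
      (Untilt.map j hϖ₂ hu₂).toAddMonoidHom), fun y => Iff.rfl⟩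
  rw [← hT]
  have hTp : ∀ x ∈ T, ∀ e : ℕ, (p : Untilt ϖ₂ u₂) ^ e * x ∈ T := by
    intro x hx e
    rw [← Nat.cast_pow, ← nsmul_eq_mul]
    exact nsmul_mem hx _
  have hTm : ∀ y, (p : Untilt ϖ₂ u₂) ^ m * y ∈ T := by
    intro y
    rw [hT, hS]
    refine ⟨0, sharp ϖ₁ u₁ (f (pRoot p k C)) * Untilt.map j hϖ₂ hu₂ y, ?_⟩
    rw [map_mul, map_pow, map_natCast, map_zero]; ring
  have hVV : j V' = f ϖ ^ (m * p ^ k) * V := by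
    have hfC : f C ≠ 0 := (map_ne_zero_iff f hf).2 hC
    refine mul_right_cancel₀ hfC ?_
    have := congrArg j hV'
    rw [map_mul, map_pow, hjf, hjf] at this
    rw [this, mul_assoc, hV]; ring
  have hmon : ∀ (r : ℕ) (hr : k ≤ r) (b : P) (l : ℕ),
      sharp ϖ₂ u₂ (f' b * pRoot p r V' ^ l) ∈ T := by
    intro r hr b l
    rw [hT, Untilt.map_sharp, ← map_mul, hS]
    by_cases hl : l ≤ p ^ (r - k)
    · obtain ⟨l', hl'⟩ := Nat.exists_eq_add_of_le hl
      have h1 : f (pRoot p r C) * j (pRoot p r V') = f (pRoot p r ϖ ^ (n + m * p ^ k)) := by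
        rw [← hjf, mul_comm, ← map_mul, map_pRoot, ← pRoot_mul, hV', ← hjf, map_pow f',
          map_pRoot p f', pRoot_pow_comm]
      refine ⟨sharp ϖ u (b * pRoot p r C ^ l' * (pRoot p r ϖ ^ (n + m * p ^ k)) ^ l), 0, ?_⟩
      rw [Untilt.map_sharp, mul_zero, add_zero]
      congr 1
      rw [map_mul, map_mul, map_mul, map_pow f _ l, ← h1, ← pRoot_pow_sub p hr, hl', map_pow,
        map_pow, map_pow, hjf]
      ring
    · obtain ⟨l', rfl⟩ := Nat.exists_eq_add_of_le (le_of_not_ge hl)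
      refine ⟨0, ?_⟩
      suffices (p : Untilt ϖ₁ u₁) ^ m ∣ sharp ϖ₁ u₁ (f (pRoot p k C) *
          j (f' b * pRoot p r V' ^ (p ^ (r - k) + l'))) by
        obtain ⟨v, hv⟩ := this
        exact ⟨v, by rw [hv, map_zero, zero_add]⟩
      have h1 : (p : Untilt ϖ₁ u₁) ^ m ∣ sharp ϖ₁ u₁ (ϖ₁ ^ m) := by
        rw [map_pow, sharp_pow_eq]; exact dvd_mul_right _ _
      refine h1.trans (map_dvd _ ?_)
      rw [map_mul, map_pow, pow_add]
      refine Dvd.dvd.mul_left (Dvd.dvd.mul_left (Dvd.dvd.mul_right ?_ _) _) _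
      rw [map_pRoot, hVV, pRoot_mul, mul_pow, pRoot_pow_comm, ← map_pRoot, ← map_pow, ← map_pow,
        ← pow_mul, mul_assoc, ← pow_add, Nat.add_sub_cancel' hr, mul_comm, mul_comm m, pow_mul,
        pRoot_pow, map_pow, hϖ₁]
      exact dvd_mul_left _ _
  have hgen' : ∀ q : Q', ∃ τ ∈ T, ∃ z, sharp ϖ₂ u₂ q = τ + p * z := by
    intro q
    obtain ⟨r, hr, G, rfl⟩ := hgen q k
    induction G using Polynomial.induction_on' with
    | monomial l b =>
      rw [Polynomial.eval₂_monomial]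
      exact ⟨_, hmon r hr b l, 0, by rw [mul_zero, add_zero]⟩
    | add G G' hG hG' =>
      obtain ⟨τ, hτ, z, hz⟩ := hG
      obtain ⟨τ', hτ', z', hz'⟩ := hG'
      rw [Polynomial.eval₂_add]
      obtain ⟨z'', hz''⟩ := exists_mk_eq_sharp_add ϖ₂ u₂
        (teichmuller p (G.eval₂ f' (pRoot p r V')) + teichmuller p (G'.eval₂ f' (pRoot p r V')))
      rw [← constantCoeff_apply, map_add, map_add, constantCoeff_apply, constantCoeff_apply,
        teichmuller_coeff_zero, teichmuller_coeff_zero] at hz''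
      refine ⟨τ + τ', add_mem hτ hτ', z + z' - z'', ?_⟩
      change sharp ϖ₂ u₂ _ + sharp ϖ₂ u₂ _ = _ at hz''
      linear_combination hz + hz' - hz''
  have key : ∀ e t, e + t = m → ∀ y, (p : Untilt ϖ₂ u₂) ^ t * y ∈ T := by
    intro e
    induction e with
    | zero =>
      intro t ht y
      rw [zero_add] at ht
      rw [ht]; exact hTm y
    | succ e ih =>
      intro t ht y
      obtain ⟨w, rfl⟩ := Ideal.Quotient.mk_surjective y
      obtain ⟨z, hz⟩ := exists_mk_eq_sharp_add ϖ₂ u₂ w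
      obtain ⟨τ, hτ, z', hz'⟩ := hgen' (w.coeff 0)
      change _ * mk ϖ₂ u₂ w ∈ T
      have : (p : Untilt ϖ₂ u₂) ^ t * mk ϖ₂ u₂ w = p ^ t * τ + p ^ (t + 1) * (z + z') := by
        rw [hz, hz']; ring
      rw [this]
      exact add_mem (hTp _ hτ _) (ih _ (by omega) _)
  simpa using key m 0 (by omega) y

end Hebbarkeit

section AdjoinRoots

variable (p : ℕ) [hpp : Fact p.Prime] {P L : Type*} [CommRing P] [CharP P p] [PerfectRing P p]
  [CommRing L] [CharP L p] [PerfectRing L p]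

/-- The subring obtained by adjoining all `p`-power roots of an element. -/
noncomputable def adjoinRoots (i : P →+* L) (V : L) : Subring L where
  carrier := {x | ∃ r₀, ∀ r, r₀ ≤ r → ∃ G : Polynomial P, x = G.eval₂ i (pRoot p r V)}
  mul_mem' := by
    rintro x y ⟨r, hx⟩ ⟨s, hy⟩
    refine ⟨max r s, fun t ht => ?_⟩
    obtain ⟨G, rfl⟩ := hx t (le_of_max_le_left ht)
    obtain ⟨H, rfl⟩ := hy t (le_of_max_le_right ht)
    exact ⟨G * H, (Polynomial.eval₂_mul _ _).symm⟩
  one_mem' := ⟨0, fun _ _ => ⟨1, (Polynomial.eval₂_one _ _).symm⟩⟩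
  add_mem' := by
    rintro x y ⟨r, hx⟩ ⟨s, hy⟩
    refine ⟨max r s, fun t ht => ?_⟩
    obtain ⟨G, rfl⟩ := hx t (le_of_max_le_left ht)
    obtain ⟨H, rfl⟩ := hy t (le_of_max_le_right ht)
    exact ⟨G + H, (Polynomial.eval₂_add _ _).symm⟩
  zero_mem' := ⟨0, fun _ _ => ⟨0, (Polynomial.eval₂_zero _ _).symm⟩⟩
  neg_mem' := by
    rintro x ⟨r, hx⟩
    refine ⟨r, fun t ht => ?_⟩
    obtain ⟨G, rfl⟩ := hx t ht
    exact ⟨-G, (Polynomial.eval₂_neg _).symm⟩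

namespace adjoinRoots

variable {p} {i : P →+* L} {V : L}

theorem map_mem (b : P) : i b ∈ adjoinRoots p i V :=
  ⟨0, fun r _ => ⟨Polynomial.C b, (Polynomial.eval₂_C i _).symm⟩⟩

theorem pRoot_self_mem (k : ℕ) : pRoot p k V ∈ adjoinRoots p i V :=
  ⟨k, fun r hr => ⟨Polynomial.X ^ p ^ (r - k), by
    rw [Polynomial.eval₂_pow, Polynomial.eval₂_X, pRoot_pow_sub p hr]⟩⟩

theorem self_mem : V ∈ adjoinRoots p i V := by
  have h := pow_mem (pRoot_self_mem (p := p) (i := i) (V := V) 0) (p ^ 0)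
  rwa [pRoot_pow] at h

theorem pRoot_mem {x : L} (hx : x ∈ adjoinRoots p i V) : pRoot p 1 x ∈ adjoinRoots p i V := by
  obtain ⟨r₀, hx⟩ := hx
  refine ⟨r₀ + 1, fun r hr => ?_⟩
  obtain ⟨s, rfl⟩ := Nat.exists_eq_add_of_le' (show 1 ≤ r by omega)
  obtain ⟨G, rfl⟩ := hx s (by omega)
  refine ⟨G.map ((iterateFrobeniusEquiv P p 1).symm : P →+* P), ?_⟩
  rw [Polynomial.eval₂_map]
  change ((iterateFrobeniusEquiv L p 1).symm : L →+* L) _ = _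
  rw [Polynomial.hom_eval₂]
  have h1 : ((iterateFrobeniusEquiv L p 1).symm : L →+* L) (pRoot p s V) = pRoot p (s + 1) V :=
    pRoot_pRoot p 1 s V
  rw [h1]
  congr 1
  exact RingHom.ext fun b => (map_pRoot p i 1 b).symm

instance : CharP (adjoinRoots p i V) p :=
  (adjoinRoots p i V).subtype.charP Subtype.val_injective p

instance [IsDomain L] : PerfectRing (adjoinRoots p i V) p :=
  PerfectRing.ofSurjective _ _ fun x => ⟨⟨pRoot p 1 x, pRoot_mem x.2⟩, Subtype.ext (by
    have := pRoot_pow p 1 (x : L)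
    rw [pow_one] at this
    exact this)⟩

/-- The structure map of `adjoinRoots`. -/
noncomputable def of (i : P →+* L) (V : L) : P →+* adjoinRoots p i V :=
  i.codRestrict _ map_mem

theorem of_injective (hi : Function.Injective i) : Function.Injective (of (p := p) i V) :=
  fun a b h => hi (congrArg Subtype.val h)

theorem exists_eq_eval₂ [IsDomain L] (x : adjoinRoots p i V) (k : ℕ) :
    ∃ r, k ≤ r ∧ ∃ G : Polynomial P, x = G.eval₂ (of i V) (pRoot p r ⟨V, self_mem⟩) := by
  obtain ⟨r₀, hx⟩ := x.2
  obtain ⟨G, hG⟩ := hx (max k r₀) (le_max_right _ _)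
  refine ⟨max k r₀, le_max_left _ _, G, Subtype.val_injective ?_⟩
  change _ = (adjoinRoots p i V).subtype _
  rw [hG, Polynomial.hom_eval₂, map_pRoot]
  rfl

theorem le_of_eq_mul {b : P} {V' : L} (h : V' = i b * V) :
    adjoinRoots p i V' ≤ adjoinRoots p i V := by
  rintro x ⟨r, hx⟩
  obtain ⟨G, rfl⟩ := hx r le_rfl
  rw [Polynomial.eval₂_eq_sum_range]
  refine sum_mem fun e _ => mul_mem (map_mem _) (pow_mem ?_ _)
  rw [h, pRoot_mul, ← map_pRoot]
  exact mul_mem (map_mem (p := p) _) (pRoot_self_mem _)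

end adjoinRoots

end AdjoinRoots

section

open WittVector Untilt

variable {p : ℕ} [hpp : Fact p.Prime] {P : Type*} [CommRing P] [CharP P p] [PerfectRing P p]

theorem Untilt.map_map {Q Q' : Type*} [CommRing Q] [CommRing Q'] (f : P →+* Q) (f' : P →+* Q')
    (j : Q' →+* Q) (hj : j.comp f' = f) {ϖ : P} {u : (WittVector p P)ˣ} {ϖ₁ : Q}
    {u₁ : (WittVector p Q)ˣ} {ϖ₂ : Q'} {u₂ : (WittVector p Q')ˣ} (hϖ₁ : f ϖ = ϖ₁)
    (hu₁ : WittVector.map f (u : WittVector p P) = (u₁ : WittVector p Q)) (hϖ₂ : j ϖ₂ = ϖ₁)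
    (hu₂ : WittVector.map j (u₂ : WittVector p Q') = (u₁ : WittVector p Q)) (hϖ : f' ϖ = ϖ₂)
    (hu : WittVector.map f' (u : WittVector p P) = (u₂ : WittVector p Q')) (x : Untilt ϖ u) :
    Untilt.map j hϖ₂ hu₂ (Untilt.map f' hϖ hu x) = Untilt.map f hϖ₁ hu₁ x := by
  subst hj
  obtain ⟨w, rfl⟩ := Ideal.Quotient.mk_surjective x
  change Untilt.mk ϖ₁ u₁ (WittVector.map j (WittVector.map f' w)) =
    Untilt.mk ϖ₁ u₁ (WittVector.map (j.comp f') w)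
  congr 1

/-- A perfectoid Riemann extension theorem. -/
theorem Untilt.exists_sharp_pRoot_mul_eq [IsDomain P] {ϖ C : P} (hϖ : ϖ ≠ 0) (hC : C ≠ 0)
    (u : (WittVector p P)ˣ) {H : Untilt ϖ u}
    (hH : ∀ j, ∃ g, H ^ (j + 1) = sharp ϖ u C ^ j * g) (k m : ℕ) :
    ∃ w v, sharp ϖ u (pRoot p k (C * ϖ)) * H = sharp ϖ u C * w + p ^ m * v := by
  obtain ⟨L, _, _, i, hi⟩ : ∃ (L : Type _) (_ : Field L) (_ : IsAlgClosed L) (i : P →+* L),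
      Function.Injective i :=
    ⟨AlgebraicClosure (FractionRing P), inferInstance, inferInstance,
      (algebraMap (FractionRing P) _).comp (algebraMap P _),
      (algebraMap (FractionRing P) (AlgebraicClosure (FractionRing P))).injective.comp
        (IsFractionRing.injective P _)⟩
  haveI : CharP L p := charP_of_injective_ringHom hi p
  haveI : PerfectRing L p := inferInstance
  have hiC : i C ≠ 0 := (map_ne_zero_iff i hi).2 hC
  obtain ⟨a, ha⟩ : ∃ a, a = 2 * m + (k + 1) := ⟨_, rfl⟩
  obtain ⟨n, hn⟩ : ∃ n, n = p ^ a := ⟨_, rfl⟩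
  obtain ⟨n', hn'⟩ : ∃ n', n' = n + m * p ^ (k + 1) := ⟨_, rfl⟩
  obtain ⟨V, hV⟩ : ∃ V, V * i C = i ϖ ^ n := ⟨_, div_mul_cancel₀ _ hiC⟩
  obtain ⟨V', hV'⟩ : ∃ V', V' * i C = i ϖ ^ n' := ⟨_, div_mul_cancel₀ _ hiC⟩
  have hVV : V' = i (ϖ ^ (m * p ^ (k + 1))) * V := by
    refine mul_right_cancel₀ hiC ?_
    rw [hV', mul_assoc, hV, hn', map_pow]; ring
  obtain ⟨f, hf⟩ : ∃ f : P →+* adjoinRoots p i V, f = adjoinRoots.of i V := ⟨_, rfl⟩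
  obtain ⟨f', hf'⟩ : ∃ f' : P →+* adjoinRoots p i V', f' = adjoinRoots.of i V' := ⟨_, rfl⟩
  obtain ⟨j, hj⟩ : ∃ j : adjoinRoots p i V' →+* adjoinRoots p i V, j.comp f' = f :=
    ⟨Subring.inclusion (adjoinRoots.le_of_eq_mul hVV), by rw [hf, hf']; rfl⟩
  have hfi : Function.Injective f := by rw [hf]; exact adjoinRoots.of_injective hi
  have hfi' : Function.Injective f' := by rw [hf']; exact adjoinRoots.of_injective hi
  have hVf : (⟨V, adjoinRoots.self_mem⟩ : adjoinRoots p i V) * f C = f ϖ ^ n := by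
    rw [hf]; exact Subtype.ext hV
  have hVf' : (⟨V', adjoinRoots.self_mem⟩ : adjoinRoots p i V') * f' C = f' ϖ ^ n' := by
    rw [hf']; exact Subtype.ext hV'
  have hjf : ∀ x, j (f' x) = f x := fun x => RingHom.congr_fun hj x
  obtain ⟨u₁, hu₁⟩ : ∃ u₁ : (WittVector p (adjoinRoots p i V))ˣ,
      WittVector.map f (u : WittVector p P) = (u₁ : WittVector p (adjoinRoots p i V)) :=
    ⟨(u.isUnit.map (WittVector.map f)).unit, rfl⟩
  obtain ⟨u₂, hu₂⟩ : ∃ u₂ : (WittVector p (adjoinRoots p i V'))ˣ,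
      WittVector.map f' (u : WittVector p P) = (u₂ : WittVector p (adjoinRoots p i V')) :=
    ⟨(u.isUnit.map (WittVector.map f')).unit, rfl⟩
  have hju : WittVector.map j (u₂ : WittVector p (adjoinRoots p i V')) =
      (u₁ : WittVector p (adjoinRoots p i V)) := by
    rw [← hu₁, ← hu₂]
    ext n
    simp only [map_coeff, hjf]
  have hgen := adjoinRoots.exists_eq_eval₂ (p := p) (i := i) (V := V)
  have hgen' := adjoinRoots.exists_eq_eval₂ (p := p) (i := i) (V := V')
  rw [← hf] at hgen
  rw [← hf'] at hgen'
  obtain ⟨y, hy⟩ := Untilt.exists_sharp_mul_eq f' rfl hu₂ ((map_ne_zero_iff f' hfi').2 hϖ) hH hVf'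
    (n' + k)
  obtain ⟨w, v, hw⟩ := Untilt.exists_map_add f hfi f' j hj hC rfl hu₁ (hjf ϖ) hju hVf
    (hn' ▸ hVf') hgen' y
  obtain ⟨g, hg⟩ : ∃ g, g = sharp ϖ u C * w -
    sharp ϖ u (pRoot p (k + 1) C) * sharp ϖ u (pRoot p (n' + k) ϖ) ^ n' * H := ⟨_, rfl⟩
  have hy' := congrArg (Untilt.map j (hjf ϖ) hju) hy
  rw [map_mul, map_mul, map_pow, Untilt.map_sharp, Untilt.map_sharp, hjf, map_pRoot, hjf,
    Untilt.map_map f f' j hj rfl hu₁] at hy'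
  obtain ⟨g', hg'⟩ := Untilt.exists_sharp_pow_mul_eq f hfi hϖ rfl hu₁ (hn ▸ hVf) hgen m (g := g)
    (b := -(sharp _ u₁ (f C) * v)) (by
      rw [hg, map_sub, map_mul, map_mul, map_mul, map_pow, Untilt.map_sharp, Untilt.map_sharp,
        Untilt.map_sharp, map_pRoot p f (n' + k) ϖ]
      linear_combination sharp (f ϖ) u₁ (f (pRoot p (k + 1) C)) * hy' - sharp (f ϖ) u₁ (f C) * hw)
  obtain ⟨D, hD⟩ : pRoot p a C ^ (2 * m) * (pRoot p (k + 1) C * pRoot p (n' + k) ϖ ^ n') ∣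
      pRoot p k (C * ϖ) := by
    rw [pRoot_mul, ← mul_assoc]
    refine mul_dvd_mul ?_ ?_
    · have h1 : pRoot p a C ^ (2 * m) ∣ pRoot p (k + 1) C := by
        rw [← pRoot_pow_sub p (show k + 1 ≤ a by omega)]
        refine pow_dvd_pow _ ?_
        rw [ha, Nat.add_sub_cancel]
        exact (Nat.lt_pow_self hpp.out.one_lt).le
      refine (mul_dvd_mul h1 dvd_rfl).trans ?_
      rw [← pow_two, ← pRoot_add_pow p k 1, pow_one]
      exact pow_dvd_pow _ hpp.out.two_le
    · rw [← pRoot_pow_sub p (show k ≤ n' + k by omega), Nat.add_sub_cancel]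
      exact pow_dvd_pow _ (Nat.lt_pow_self hpp.out.one_lt).le
  refine ⟨sharp ϖ u D * sharp ϖ u (pRoot p a C) ^ (2 * m) * w, -(sharp ϖ u D * g'), ?_⟩
  rw [hD, map_mul, map_mul, map_mul, map_pow, map_pow]
  rw [hg] at hg'
  linear_combination -sharp ϖ u D * hg'

end

section AdaptedUntilt

open WittVector Untilt

variable {p : ℕ} [hpp : Fact p.Prime]

/-- A system of elements of a perfect domain whose Teichmüller representatives behave like
parameters on an untilt. -/
structure Untilt.IsAdapted {P ι : Type*} [CommRing P] [Fintype ι] (X : ι → P) (ϖ : P)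
    (u : (WittVector p P)ˣ) : Prop where
  syzTriv : SyzTriv ⊥ X
  one_notMem : (1 : P) ∉ Ideal.span (Set.range X)
  mem : ϖ ∈ Ideal.span (Set.range X)
  ne_zero : ϖ ≠ 0
  exists_span_eq : ∃ f : ι → WittVector p P,
    Ideal.span {(p : WittVector p P) - ∑ i, teichmuller p (X i) * f i} =
      Ideal.span {(p : WittVector p P) - teichmuller p ϖ * u}

theorem Untilt.IsAdapted.syzTriv_sharp {P ι : Type*} [CommRing P] [CharP P p] [PerfectRing P p]
    [Fintype ι] {X : ι → P} {ϖ : P} {u : (WittVector p P)ˣ} (h : IsAdapted X ϖ u) :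
    SyzTriv ⊥ fun i => sharp ϖ u (X i) := by
  obtain ⟨f, hf⟩ := h.exists_span_eq
  refine SyzTriv.quotient_iff.2 ?_
  rw [← hf, ← bot_sup_eq (Ideal.span _)]
  exact h.syzTriv.wittVector_append.of_unit_append_sub

theorem Untilt.IsAdapted.one_notMem_sharp {P ι : Type*} [CommRing P] [CharP P p] [PerfectRing P p]
    [Fintype ι] {X : ι → P} {ϖ : P} {u : (WittVector p P)ˣ} (h : IsAdapted X ϖ u) :
    (1 : Untilt ϖ u) ∉ Ideal.span (Set.range fun i => sharp ϖ u (X i)) := by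
  refine one_notMem_span_teichmuller h.one_notMem ?_
  rw [← WittVector.constantCoeff_apply, map_sub, map_mul, map_natCast, CharP.cast_eq_zero,
    zero_sub, WittVector.constantCoeff_apply, teichmuller_coeff_zero]
  exact neg_mem (Ideal.mul_mem_right _ _ h.mem)

universe u₁ u₂ w

theorem Untilt.IsAdapted.exists_root {P : Type w} {ι : Type*} [CommRing P] [IsDomain P] [CharP P p]
    [PerfectRing P p] [Fintype ι] {X : ι → P} {ϖ : P} {u : (WittVector p P)ˣ}
    (h : IsAdapted X ϖ u) {F : Polynomial (Untilt ϖ u)} (hF : F.Monic) (hF0 : F.natDegree ≠ 0) :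
    ∃ (P' : Type w) (_ : CommRing P') (_ : IsDomain P') (_ : CharP P' p) (_ : PerfectRing P' p)
      (X' : ι → P') (ϖ' : P') (u' : (WittVector p P')ˣ) (θ : Untilt ϖ u →+* Untilt ϖ' u'),
      IsAdapted X' ϖ' u' ∧ (∀ i, θ (sharp ϖ u (X i)) = sharp ϖ' u' (X' i)) ∧
        ∃ T, F.eval₂ θ (sharp ϖ' u' T) = 0 := by
  have hl : F ∈ Polynomial.lifts (Untilt.mk ϖ u) := by
    rw [Polynomial.lifts_iff_coeff_lifts]
    exact fun n => Ideal.Quotient.mk_surjective _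
  obtain ⟨G, hGF, hGd, hG⟩ := Polynomial.lifts_and_natDegree_eq_and_monic hl hF
  obtain ⟨P', _, _, _, _, j, hj, hX', h1', T, y, hT⟩ := SyzTriv.exists_perfect_extension_root
    h.syzTriv h.one_notMem h.ne_zero h.mem u hG (hGd ▸ hF0)
  obtain ⟨u', hu'⟩ : ∃ u' : (WittVector p P')ˣ,
      WittVector.map j (u : WittVector p P) = (u' : WittVector p P') :=
    ⟨(u.isUnit.map (WittVector.map j)).unit, rfl⟩
  refine ⟨P', _, ‹_›, ‹_›, ‹_›, fun i => j (X i), j ϖ, u', Untilt.map j rfl hu',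
    ⟨hX', h1', ?_, (map_ne_zero_iff j hj).2 h.ne_zero, ?_⟩, fun i => Untilt.map_sharp _ _ _ _,
    T, ?_⟩
  · have := Ideal.mem_map_of_mem j h.mem
    rwa [Ideal.map_span, ← Set.range_comp] at this
  · obtain ⟨f, hf⟩ := h.exists_span_eq
    refine ⟨fun i => WittVector.map j (f i), ?_⟩
    have := congrArg (Ideal.map (WittVector.map (p := p) j)) hf
    rw [Ideal.map_span, Ideal.map_span, Set.image_singleton, Set.image_singleton, map_sub, map_sub,
      map_sum, map_natCast, map_mul, map_teichmuller, hu'] at this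
    simpa only [map_mul, map_teichmuller] using this
  · rw [← hGF, Polynomial.eval₂_map]
    have h2 : (Untilt.map j rfl hu').comp (Untilt.mk ϖ u) =
        (Untilt.mk (j ϖ) u').comp (WittVector.map j) := RingHom.ext fun _ => rfl
    rw [h2]
    change G.eval₂ ((Untilt.mk (j ϖ) u').comp (WittVector.map j))
      (Untilt.mk (j ϖ) u' (teichmuller p T)) = 0
    rw [← Polynomial.hom_eval₂, hT, hu', Ideal.Quotient.eq_zero_iff_mem]
    exact Ideal.mul_mem_left _ _ (Ideal.mem_span_singleton_self _)

theorem Untilt.IsAdapted.exists_eval₂_eq_zero {P : Type w} {ι A : Type*} [CommRing P] [IsDomain P]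
    [CharP P p] [PerfectRing P p] [Fintype ι] [CommRing A] {X : ι → P} {ϖ : P}
    {u : (WittVector p P)ˣ} (h : IsAdapted X ϖ u) (x : ι → A) (g : A →+* Untilt ϖ u)
    (hg : ∀ i, g (x i) = sharp ϖ u (X i)) {F : Polynomial A} (hF : F.Monic)
    (hF0 : F.natDegree ≠ 0) :
    ∃ (P' : Type w) (_ : CommRing P') (_ : IsDomain P') (_ : CharP P' p) (_ : PerfectRing P' p)
      (X' : ι → P') (ϖ' : P') (u' : (WittVector p P')ˣ) (θ : Untilt ϖ u →+* Untilt ϖ' u'),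
      IsAdapted X' ϖ' u' ∧ (∀ i, θ (g (x i)) = sharp ϖ' u' (X' i)) ∧
        ∃ T, F.eval₂ (θ.comp g) (sharp ϖ' u' T) = 0 := by
  have hn : Nontrivial (Untilt ϖ u) := by
    refine ⟨1, 0, fun h0 => h.one_notMem_sharp ?_⟩
    rw [h0]
    exact zero_mem _
  have hd : (F.map g).natDegree ≠ 0 := by
    rw [hF.natDegree_map]
    exact hF0
  obtain ⟨P', i1, i2, i3, i4, X', ϖ', u', θ, h', hθ, T, hT⟩ := h.exists_root (hF.map g) hd
  refine ⟨P', i1, i2, i3, i4, X', ϖ', u', θ, h', fun i => ?_, T, ?_⟩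
  · rw [hg, hθ]
  · rw [Polynomial.eval₂_map] at hT
    exact hT

theorem SyzTriv.exists_untilt {A : Type u₁} {ι : Type u₂} [CommRing A] [IsLocalRing A] [IsNoetherianRing A]
    [Fintype ι] {x : ι → A} (hx : SyzTriv ⊥ x) (hm : Ideal.span (Set.range x) = IsLocalRing.maximalIdeal A)
    (hp : (p : A) ∈ IsLocalRing.maximalIdeal A) (hp0 : (p : A) ≠ 0) {F : Polynomial A} (hF : F.Monic)
    (hF0 : F.natDegree ≠ 0) (c : A) :
    ∃ (P : Type (max u₁ u₂)) (_ : CommRing P) (_ : IsDomain P) (_ : CharP P p) (_ : PerfectRing P p)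
      (ϖ : P) (u : (WittVector p P)ˣ) (g : A →+* Untilt ϖ u), ϖ ≠ 0 ∧
      SyzTriv ⊥ (fun i => g (x i)) ∧ (1 : Untilt ϖ u) ∉ Ideal.span (Set.range fun i => g (x i)) ∧
      (∃ T, F.eval₂ g T = 0) ∧ ∃ C, sharp ϖ u C = g c := by
  obtain ⟨P, _, _, _, _, X, ϖ, u, g, hX, hX1, hϖ, hϖ0, hg, hf⟩ :=
    SyzTriv.exists_wittVector_hom hx hm p hp hp0
  have h₀ : Untilt.IsAdapted X ϖ u := ⟨hX, hX1, hϖ, hϖ0, hf⟩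
  obtain ⟨P₁, _, _, _, _, X₁, ϖ₁, u₁, θ₁, h₁, hθ₁, T, hT⟩ :=
    h₀.exists_eval₂_eq_zero x g hg hF hF0
  obtain ⟨P₂, _, _, _, _, X₂, ϖ₂, u₂, θ₂, h₂, hθ₂, C, hC⟩ :=
    h₁.exists_eval₂_eq_zero x (θ₁.comp g) hθ₁ (Polynomial.monic_X_sub_C c) (by
      haveI : Nontrivial A := inferInstance
      rw [Polynomial.natDegree_X_sub_C]
      exact one_ne_zero)
  obtain ⟨g₂, hg₂⟩ : ∃ g₂ : A →+* Untilt ϖ₂ u₂, g₂ = θ₂.comp (θ₁.comp g) := ⟨_, rfl⟩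
  have hgx : (fun i => g₂ (x i)) = fun i => sharp ϖ₂ u₂ (X₂ i) := funext fun i => by
    rw [hg₂]
    exact hθ₂ i
  refine ⟨P₂, _, ‹_›, ‹_›, ‹_›, ϖ₂, u₂, g₂, h₂.ne_zero, ?_, ?_, ⟨θ₂ (sharp ϖ₁ u₁ T), ?_⟩, C, ?_⟩
  · rw [hgx]
    exact h₂.syzTriv_sharp
  · rw [hgx]
    exact h₂.one_notMem_sharp
  · rw [hg₂, ← Polynomial.hom_eval₂, hT, map_zero]
  · rw [← hg₂, Polynomial.eval₂_sub, Polynomial.eval₂_X, Polynomial.eval₂_C, sub_eq_zero] at hC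
    exact hC

end AdaptedUntilt

section PrimitiveData

open Polynomial

universe w

theorem exists_integral_primitive_element (A K L : Type*) [CommRing A] [Field K] [Field L]
    [Algebra A K] [Algebra A L] [Algebra K L] [IsScalarTower A K L] [IsFractionRing A K] [IsDomain A]
    [FiniteDimensional K L] [Algebra.IsSeparable K L] :
    ∃ θ : L, IsIntegral A θ ∧ ∀ z : L, ∃ c : A, c ≠ 0 ∧ ∃ G : A[X], algebraMap A L c * z = aeval θ G := by
  obtain ⟨α, hα⟩ := Field.exists_primitive_element K L
  obtain ⟨⟨y, hy⟩, hyα⟩ := IsIntegral.exists_multiple_integral_of_isLocalization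
    (nonZeroDivisors A) α (Algebra.IsIntegral.isIntegral (R := K) α)
  have hy0 : algebraMap A K y ≠ 0 :=
    (map_ne_zero_iff _ (IsFractionRing.injective A K)).2 (nonZeroDivisors.ne_zero hy)
  refine ⟨y • α, hyα, fun z => ?_⟩
  have hα' : Algebra.adjoin K {y • α} = ⊤ := by
    rw [eq_top_iff, ← IntermediateField.top_toSubalgebra (F := K) (E := L), ← hα,
      IntermediateField.adjoin_simple_toSubalgebra_of_isAlgebraic
        (Algebra.IsAlgebraic.isAlgebraic (R := K) α), Algebra.adjoin_le_iff, Set.singleton_subset_iff]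
    have h : α = (algebraMap A K y)⁻¹ • (y • α) := by
      rw [← algebraMap_smul K y α, smul_smul, inv_mul_cancel₀ hy0, one_smul]
    have h' := (Algebra.adjoin K {y • α}).smul_mem
      (Algebra.self_mem_adjoin_singleton K (y • α)) (algebraMap A K y)⁻¹
    rwa [← h] at h'
  have hz : z ∈ Algebra.adjoin K {y • α} := by
    rw [hα']
    exact Algebra.mem_top
  rw [Algebra.adjoin_singleton_eq_range_aeval] at hz
  obtain ⟨q, rfl⟩ := hz
  obtain ⟨b, hb₁, hb₂⟩ := IsLocalization.integerNormalization_spec (nonZeroDivisors A) q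
  refine ⟨b, nonZeroDivisors.ne_zero hb₁, IsLocalization.integerNormalization (nonZeroDivisors A) q, ?_⟩
  rw [← aeval_map_algebraMap K, hb₂, ← Algebra.smul_def, ← algebraMap_smul K b q, map_smul,
    algebraMap_smul]
  rfl

theorem exists_eval₂_lift {A R : Type*} [CommRing A] [CommRing R] [Algebra A R] [IsDomain A] [IsDomain R]
    [IsIntegrallyClosed A] [CharZero A] [Module.Finite A R]
    (hinj : Function.Injective (algebraMap A R)) :
    ∃ c : A, c ≠ 0 ∧ ∃ F : A[X], F.Monic ∧ F.natDegree ≠ 0 ∧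
      ∀ {B : Type w} [CommRing B] (φ : A →+* B) (T : B), F.eval₂ φ T = 0 →
        ∃ ρ : R → B, ρ 1 = φ c ∧ (∀ r s, ρ (r + s) = ρ r + ρ s) ∧
          (∀ r s, φ c * ρ (r * s) = ρ r * ρ s) ∧ ∀ a r, ρ (algebraMap A R a * r) = φ a * ρ r := by
  have : FaithfulSMul A R := (faithfulSMul_iff_algebraMap_injective A R).2 hinj
  let K := FractionRing A
  let L := FractionRing R
  letI : Algebra K L := FractionRing.liftAlgebra A L
  haveI : IsScalarTower A K L := FractionRing.isScalarTower_liftAlgebra A L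
  haveI : FiniteDimensional K L := .of_isLocalization A R (nonZeroDivisors A)
  haveI : CharZero K := charZero_of_injective_algebraMap (IsFractionRing.injective A K)
  obtain ⟨θ, hθ, hz⟩ := exists_integral_primitive_element A K L
  have hc : ∃ c : A, c ≠ 0 ∧ ∀ r : R, ∃ G : A[X],
      algebraMap A L c * algebraMap R L r = aeval θ G := by
    obtain ⟨S, hS⟩ := Module.Finite.fg_top (R := A) (M := R)
    choose c hc0 G hG using hz
    classical
    refine ⟨∏ s ∈ S, c (algebraMap R L s), Finset.prod_ne_zero_iff.2 fun s _ => hc0 _, fun r => ?_⟩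
    have hr : r ∈ Submodule.span A (S : Set R) := hS ▸ Submodule.mem_top
    induction hr using Submodule.span_induction with
    | mem s hs =>
      refine ⟨C (∏ t ∈ S.erase s, c (algebraMap R L t)) * G (algebraMap R L s), ?_⟩
      rw [← Finset.prod_erase_mul S _ hs, map_mul, map_mul, aeval_C, ← hG, mul_assoc]
    | zero => exact ⟨0, by rw [map_zero, map_zero, mul_zero]⟩
    | add r s _ _ hr hs =>
      obtain ⟨G₁, h₁⟩ := hr
      obtain ⟨G₂, h₂⟩ := hs
      exact ⟨G₁ + G₂, by rw [map_add, map_add, mul_add, h₁, h₂]⟩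
    | smul a r _ hr =>
      obtain ⟨G₁, h₁⟩ := hr
      exact ⟨C a * G₁, by rw [map_mul, aeval_C, ← h₁, Algebra.smul_def, map_mul,
        ← IsScalarTower.algebraMap_apply]; ring⟩
  obtain ⟨c, hc0, hc⟩ := hc
  choose h hh using hc
  refine ⟨c, hc0, minpoly A θ, minpoly.monic hθ, (minpoly.natDegree_pos hθ).ne', ?_⟩
  intro B _ φ T hT
  have key : ∀ G H : A[X], aeval θ G = aeval θ H → G.eval₂ φ T = H.eval₂ φ T := by
    intro G H hGH
    rw [← sub_eq_zero, ← map_sub] at hGH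
    obtain ⟨D, hD⟩ := minpoly.isIntegrallyClosed_dvd hθ hGH
    rw [← sub_eq_zero, ← eval₂_sub, hD, eval₂_mul, hT, zero_mul]
  refine ⟨fun r => (h r).eval₂ φ T, ?_, fun r s => ?_, fun r s => ?_, fun a r => ?_⟩
  · beta_reduce
    rw [key _ (C c) (by rw [← hh, map_one, mul_one, aeval_C]), eval₂_C]
  · beta_reduce
    rw [← eval₂_add]
    refine key _ _ ?_
    rw [map_add, ← hh, ← hh, ← hh, map_add, mul_add]
  · beta_reduce
    rw [← eval₂_C φ T (a := c), ← eval₂_mul, ← eval₂_mul]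
    refine key _ _ ?_
    rw [map_mul, map_mul, ← hh, ← hh, ← hh, map_mul, aeval_C]
    ring
  · beta_reduce
    rw [← eval₂_C φ T (a := a), ← eval₂_mul]
    refine key _ _ ?_
    rw [map_mul, ← hh, ← hh, map_mul, aeval_C, ← IsScalarTower.algebraMap_apply]
    ring

end PrimitiveData

section MixedCharacteristic

open IsLocalRing Untilt

theorem IsLocalRing.exists_forall_mul_mem_maximalIdeal_pow {A : Type*} [CommRing A] [IsDomain A]
    [IsNoetherianRing A] [IsLocalRing A] {c : A} (hc : c ≠ 0) (k : ℕ) :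
    ∃ l, ∀ a, a * c ∈ maximalIdeal A ^ l → a ∈ maximalIdeal A ^ k := by
  obtain ⟨r, hr⟩ := Ideal.exists_pow_inf_eq_pow_smul (maximalIdeal A) (M := A) (Ideal.span {c})
  refine ⟨r + k, fun a ha => ?_⟩
  have h1 : a * c ∈ maximalIdeal A ^ (r + k) • (⊤ : Submodule A A) ⊓ Ideal.span {c} :=
    ⟨by rwa [smul_eq_mul, Ideal.mul_top], Ideal.mul_mem_left _ _ (Ideal.mem_span_singleton_self c)⟩
  rw [hr _ (Nat.le_add_right r k), Nat.add_sub_cancel_left] at h1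
  have h2 : a * c ∈ maximalIdeal A ^ k * Ideal.span {c} :=
    Submodule.smul_mono le_rfl inf_le_right h1
  obtain ⟨b, hb, hbc⟩ := Ideal.mem_mul_span_singleton.1 h2
  rwa [← mul_right_cancel₀ hc hbc]

theorem mul_prod_pow_mem_span {A ι : Type*} [CommRing A] [Fintype ι] (x : ι → A) {t l : ℕ} (h : t ≤ l)
    {a : A} (ha : a ∈ Ideal.span (Set.range fun i => x i ^ t)) :
    a * ∏ i, x i ^ (l - t) ∈ Ideal.span (Set.range fun i => x i ^ l) := by
  induction ha using Submodule.span_induction with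
  | mem a ha =>
    obtain ⟨i, rfl⟩ := ha
    classical
    beta_reduce
    rw [← Finset.mul_prod_erase _ _ (Finset.mem_univ i), ← mul_assoc, ← pow_add,
      Nat.add_sub_cancel' h]
    exact Ideal.mul_mem_right _ _ (Ideal.subset_span (Set.mem_range_self i))
  | zero => rw [zero_mul]; exact zero_mem _
  | add a b _ _ ha hb => rw [add_mul]; exact add_mem ha hb
  | smul r a _ ha => rw [smul_eq_mul, mul_assoc]; exact Ideal.mul_mem_left _ _ ha

theorem map_span_range_pow {A B ι : Type*} [CommRing A] [CommRing B] (x : ι → A) (g : A →+* B)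
    (t : ℕ) : (Ideal.span (Set.range fun i => x i ^ t)).map g =
      Ideal.span (Set.range fun i => g (x i) ^ t) := by
  rw [Ideal.map_span, ← Set.range_comp]
  congr 2
  funext i
  exact map_pow g _ _

/-- If the images of parameters behave like parameters, then multiplication by a nonzero element
is Artin-Rees injective uniformly over the target. -/
theorem SyzTriv.exists_forall_mul_map_mem {A : Type*} {ι : Type*} [CommRing A] [IsDomain A]
    [IsNoetherianRing A] [IsLocalRing A] [Fintype ι] {x : ι → A} (hx : SyzTriv ⊥ x)
    (hm : Ideal.span (Set.range x) = maximalIdeal A) {c : A} (hc : c ≠ 0) (t : ℕ) :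
    ∃ l, ∀ {B : Type*} [CommRing B] (g : A →+* B), SyzTriv ⊥ (fun i => g (x i)) → ∀ U : B,
      g c * U ∈ Ideal.span (Set.range fun i => g (x i) ^ l) →
        U ∈ Ideal.span (Set.range fun i => g (x i) ^ t) := by
  obtain ⟨k, hk⟩ := exists_maximalIdeal_pow_le hm t
  obtain ⟨l, hl⟩ := exists_forall_mul_mem_maximalIdeal_pow hc k
  refine ⟨l + t + 1, fun {B} _ g hg U hU => ?_⟩
  have h0 : Ideal.span (Set.range fun i => x i ^ (l + t + 1)) ≤ maximalIdeal A ^ l := by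
    rw [Ideal.span_le]
    rintro _ ⟨i, rfl⟩
    refine Ideal.pow_le_pow_right (by omega : l ≤ l + t + 1) (Ideal.pow_mem_pow ?_ _)
    rw [← hm]
    exact Ideal.subset_span (Set.mem_range_self i)
  have h1 := hx.mem_of_annihilator_le (t := l + t + 1) (by omega) hm c
    (∏ i, x i ^ (l + t + 1 - t)) fun a ha =>
      mul_prod_pow_mem_span x (by omega) (hk (hl a (h0 ha)))
  have h2 := Ideal.mem_map_of_mem g h1
  rw [Ideal.map_sup, map_span_range_pow, Ideal.map_span, Set.image_singleton, map_prod,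
    Submodule.mem_sup] at h2
  obtain ⟨_, hb, y, hy, hby⟩ := h2
  obtain ⟨b, rfl⟩ := Ideal.mem_span_singleton'.1 hb
  have h3 := hg.colon (fun _ => l + t + 1 - t) (fun _ => l + t + 1) (fun _ => by omega) (v := U) (by
    simp only [map_pow] at hby
    rw [bot_sup_eq, ← hby, add_mul, mul_assoc]
    exact add_mem (Ideal.mul_mem_left _ _ hU) (Ideal.mul_mem_right _ _ hy))
  rw [bot_sup_eq] at h3
  simpa only [show l + t + 1 - (l + t + 1 - t) = t by omega] using h3

theorem SyzTriv.prod_notMem_of_mixed {A : Type*} {R : Type*} {ι : Type*} [CommRing A]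
    [CommRing R] [Algebra A R] [IsDomain A] [IsDomain R] [IsNoetherianRing A] [IsLocalRing A]
    [IsIntegrallyClosed A] [CharZero A] [Module.Finite A R] [Fintype ι]
    (hinj : Function.Injective (algebraMap A R)) {x : ι → A} (hx : SyzTriv (⊥ : Ideal A) x)
    (hm : Ideal.span (Set.range x) = maximalIdeal A) (p : ℕ) [hpp : Fact p.Prime]
    (hp : (p : A) ∈ maximalIdeal A) {t : ℕ} (ht : 1 ≤ t) :
    ∏ i, x i ^ (t - 1) ∉ ((Ideal.span (Set.range fun i => x i ^ t)).map (algebraMap A R)).comap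
      (algebraMap A R) := by
  intro hz
  have hp0 : (p : A) ≠ 0 := Nat.cast_ne_zero.2 hpp.out.ne_zero
  obtain ⟨c, hc0, F, hF, hF0, hρ⟩ := exists_eval₂_lift hinj
  obtain ⟨P, _, _, _, _, ϖ, u, g, hϖ, hg, hg1, ⟨T, hT⟩, C, hC⟩ :=
    hx.exists_untilt hm hp hp0 hF hF0 c
  obtain ⟨ρ, hρ1, hρadd, hρmul, hρsmul⟩ := hρ g T hT
  have hC0 : C ≠ 0 := by
    rintro rfl
    refine hc0 (hx.eq_zero_of_map_mem hm g hg hg1 fun e _ => ?_)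
    have h0 : mk ϖ u (WittVector.teichmuller p 0) = g c := hC
    rw [← h0, WittVector.teichmuller_zero, map_zero]
    exact zero_mem _
  rw [Ideal.mem_comap, map_span_range_pow] at hz
  obtain ⟨r, hr⟩ := (Ideal.mem_span_range_iff_exists_fun).1 hz
  have hρsum : ∀ S : Finset ι, ρ (∑ i ∈ S, r i * algebraMap A R (x i) ^ t) =
      ∑ i ∈ S, g (x i) ^ t * ρ (r i) := by
    classical
    intro S
    induction S using Finset.induction_on with
    | empty =>
      rw [Finset.sum_empty, Finset.sum_empty]
      have := hρadd 0 0
      rwa [add_zero, left_eq_add] at this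
    | insert i S hi ih =>
      rw [Finset.sum_insert hi, Finset.sum_insert hi, hρadd, ih, mul_comm (r i), ← map_pow, hρsmul,
        map_pow]
  have hH : ∀ i j, ∃ h, ρ (r i) ^ (j + 1) = sharp ϖ u C ^ j * h := by
    intro i j
    refine ⟨ρ (r i ^ (j + 1)), ?_⟩
    rw [hC]
    induction j with
    | zero => rw [zero_add, pow_one, pow_one, pow_zero, one_mul]
    | succ j ih =>
      rw [pow_succ, ih, pow_succ (g c), pow_succ (r i) (j + 1), mul_assoc, mul_assoc, hρmul]
  have hz1 : g c * g (∏ i, x i ^ (t - 1)) = ∑ i, g (x i) ^ t * ρ (r i) := by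
    rw [← hρsum, hr, ← mul_one (algebraMap A R _), hρsmul, hρ1, mul_comm]
  obtain ⟨l, hl⟩ := hx.exists_forall_mul_map_mem hm hc0 t
  obtain ⟨m, hml⟩ := exists_maximalIdeal_pow_le hm l
  have hpm : (p : Untilt ϖ u) ^ m ∈ Ideal.span (Set.range fun i => g (x i) ^ l) := by
    rw [← map_span_range_pow, ← map_natCast g, ← map_pow]
    exact Ideal.mem_map_of_mem g (hml (Ideal.pow_mem_pow hp m))
  have hs : ∀ k, sharp ϖ u (pRoot p k (C * ϖ)) ∈ Ideal.span (Set.range fun i => g (x i)) := by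
    intro k
    obtain ⟨s, hs⟩ : ∃ s, s = sharp ϖ u (pRoot p k (C * ϖ)) := ⟨_, rfl⟩
    have hw : ∀ i, ∃ w v, s * ρ (r i) = g c * w + (p : Untilt ϖ u) ^ m * v := by
      intro i
      rw [hs, ← hC]
      exact Untilt.exists_sharp_pRoot_mul_eq hϖ hC0 u (hH i) k m
    choose w v hwv using hw
    rw [← hs]
    have h1 : g c * (s * g (∏ i, x i ^ (t - 1)) - ∑ i, g (x i) ^ t * w i) ∈
        Ideal.span (Set.range fun i => g (x i) ^ l) := by
      have : g c * (s * g (∏ i, x i ^ (t - 1)) - ∑ i, g (x i) ^ t * w i) =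
          (p : Untilt ϖ u) ^ m * ∑ i, g (x i) ^ t * v i := by
        rw [mul_sub, mul_left_comm, hz1, Finset.mul_sum, Finset.mul_sum, Finset.mul_sum,
          ← Finset.sum_sub_distrib]
        refine Finset.sum_congr rfl fun i _ => ?_
        linear_combination g (x i) ^ t * hwv i
      rw [this]
      exact Ideal.mul_mem_right _ _ hpm
    have h2 := hl g hg _ h1
    have h3 : s * g (∏ i, x i ^ (t - 1)) ∈ Ideal.span (Set.range fun i => g (x i) ^ t) := by
      refine (Submodule.sub_mem_iff_left _ (Ideal.sum_mem _ fun i _ => ?_)).1 h2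
      exact Ideal.mul_mem_right _ _ (Ideal.subset_span (Set.mem_range_self i))
    have h4 := hg.colon (fun _ => t - 1) (fun _ => t) (fun _ => Nat.sub_le _ _) (v := s) (by
      rw [map_prod, mul_comm s] at h3
      simp only [map_pow] at h3
      rwa [bot_sup_eq])
    rw [bot_sup_eq] at h4
    simpa only [Nat.sub_sub_self ht, pow_one] using h4
  refine mul_ne_zero hc0 hp0 (hx.eq_zero_of_map_mem hm g hg hg1 fun e he => ?_)
  obtain ⟨k, hk⟩ := exists_maximalIdeal_pow_le hm e
  have h1 := Ideal.pow_mem_pow (hs k) (p ^ k)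
  rw [← map_pow, pRoot_pow, map_mul, hC, sharp_eq] at h1
  have h2 : g (c * p) = g c * ((p : Untilt ϖ u) * mk ϖ u ↑u⁻¹) * mk ϖ u u := by
    rw [map_mul, map_natCast, mul_assoc, mul_assoc, ← map_mul, Units.inv_mul, map_one, mul_one]
  rw [h2]
  refine Ideal.mul_mem_right _ _ ?_
  have h3 : Ideal.span (Set.range fun i => g (x i)) = (maximalIdeal A).map g := by
    rw [← hm, Ideal.map_span, ← Set.range_comp]
    rfl
  rw [h3] at h1
  have h4 := Ideal.pow_le_pow_right (Nat.lt_pow_self hpp.out.one_lt (n := k)).le h1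
  rw [← Ideal.map_pow] at h4
  rw [← map_span_range_pow]
  exact Ideal.map_mono hk h4

end MixedCharacteristic

section DirectSummand

open IsLocalRing

theorem exists_splitting_of_isLocalRing {A R : Type*} [CommRing A] [CommRing R] [IsLocalRing A]
    [IsNoetherianRing A] [Algebra A R] [Module.Finite A R] (hinj : Function.Injective (algebraMap A R))
    [IsDomain A] [IsIntegrallyClosed A] {ι : Type*} [Fintype ι] {x : ι → A} (hx : SyzTriv ⊥ x)
    (hm : Ideal.span (Set.range x) = maximalIdeal A) : ∃ π : R →ₗ[A] A, π 1 = 1 := by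
  obtain ⟨Q, hQ, hQinj⟩ := exists_prime_comap_eq_bot hinj
  suffices ∃ π : (R ⧸ Q) →ₗ[A] A, π 1 = 1 by
    obtain ⟨π, hπ⟩ := this
    exact ⟨π ∘ₗ (Ideal.Quotient.mkₐ A Q).toLinearMap, by simpa using hπ⟩
  by_cases hu : ∀ n : ℕ, n ≠ 0 → IsUnit (n : A)
  · exact exists_splitting_of_isIntegrallyClosed hQinj hu
  · obtain ⟨p, hp, hpm⟩ : ∃ p : ℕ, p.Prime ∧ (p : A) ∈ maximalIdeal A := by
      by_contra! h
      refine hu fun n hn => ?_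
      induction n using Nat.recOnMul with
      | zero => exact absurd rfl hn
      | one => rw [Nat.cast_one]; exact isUnit_one
      | prime p hp => exact not_not.1 (h p hp)
      | mul a b ha hb =>
        rw [Nat.cast_mul]
        exact (ha (left_ne_zero_of_mul hn)).mul (hb (right_ne_zero_of_mul hn))
    haveI : Fact p.Prime := ⟨hp⟩
    by_cases hp0 : (p : A) = 0
    · haveI : CharP A p := (CharP.charP_iff_prime_eq_zero hp).2 hp0
      exact hx.exists_splitting hm fun t ht => hx.prod_notMem_of_charP hQinj hm p ht
    · haveI : CharZero A := by
        rcases CharP.exists' A with h | ⟨q, hq, hqA⟩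
        · exact h
        · exfalso
          have hqm : (q : A) ∈ maximalIdeal A := by
            rw [CharP.cast_eq_zero]
            exact zero_mem _
          have hne : p ≠ q := by
            rintro rfl
            exact hp0 (CharP.cast_eq_zero A p)
          have hco : IsCoprime (p : A) (q : A) :=
            Nat.Coprime.cast ((Nat.coprime_primes hp hq.out).2 hne)
          obtain ⟨a, b, hab⟩ := hco
          exact (Ideal.ne_top_iff_one _).1 (maximalIdeal.isMaximal A).ne_top
            (hab ▸ add_mem (Ideal.mul_mem_left _ _ hpm) (Ideal.mul_mem_left _ _ hqm))
      exact hx.exists_splitting hm fun t ht => hx.prod_notMem_of_mixed hQinj hm p hpm ht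

theorem isIntegrallyClosed_localization_of_regular {A : Type*} [CommRing A] [IsNoetherianRing A]
    (h : ∀ (P : Ideal A) [P.IsPrime], IsRegularLocal (Localization.AtPrime P))
    (P : Ideal A) [P.IsPrime] [IsDomain (Localization.AtPrime P)] :
    IsIntegrallyClosed (Localization.AtPrime P) := by
  haveI : IsNoetherianRing (Localization.AtPrime P) :=
    IsLocalization.isNoetherianRing P.primeCompl _ inferInstance
  refine isIntegrallyClosed_of_regular fun q hq => ?_
  exact (h (q.comap (algebraMap A (Localization.AtPrime P)))).of_ringEquiv
    (IsLocalization.localizationLocalizationAtPrimeIsoLocalization P.primeCompl q).toRingEquiv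

/-- The direct summand theorem: if `A → R` is a finite extension of Noetherian rings
(injective, with `R` a finitely generated `A`-module) and `A` is regular (all of its
localizations at primes are regular local rings), then `A → R` splits as a map of
`A`-modules. -/
theorem direct_summand_theorem {A R : Type*} [CommRing A] [CommRing R]
    [IsNoetherianRing A] [IsNoetherianRing R] [Algebra A R]
    (hinj : Function.Injective (algebraMap A R)) [Module.Finite A R]
    (hreg : ∀ (P : Ideal A) [P.IsPrime], IsRegularLocal (Localization.AtPrime P)) :
    ∃ π : R →ₗ[A] A, ∀ a : A, π (algebraMap A R a) = a := by
  suffices ∃ π : R →ₗ[A] A, π 1 = 1 by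
    obtain ⟨π, hπ⟩ := this
    exact ⟨π, fun a => by rw [Algebra.algebraMap_eq_smul_one, map_smul, hπ, smul_eq_mul, mul_one]⟩
  refine exists_splitting_of_localization fun P hP => ?_
  obtain ⟨_, d, x, hm, hx⟩ := (hreg P).exists_parameters
  haveI := (hreg P).1
  haveI := isIntegrallyClosed_localization_of_regular hreg P
  haveI : Module.Finite (Localization.AtPrime P)
      (Localization (Algebra.algebraMapSubmonoid R P.primeCompl)) :=
    .of_isLocalization A R P.primeCompl
  refine exists_splitting_of_isLocalRing ?_ hx hm
  exact localizationAlgebra_injective _ _ hinj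

end DirectSummand
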